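/- There exist positive constants C₀, C₁, C₂, C₃ and T₀ > 0 such that for every T ≥ T₀ there are natural numbers M, m, K₁ with M even, 2m < M and 4K₁ < M, satisfying: (i) C₀ T ≤ log M ≤ C₁ T; (ii) K₁ ≥ C₂ · √T/(log T)²; (iii) r_{3,3}(m+k, M) ≤ M²/(2K₁) for all 0 ≤ k < K₁; (iv) r_{3,3}(m′, M) ≤ (log T)^{C₃} · M² for all m′ ∈ ℤ. -/

import Mathlib

/-- `rmod3 m M` is the number of triples `(x₁,x₂,x₃) ∈ (ℤ/MΖ)³` with
`x₁³ + x₂³ + x₃³ ≡ m (mod M)`. -/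
noncomputable def rmod3 (m : ℤ) (M : ℕ) : ℕ :=
  Nat.card {x : Fin 3 → ZMod M // ∑ i, (x i) ^ 3 = (m : ZMod M)}

open Finset

open scoped QuadraticAlgebra

set_option linter.unusedSectionVars false

section MertensAnalysis

/-- Summation by parts against the partial sums of `a`. -/
lemma sum_mul_by_parts (a f : ℕ → ℂ) (L : ℂ) (N : ℕ) :
    ∑ n ∈ Ioc 0 N, a n * f n = (∑ n ∈ Ioc 0 N, a n - L) * f (N + 1) +
      ∑ n ∈ Ioc 0 N, (∑ k ∈ Ioc 0 n, a k - L) * (f n - f (n + 1)) + L * f 1 := by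
  induction N with
  | zero => simp
  | succ N ih =>
    rw [sum_Ioc_succ_top (by omega), ih, sum_Ioc_succ_top (by omega) a,
      sum_Ioc_succ_top (by omega) (fun n => (∑ k ∈ Ioc 0 n, a k - L) * (f n - f (n + 1))),
      sum_Ioc_succ_top (by omega) a]
    ring

lemma norm_sum_Ioc_le_telescope {h : ℕ → ℂ} {t : ℕ → ℝ}
    (hh : ∀ n, 1 ≤ n → ‖h n‖ ≤ t n - t (n + 1)) {M N : ℕ} (hMN : M ≤ N) :
    ‖∑ n ∈ Ioc 0 N, h n - ∑ n ∈ Ioc 0 M, h n‖ ≤ t (M + 1) - t (N + 1) := by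
  induction N, hMN using Nat.le_induction with
  | base => simp
  | succ N hN ih =>
    rw [sum_Ioc_succ_top (by omega)]
    have h1 := hh (N + 1) (by omega)
    calc _ = ‖(∑ n ∈ Ioc 0 N, h n - ∑ n ∈ Ioc 0 M, h n) + h (N + 1)‖ := by congr 1; ring
      _ ≤ _ := (norm_add_le _ _).trans (by linarith)

lemma exists_sum_limit_of_telescope {h : ℕ → ℂ} {t : ℕ → ℝ} (ht : ∀ n, 0 ≤ t n)
    (hh : ∀ n, 1 ≤ n → ‖h n‖ ≤ t n - t (n + 1)) :
    ∃ L : ℂ, ∀ N, ‖∑ n ∈ Ioc 0 N, h n - L‖ ≤ t (N + 1) := by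
  have hanti : Antitone fun n => t (n + 1) := antitone_nat_of_succ_le fun n => by
    have := (norm_nonneg _).trans (hh (n + 1) (by omega)); linarith
  have hbdd : BddBelow (Set.range fun n => t (n + 1)) := ⟨0, by rintro _ ⟨n, rfl⟩; exact ht _⟩
  have htend := tendsto_atTop_ciInf hanti hbdd
  have hcauchy : CauchySeq fun N => ∑ n ∈ Ioc 0 N, h n := by
    have hc := htend.cauchySeq
    rw [Metric.cauchySeq_iff'] at hc ⊢
    intro ε hε
    obtain ⟨N, hN⟩ := hc ε hε
    refine ⟨N, fun n hn => ?_⟩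
    rw [dist_eq_norm]
    refine (norm_sum_Ioc_le_telescope hh hn).trans_lt ?_
    have := hN n hn
    rw [Real.dist_eq, abs_lt] at this
    linarith [this.1]
  obtain ⟨L, hL⟩ := cauchySeq_tendsto_of_complete hcauchy
  refine ⟨L, fun N => ?_⟩
  have h1 : Filter.Tendsto (fun M => ‖∑ n ∈ Ioc 0 N, h n - ∑ n ∈ Ioc 0 M, h n‖) Filter.atTop
      (nhds ‖∑ n ∈ Ioc 0 N, h n - L‖) := (tendsto_const_nhds.sub hL).norm
  refine le_of_tendsto h1 (Filter.eventually_atTop.2 ⟨N, fun M hM => ?_⟩)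
  rw [norm_sub_rev]
  linarith [norm_sum_Ioc_le_telescope hh hM, ht (M + 1)]

lemma sqrt_mul_inv_sub_inv_le {n : ℕ} (hn : 1 ≤ n) :
    √(n : ℝ) * ((n : ℝ)⁻¹ - ((n : ℝ) + 1)⁻¹) ≤ 2 / √(n : ℝ) - 2 / √((n : ℝ) + 1) := by
  have hn' : (1 : ℝ) ≤ n := by exact_mod_cast hn
  obtain ⟨x, hx, hx2⟩ : ∃ x : ℝ, 0 < x ∧ x ^ 2 = n :=
    ⟨√n, Real.sqrt_pos.2 (by linarith), Real.sq_sqrt (by linarith)⟩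
  obtain ⟨y, hy, hy2⟩ : ∃ y : ℝ, 0 < y ∧ y ^ 2 = (n : ℝ) + 1 :=
    ⟨√(n + 1), Real.sqrt_pos.2 (by linarith), Real.sq_sqrt (by linarith)⟩
  rw [← hy2, ← hx2, Real.sqrt_sq hx.le, Real.sqrt_sq hy.le]
  have hxy : x ≤ y := by nlinarith
  have e1 : x * ((x ^ 2)⁻¹ - (y ^ 2)⁻¹) = (y - x) * (y + x) / (x * y ^ 2) := by
    field_simp; ring
  have e2 : 2 / x - 2 / y = (y - x) * (2 * y) / (x * y ^ 2) := by field_simp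
  rw [e1, e2]
  gcongr
  linarith

/-- Abel summation for a sequence whose partial sums are `O(√N)`. -/
lemma exists_sum_div_limit {a : ℕ → ℂ} {C : ℝ}
    (ha : ∀ N : ℕ, ‖∑ n ∈ Ioc 0 N, a n‖ ≤ C * √(N : ℝ)) :
    ∃ L : ℂ, ∀ N : ℕ, 1 ≤ N → ‖∑ n ∈ Ioc 0 N, a n / n - L‖ ≤ 3 * C / √(N : ℝ) := by
  have hC : 0 ≤ C := by simpa using (norm_nonneg _).trans (ha 1)
  obtain ⟨L, hL⟩ := exists_sum_limit_of_telescope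
    (h := fun n => (∑ k ∈ Ioc 0 n, a k - 0) * ((n : ℂ)⁻¹ - ((n + 1 : ℕ) : ℂ)⁻¹))
    (t := fun n => C * (2 / √(n : ℝ))) (fun n => by positivity) (fun n hn => by
      have hn' : (1 : ℝ) ≤ n := by exact_mod_cast hn
      have e : ((n : ℂ)⁻¹ - ((n + 1 : ℕ) : ℂ)⁻¹) = (((n : ℝ)⁻¹ - ((n : ℝ) + 1)⁻¹ : ℝ) : ℂ) := by
        push_cast; ring
      have hnn : 0 ≤ (n : ℝ)⁻¹ - ((n : ℝ) + 1)⁻¹ := by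
        rw [sub_nonneg]; gcongr; linarith
      rw [norm_mul, e, Complex.norm_real, Real.norm_of_nonneg hnn, sub_zero]
      calc _ ≤ C * √(n : ℝ) * ((n : ℝ)⁻¹ - ((n : ℝ) + 1)⁻¹) := by gcongr; exact ha n
        _ = C * (√(n : ℝ) * ((n : ℝ)⁻¹ - ((n : ℝ) + 1)⁻¹)) := by ring
        _ ≤ C * (2 / √(n : ℝ) - 2 / √((n : ℝ) + 1)) := by
          gcongr; exact sqrt_mul_inv_sub_inv_le hn
        _ = _ := by push_cast; ring)
  refine ⟨L, fun N hN => ?_⟩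
  have hN' : (1 : ℝ) ≤ N := by exact_mod_cast hN
  have := sum_mul_by_parts a (fun n => (n : ℂ)⁻¹) 0 N
  simp only [div_eq_mul_inv] at *
  rw [this]
  have h1 := hL N
  have h2 := ha N
  have hs : 0 < √(N : ℝ) := Real.sqrt_pos.2 (by linarith)
  have h3 : ‖(∑ n ∈ Ioc 0 N, a n - 0) * (((N + 1 : ℕ) : ℂ))⁻¹‖ ≤ C * (√(N : ℝ))⁻¹ := by
    rw [norm_mul, sub_zero, norm_inv, Complex.norm_natCast]
    calc _ ≤ C * √(N : ℝ) * (N : ℝ)⁻¹ := by gcongr; simp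
      _ = C * (√(N : ℝ) * (√(N : ℝ) * √(N : ℝ))⁻¹) := by rw [Real.mul_self_sqrt (by linarith)]; ring
      _ = _ := by field_simp
  have h4 : C * (2 * (√((N + 1 : ℕ) : ℝ))⁻¹) ≤ 2 * C * (√(N : ℝ))⁻¹ := by
    have : (√((N + 1 : ℕ) : ℝ))⁻¹ ≤ (√(N : ℝ))⁻¹ := by gcongr; simp
    nlinarith
  calc _ = ‖(∑ n ∈ Ioc 0 N, a n - 0) * (((N + 1 : ℕ) : ℂ))⁻¹ +
      (∑ n ∈ Ioc 0 N, (∑ k ∈ Ioc 0 n, a k - 0) * ((n : ℂ)⁻¹ - ((n + 1 : ℕ) : ℂ)⁻¹) - L)‖ := by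
        congr 1; ring
    _ ≤ _ := norm_add_le _ _
    _ ≤ C * (√(N : ℝ))⁻¹ + 2 * C * (√(N : ℝ))⁻¹ := add_le_add h3 (h1.trans h4)
    _ = _ := by ring

lemma log_succ_sub_log_le {n : ℕ} (hn : 1 ≤ n) :
    Real.log ((n : ℝ) + 1) - Real.log n ≤ (n : ℝ)⁻¹ := by
  have hn' : (0 : ℝ) < n := by exact_mod_cast hn
  rw [← Real.log_div (by positivity) (by positivity)]
  refine (Real.log_le_sub_one_of_pos (by positivity)).trans (le_of_eq ?_)
  field_simp; ring

lemma norm_log_sub_log_succ_le {n : ℕ} (hn : 1 ≤ n) :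
    ‖((Real.log n : ℝ) : ℂ) - ((Real.log (n + 1 : ℕ) : ℝ) : ℂ)‖ ≤ (n : ℝ)⁻¹ := by
  have hn' : (0 : ℝ) < n := by exact_mod_cast hn
  rw [← Complex.ofReal_sub, Complex.norm_real, Real.norm_eq_abs, abs_le]
  push_cast
  constructor
  · linarith [log_succ_sub_log_le hn]
  · have : Real.log n ≤ Real.log ((n : ℝ) + 1) := Real.log_le_log hn' (by linarith)
    have : 0 ≤ (n : ℝ)⁻¹ := by positivity
    linarith

lemma sum_inv_sqrt_mul_inv_le (N : ℕ) :
    ∑ n ∈ Ioc 0 N, (√(n : ℝ))⁻¹ * (n : ℝ)⁻¹ ≤ 4 - 4 / √((N : ℝ) + 1) := by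
  induction N with
  | zero => simp
  | succ N ih =>
    rw [sum_Ioc_succ_top (by omega)]
    have h1 := sqrt_mul_inv_sub_inv_le (n := N + 1) (by omega)
    have h2 : (√((N + 1 : ℕ) : ℝ))⁻¹ * ((N + 1 : ℕ) : ℝ)⁻¹ ≤
        2 * (√((N + 1 : ℕ) : ℝ) * (((N + 1 : ℕ) : ℝ)⁻¹ - (((N + 1 : ℕ) : ℝ) + 1)⁻¹)) := by
      set x : ℝ := ((N + 1 : ℕ) : ℝ) with hx
      have hx1 : 1 ≤ x := by rw [hx]; push_cast; linarith [(Nat.cast_nonneg N : (0 : ℝ) ≤ N)]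
      have e : (√x)⁻¹ = √x * x⁻¹ := by
        rw [eq_comm, mul_inv_eq_iff_eq_mul₀ (by positivity)]
        have : √x ≠ 0 := (Real.sqrt_pos.2 (by linarith)).ne'
        field_simp
        exact Real.sq_sqrt (by linarith)
      rw [e, mul_assoc, mul_left_comm 2]
      refine mul_le_mul_of_nonneg_left ?_ (Real.sqrt_nonneg _)
      rw [← mul_inv, inv_eq_one_div, div_le_iff₀ (by positivity)]
      have : 2 * (x⁻¹ - (x + 1)⁻¹) * (x * x) = 2 * x / (x + 1) := by field_simp; ring
      rw [this, le_div_iff₀ (by linarith)]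
      linarith
    push_cast at *
    have e4 : ∀ y : ℝ, 4 / y = 2 * (2 / y) := fun y => by ring
    rw [e4] at ih ⊢
    linarith

/-- If the partial sums of `a` are `O(√N)`, then `∑ a(n) log n / n` is bounded. -/
lemma exists_bound_sum_log_div {a : ℕ → ℂ} {C : ℝ}
    (ha : ∀ N : ℕ, ‖∑ n ∈ Ioc 0 N, a n‖ ≤ C * √(N : ℝ)) :
    ∃ K : ℝ, ∀ N : ℕ, 1 ≤ N → ‖∑ n ∈ Ioc 0 N, a n / n * (Real.log n : ℝ)‖ ≤ K := by
  have hC : 0 ≤ C := by simpa using (norm_nonneg _).trans (ha 1)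
  obtain ⟨L, hL⟩ := exists_sum_div_limit ha
  refine ⟨3 * C * 4 + 3 * C * 4, fun N hN => ?_⟩
  have hN' : (1 : ℝ) ≤ N := by exact_mod_cast hN
  have hs : 0 < √(N : ℝ) := Real.sqrt_pos.2 (by linarith)
  rw [sum_mul_by_parts _ (fun n : ℕ => ((Real.log n : ℝ) : ℂ)) L N]
  simp only [Nat.cast_one, Real.log_one, Complex.ofReal_zero, mul_zero, add_zero]
  refine (norm_add_le _ _).trans (add_le_add ?_ ?_)
  · rw [norm_mul, Complex.norm_real, Real.norm_of_nonneg (Real.log_natCast_nonneg _)]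
    have hlog : Real.log (N + 1 : ℕ) ≤ 4 * √(N : ℝ) := by
      push_cast
      have h1 : Real.log ((N : ℝ) + 1) ≤ Real.log ((2 * √(N : ℝ)) ^ 2) := by
        apply Real.log_le_log (by linarith)
        rw [mul_pow, Real.sq_sqrt (by linarith)]; linarith
      rw [Real.log_pow] at h1
      have := Real.log_le_sub_one_of_pos (x := 2 * √(N : ℝ)) (by positivity)
      push_cast at h1
      linarith
    calc _ ≤ 3 * C / √(N : ℝ) * (4 * √(N : ℝ)) :=
          mul_le_mul (hL N hN) hlog (Real.log_natCast_nonneg _) (by positivity)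
      _ = _ := by field_simp
  · refine (norm_sum_le _ _).trans ?_
    calc _ ≤ ∑ n ∈ Ioc 0 N, 3 * C * ((√(n : ℝ))⁻¹ * (n : ℝ)⁻¹) := by
          refine sum_le_sum fun n hn => ?_
          have hn1 : 1 ≤ n := (mem_Ioc.1 hn).1
          rw [norm_mul, ← mul_assoc, ← div_eq_mul_inv]
          exact mul_le_mul (hL n hn1) (norm_log_sub_log_succ_le hn1) (norm_nonneg _)
            (by positivity)
      _ = 3 * C * ∑ n ∈ Ioc 0 N, ((√(n : ℝ))⁻¹ * (n : ℝ)⁻¹) := by rw [mul_sum]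
      _ ≤ _ := by
        gcongr
        have := sum_inv_sqrt_mul_inv_le N
        have : 0 ≤ 4 / √((N : ℝ) + 1) := by positivity
        linarith

/-- Majorization of a weighted sum by partial sums, for an antitone weight. -/
lemma sum_mul_le_of_antitone {b f : ℕ → ℝ} {C : ℝ} (hf : ∀ n, 0 ≤ f n)
    (hanti : ∀ n, 1 ≤ n → f (n + 1) ≤ f n)
    (hb : ∀ N : ℕ, ∑ n ∈ Ioc 0 N, b n ≤ C * N) (N : ℕ) :
    ∑ n ∈ Ioc 0 N, b n * f n ≤ C * ∑ n ∈ Ioc 0 N, f n := by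
  suffices h : ∑ n ∈ Ioc 0 N, b n * f n + (C * N - ∑ n ∈ Ioc 0 N, b n) * f N ≤
      C * ∑ n ∈ Ioc 0 N, f n by
    have := mul_nonneg (sub_nonneg.2 (hb N)) (hf N)
    linarith
  induction N with
  | zero => simp
  | succ N ih =>
    rw [sum_Ioc_succ_top (by omega), sum_Ioc_succ_top (by omega), sum_Ioc_succ_top (by omega)]
    have h1 : (C * N - ∑ n ∈ Ioc 0 N, b n) * f (N + 1) ≤ (C * N - ∑ n ∈ Ioc 0 N, b n) * f N := by
      rcases Nat.eq_zero_or_pos N with rfl | hN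
      · simp
      · exact mul_le_mul_of_nonneg_left (hanti N hN) (sub_nonneg.2 (hb N))
    push_cast
    nlinarith

lemma sum_rpow_neg_three_quarters_le (N : ℕ) :
    ∑ n ∈ Ioc 0 N, (n : ℝ) ^ (-(3 / 4) : ℝ) ≤ 4 * (N : ℝ) ^ (1 / 4 : ℝ) := by
  induction N with
  | zero => simp
  | succ N ih =>
    rw [sum_Ioc_succ_top (by omega)]
    have hN : (0 : ℝ) ≤ N := Nat.cast_nonneg N
    push_cast
    set u : ℝ := ((N : ℝ) + 1) ^ (1 / 4 : ℝ) with hu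
    set v : ℝ := (N : ℝ) ^ (1 / 4 : ℝ) with hv
    have hu0 : 0 < u := by positivity
    have hv0 : 0 ≤ v := by positivity
    have hu4 : u ^ 4 = N + 1 := by
      rw [hu, ← Real.rpow_natCast, ← Real.rpow_mul (by linarith)]; norm_num
    have hv4 : v ^ 4 = N := by
      rw [hv, ← Real.rpow_natCast, ← Real.rpow_mul (by linarith)]; norm_num
    have huv : v ≤ u := Real.rpow_le_rpow hN (by linarith) (by norm_num)
    have e : ((N : ℝ) + 1) ^ (-(3 / 4) : ℝ) = (u ^ 3)⁻¹ := by
      rw [hu, ← Real.rpow_natCast, ← Real.rpow_mul (by linarith), ← Real.rpow_neg (by linarith)]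
      norm_num
    rw [e]
    have : (u ^ 3)⁻¹ ≤ 4 * (u - v) := by
      rw [inv_eq_one_div, div_le_iff₀ (by positivity)]
      have h1 : (u - v) * (u ^ 3 + u ^ 2 * v + u * v ^ 2 + v ^ 3) = 1 := by
        ring_nf; rw [hu4, hv4]; ring
      have h2 : u ^ 3 + u ^ 2 * v + u * v ^ 2 + v ^ 3 ≤ 4 * u ^ 3 := by
        have a1 : u ^ 2 * v ≤ u ^ 2 * u := by gcongr
        have a2 : u * v ^ 2 ≤ u * u ^ 2 := by gcongr
        have a3 : v ^ 3 ≤ u ^ 3 := by gcongr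
        nlinarith
      nlinarith
    linarith

/-- The error-term bound `∑ b(n)/n · (n/N)^{1/4} = O(1)` for `b` of bounded mean. -/
lemma sum_div_mul_rpow_le {b : ℕ → ℝ} {C : ℝ}
    (hb0 : ∀ n, 0 ≤ b n) (hb : ∀ N : ℕ, ∑ n ∈ Ioc 0 N, b n ≤ C * N) {N : ℕ} (hN : 1 ≤ N) :
    ∑ n ∈ Ioc 0 N, b n / n * ((n : ℝ) / N) ^ (1 / 4 : ℝ) ≤ 4 * C := by
  have hN' : (0 : ℝ) < N := by exact_mod_cast hN
  have hC0 : 0 ≤ C := by simpa using (sum_nonneg fun n _ => hb0 n).trans (hb 1)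
  have key : ∀ n ∈ Ioc 0 N, b n / n * ((n : ℝ) / N) ^ (1 / 4 : ℝ) =
      (b n * (n : ℝ) ^ (-(3 / 4) : ℝ)) * ((N : ℝ) ^ (1 / 4 : ℝ))⁻¹ := by
    intro n hn
    have hn0 : (0 : ℝ) < n := by exact_mod_cast (mem_Ioc.1 hn).1
    rw [Real.div_rpow hn0.le hN'.le, show (-(3 / 4) : ℝ) = 1 / 4 - 1 by norm_num,
      Real.rpow_sub hn0, Real.rpow_one]
    field_simp
  rw [sum_congr rfl key, ← sum_mul, ← div_eq_mul_inv, div_le_iff₀ (by positivity)]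
  calc _ ≤ C * ∑ n ∈ Ioc 0 N, (n : ℝ) ^ (-(3 / 4) : ℝ) :=
        sum_mul_le_of_antitone (fun n => by positivity) (fun n hn => by
          apply Real.rpow_le_rpow_of_nonpos (by exact_mod_cast hn) (by push_cast; linarith)
          norm_num) hb N
    _ ≤ C * (4 * (N : ℝ) ^ (1 / 4 : ℝ)) := by gcongr; exact sum_rpow_neg_three_quarters_le N
    _ = _ := by ring

end MertensAnalysis

section MertensAnalysis

open ArithmeticFunction

lemma one_le_div_cast_of_mem {N d : ℕ} (hd : d ∈ Ioc 0 N) : 1 ≤ N / d := by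
  rw [mem_Ioc] at hd
  exact (Nat.one_le_div_iff hd.1).2 hd.2

lemma div_le_two_mul_floor_div {N d : ℕ} (hd : d ∈ Ioc 0 N) :
    (N : ℝ) / d ≤ 2 * ((N / d : ℕ) : ℝ) := by
  have h1 := one_le_div_cast_of_mem hd
  have hd0 : (0 : ℝ) < d := by exact_mod_cast (mem_Ioc.1 hd).1
  rw [div_le_iff₀ hd0]
  have h2 := Nat.lt_div_mul_add (a := N) (mem_Ioc.1 hd).1
  have h3 : N ≤ 2 * (N / d) * d := by nlinarith [Nat.le_mul_of_pos_left d (n := N / d) (by omega)]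
  exact_mod_cast h3

lemma inv_sqrt_floor_div_le {N d : ℕ} (hd : d ∈ Ioc 0 N) :
    1 / √((N / d : ℕ) : ℝ) ≤ 2 * ((d : ℝ) / N) ^ (1 / 2 : ℝ) := by
  have h1 : (1 : ℝ) ≤ ((N / d : ℕ) : ℝ) := by exact_mod_cast one_le_div_cast_of_mem hd
  have hd0 : (0 : ℝ) < d := by exact_mod_cast (mem_Ioc.1 hd).1
  have hN0 : (0 : ℝ) < N := hd0.trans_le (by exact_mod_cast (mem_Ioc.1 hd).2)
  have h2 := div_le_two_mul_floor_div hd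
  rw [← Real.sqrt_eq_rpow, div_le_iff₀ (Real.sqrt_pos.2 (by linarith)), mul_assoc,
    ← Real.sqrt_mul (by positivity)]
  have h3 : (1 / 2 : ℝ) ^ 2 ≤ (d : ℝ) / N * ((N / d : ℕ) : ℝ) := by
    rw [div_le_iff₀ hd0] at h2
    rw [div_mul_eq_mul_div, le_div_iff₀ hN0]
    nlinarith
  have := Real.le_sqrt_of_sq_le h3
  linarith

lemma rpow_half_le_rpow_quarter {N d : ℕ} (hd : d ∈ Ioc 0 N) :
    ((d : ℝ) / N) ^ (1 / 2 : ℝ) ≤ ((d : ℝ) / N) ^ (1 / 4 : ℝ) := by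
  have hd0 : (0 : ℝ) < d := by exact_mod_cast (mem_Ioc.1 hd).1
  have hN0 : (d : ℝ) ≤ N := by exact_mod_cast (mem_Ioc.1 hd).2
  exact Real.rpow_le_rpow_of_exponent_ge (div_pos hd0 (hd0.trans_le hN0))
    ((div_le_one (hd0.trans_le hN0)).2 hN0) (by norm_num)

lemma sum_Ioc_mul_div_eq (f g : ArithmeticFunction ℂ) (N : ℕ) :
    ∑ n ∈ Ioc 0 N, (f * g) n / n =
      ∑ d ∈ Ioc 0 N, f d / d * ∑ e ∈ Ioc 0 (N / d), g e / e := by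
  let F : ArithmeticFunction ℂ := ⟨fun n => f n / n, by simp⟩
  let G : ArithmeticFunction ℂ := ⟨fun n => g n / n, by simp⟩
  have h : ∀ n, (F * G) n = (f * g) n / n := fun n => by
    rw [mul_apply, mul_apply, sum_div]
    refine sum_congr rfl fun x hx => ?_
    rw [← (Nat.mem_divisorsAntidiagonal.1 hx).1]
    simp only [F, G, coe_mk]
    push_cast
    exact div_mul_div_comm _ _ _ _
  rw [← sum_congr rfl fun n _ => h n, sum_Ioc_mul_eq_sum_sum]
  rfl

/-- Pointwise product of an arithmetic function with the logarithm, a derivation. -/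
noncomputable def logTwist (f : ArithmeticFunction ℂ) : ArithmeticFunction ℂ :=
  ⟨fun n => f n * (Real.log n : ℝ), by simp⟩

lemma logTwist_apply (f : ArithmeticFunction ℂ) (n : ℕ) :
    logTwist f n = f n * (Real.log n : ℝ) := rfl

lemma logTwist_mul (f g : ArithmeticFunction ℂ) :
    logTwist (f * g) = logTwist f * g + f * logTwist g := by
  ext n
  rw [ArithmeticFunction.add_apply, logTwist_apply, mul_apply, mul_apply, mul_apply, sum_mul,
    ← sum_add_distrib]
  refine sum_congr rfl fun x hx => ?_
  obtain ⟨h1, h2⟩ := Nat.mem_divisorsAntidiagonal.1 hx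
  rw [← h1] at h2
  have ha : (x.1 : ℝ) ≠ 0 := by exact_mod_cast left_ne_zero_of_mul h2
  have hb : (x.2 : ℝ) ≠ 0 := by exact_mod_cast right_ne_zero_of_mul h2
  rw [logTwist_apply, logTwist_apply, ← h1, Nat.cast_mul, Real.log_mul ha hb]
  push_cast
  ring

lemma logTwist_one : logTwist 1 = 0 := by
  ext n
  rw [logTwist_apply, one_apply]
  split_ifs with h <;> simp [h]

/-- Dichotomy for the Mertens sum of a function whose summatory function is `O(√N)`: the sum of
`Λ'(n)/n` is bounded, or equals `-log N` up to a bounded error. -/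
theorem mertens_dichotomy {a l m : ArithmeticFunction ℂ} {C Cl Cm : ℝ}
    (ha : ∀ N : ℕ, ‖∑ n ∈ Ioc 0 N, a n‖ ≤ C * √(N : ℝ))
    (hl : ∀ N : ℕ, ∑ n ∈ Ioc 0 N, ‖l n‖ ≤ Cl * N)
    (hm : ∀ N : ℕ, ∑ n ∈ Ioc 0 N, ‖m n‖ ≤ Cm * N)
    (ham : a * m = 1) (hal : logTwist a = a * l) :
    ∃ K : ℝ, (∀ N : ℕ, 1 ≤ N → ‖∑ n ∈ Ioc 0 N, l n / n‖ ≤ K) ∨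
      (∀ N : ℕ, 1 ≤ N → ‖∑ n ∈ Ioc 0 N, l n / n + (Real.log N : ℝ)‖ ≤ K) := by
  have hC : 0 ≤ C := by simpa using (norm_nonneg _).trans (ha 1)
  obtain ⟨L, hL⟩ := exists_sum_div_limit ha
  have herr : ∀ {N d : ℕ}, d ∈ Ioc 0 N →
      ‖∑ e ∈ Ioc 0 (N / d), a e / e - L‖ ≤ 6 * C * ((d : ℝ) / N) ^ (1 / 2 : ℝ) := fun {N d} hd => by
    refine (hL _ (one_le_div_cast_of_mem hd)).trans ?_
    rw [div_eq_mul_one_div]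
    have := mul_le_mul_of_nonneg_left (inv_sqrt_floor_div_le hd) (by positivity : 0 ≤ 3 * C)
    linarith
  by_cases h0 : L = 0
  · subst h0
    refine ⟨24 * C * (4 * Cm), Or.inr fun N hN => ?_⟩
    have hN0 : (0 : ℝ) < N := by exact_mod_cast hN
    have hmal : logTwist m * a = -l := by
      have h1 := logTwist_mul a m
      rw [ham, logTwist_one, hal] at h1
      have h2 : a * l * m = l := by rw [mul_right_comm, ham, one_mul]
      rw [h2] at h1
      rw [mul_comm]
      exact (neg_eq_of_add_eq_zero_right h1.symm).symm
    have e1 : ∑ n ∈ Ioc 0 N, (m * a) n / n = 1 := by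
      rw [mul_comm, ham, sum_eq_single_of_mem 1 (by simp; omega)]
      · simp
      · intro b _ hb; simp [one_apply_ne hb]
    have e2 := sum_Ioc_mul_div_eq (logTwist m) a N
    have e3 := sum_Ioc_mul_div_eq m a N
    rw [hmal] at e2
    rw [e1] at e3
    have e4 : ∑ n ∈ Ioc 0 N, l n / n + (Real.log N : ℝ) =
        ∑ d ∈ Ioc 0 N, m d / d * (Real.log N - Real.log d : ℝ) *
          (∑ e ∈ Ioc 0 (N / d), a e / e - 0) := by
      have e5 : ∑ n ∈ Ioc 0 N, l n / n = -∑ n ∈ Ioc 0 N, (-l) n / n := by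
        rw [← sum_neg_distrib]
        refine sum_congr rfl fun n _ => ?_
        rw [ArithmeticFunction.neg_apply]; ring
      rw [e5, e2, ← mul_one ((Real.log N : ℝ) : ℂ), e3, mul_sum, ← sum_neg_distrib,
        ← sum_add_distrib]
      refine sum_congr rfl fun d _ => ?_
      rw [logTwist_apply]
      push_cast
      ring
    rw [e4]
    refine (norm_sum_le _ _).trans ?_
    calc _ ≤ ∑ d ∈ Ioc 0 N, 24 * C * (‖m d‖ / d * ((d : ℝ) / N) ^ (1 / 4 : ℝ)) := by
          refine sum_le_sum fun d hd => ?_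
          have hd0 : (0 : ℝ) < d := by exact_mod_cast (mem_Ioc.1 hd).1
          have hdN : (d : ℝ) ≤ N := by exact_mod_cast (mem_Ioc.1 hd).2
          rw [norm_mul, norm_mul, norm_div, Complex.norm_natCast, Complex.norm_real,
            Real.norm_of_nonneg (sub_nonneg.2 (Real.log_le_log hd0 hdN)),
            ← Real.log_div hN0.ne' hd0.ne']
          have hx : 0 < (d : ℝ) / N := by positivity
          have hlog : Real.log ((N : ℝ) / d) ≤ 4 * ((d : ℝ) / N) ^ (-(1 / 4) : ℝ) := by
            have := Real.log_le_rpow_div (x := (N : ℝ) / d) (by positivity)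
              (by norm_num : (0 : ℝ) < 1 / 4)
            rw [Real.rpow_neg hx.le, ← Real.inv_rpow hx.le, inv_div]
            linarith
          calc _ ≤ ‖m d‖ / d * (4 * ((d : ℝ) / N) ^ (-(1 / 4) : ℝ)) *
                (6 * C * ((d : ℝ) / N) ^ (1 / 2 : ℝ)) := by
                gcongr
                exact herr hd
            _ = 24 * C * (‖m d‖ / d * (((d : ℝ) / N) ^ (-(1 / 4) : ℝ) *
                ((d : ℝ) / N) ^ (1 / 2 : ℝ))) := by ring
            _ = _ := by rw [← Real.rpow_add hx]; norm_num
      _ = 24 * C * ∑ d ∈ Ioc 0 N, (‖m d‖ / d * ((d : ℝ) / N) ^ (1 / 4 : ℝ)) := by rw [mul_sum]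
      _ ≤ _ := by
        gcongr
        exact sum_div_mul_rpow_le (fun n => norm_nonneg _) hm hN
  · obtain ⟨K, hK⟩ := exists_bound_sum_log_div ha
    refine ⟨(K + 6 * C * (4 * Cl)) / ‖L‖, Or.inl fun N hN => ?_⟩
    rw [le_div_iff₀ (norm_pos_iff.2 h0), ← norm_mul]
    have e1 : ∑ n ∈ Ioc 0 N, a n / n * (Real.log n : ℝ) =
        ∑ d ∈ Ioc 0 N, l d / d * ∑ e ∈ Ioc 0 (N / d), a e / e := by
      rw [← sum_Ioc_mul_div_eq, mul_comm l, ← hal]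
      refine sum_congr rfl fun n _ => ?_
      rw [logTwist_apply]; ring
    have e2 : (∑ n ∈ Ioc 0 N, l n / n) * L = ∑ n ∈ Ioc 0 N, a n / n * (Real.log n : ℝ) -
        ∑ d ∈ Ioc 0 N, l d / d * (∑ e ∈ Ioc 0 (N / d), a e / e - L) := by
      rw [e1, ← sum_sub_distrib, sum_mul]
      exact sum_congr rfl fun d _ => by ring
    rw [e2]
    refine (norm_sub_le _ _).trans (add_le_add (hK N hN) ((norm_sum_le _ _).trans ?_))
    calc _ ≤ ∑ d ∈ Ioc 0 N, 6 * C * (‖l d‖ / d * ((d : ℝ) / N) ^ (1 / 4 : ℝ)) := by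
          refine sum_le_sum fun d hd => ?_
          rw [norm_mul, norm_div, Complex.norm_natCast]
          calc _ ≤ ‖l d‖ / d * (6 * C * ((d : ℝ) / N) ^ (1 / 4 : ℝ)) := by
                gcongr
                exact (herr hd).trans
                  (mul_le_mul_of_nonneg_left (rpow_half_le_rpow_quarter hd) (by positivity))
            _ = _ := by ring
      _ = 6 * C * ∑ d ∈ Ioc 0 N, (‖l d‖ / d * ((d : ℝ) / N) ^ (1 / 4 : ℝ)) := by rw [mul_sum]
      _ ≤ _ := by
        gcongr
        exact sum_div_mul_rpow_le (fun n => norm_nonneg _) hl hN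

/-- Mertens' theorem for a function whose summatory function is `c N + O(√N)`. -/
theorem mertens_principal {a l : ArithmeticFunction ℂ} {c C Cl : ℝ} (hc : 0 < c)
    (ha : ∀ N : ℕ, ‖∑ n ∈ Ioc 0 N, a n - c * N‖ ≤ C * √(N : ℝ))
    (hl : ∀ N : ℕ, ∑ n ∈ Ioc 0 N, ‖l n‖ ≤ Cl * N) (hal : logTwist a = a * l) :
    ∃ K : ℝ, ∀ N : ℕ, 1 ≤ N → ‖∑ n ∈ Ioc 0 N, l n / n - (Real.log N : ℝ)‖ ≤ K := by
  have hC : 0 ≤ C := by simpa using (norm_nonneg _).trans (ha 1)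
  have hCl : 0 ≤ Cl := by simpa using (sum_nonneg fun n _ => norm_nonneg _).trans (hl 1)
  have hsqrt : ∀ n : ℕ, √(n : ℝ) ≤ n := fun n => by
    rcases Nat.eq_zero_or_pos n with rfl | hn
    · simp
    · have : (1 : ℝ) ≤ n := by exact_mod_cast hn
      rw [Real.sqrt_le_left (by linarith)]
      nlinarith
  -- the summatory function of `a log`
  have hA : ∀ N : ℕ, 1 ≤ N → ‖∑ n ∈ Ioc 0 N, a n * (Real.log n : ℝ) - c * N * (Real.log N : ℝ)‖ ≤
      (4 * C + c + (c + C)) * N := fun N hN => by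
    have hN0 : (1 : ℝ) ≤ N := by exact_mod_cast hN
    rw [sum_mul_by_parts a (fun n : ℕ => ((Real.log n : ℝ) : ℂ)) 0 N]
    simp only [Nat.cast_one, Real.log_one, Complex.ofReal_zero, mul_zero, add_zero, sub_zero]
    have h1 : ‖(∑ n ∈ Ioc 0 N, a n - c * N) * ((Real.log (N + 1 : ℕ) : ℝ) : ℂ)‖ ≤ 4 * C * N := by
      rw [norm_mul, Complex.norm_real, Real.norm_of_nonneg (Real.log_natCast_nonneg _)]
      have hlog : Real.log (N + 1 : ℕ) ≤ 4 * √(N : ℝ) := by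
        push_cast
        have hs : 0 < √(N : ℝ) := Real.sqrt_pos.2 (by linarith)
        have h1 : Real.log ((N : ℝ) + 1) ≤ Real.log ((2 * √(N : ℝ)) ^ 2) := by
          apply Real.log_le_log (by linarith)
          rw [mul_pow, Real.sq_sqrt (by linarith)]; linarith
        rw [Real.log_pow] at h1
        have := Real.log_le_sub_one_of_pos (x := 2 * √(N : ℝ)) (by positivity)
        push_cast at h1
        linarith
      calc _ ≤ C * √(N : ℝ) * (4 * √(N : ℝ)) :=
            mul_le_mul (ha N) hlog (Real.log_natCast_nonneg _) (by positivity)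
        _ = 4 * C * (√(N : ℝ) * √(N : ℝ)) := by ring
        _ = _ := by rw [Real.mul_self_sqrt (by linarith)]
    have h2 : ‖(c : ℂ) * N * (((Real.log (N + 1 : ℕ) : ℝ) : ℂ) - ((Real.log N : ℝ) : ℂ))‖ ≤
        c * N := by
      rw [norm_mul, norm_mul, Complex.norm_real, Complex.norm_natCast, Real.norm_of_nonneg hc.le,
        norm_sub_rev]
      calc _ ≤ c * N * (N : ℝ)⁻¹ := by gcongr; exact norm_log_sub_log_succ_le hN
        _ = c := by field_simp
        _ ≤ _ := by nlinarith
    have h3 : ‖∑ n ∈ Ioc 0 N, (∑ k ∈ Ioc 0 n, a k) *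
        (((Real.log n : ℝ) : ℂ) - ((Real.log (n + 1 : ℕ) : ℝ) : ℂ))‖ ≤ (c + C) * N := by
      refine (norm_sum_le _ _).trans ?_
      calc _ ≤ ∑ n ∈ Ioc 0 N, (c + C) := by
            refine sum_le_sum fun n hn => ?_
            have hn1 : 1 ≤ n := (mem_Ioc.1 hn).1
            have hn0 : (0 : ℝ) < n := by exact_mod_cast hn1
            have h4 : ‖∑ k ∈ Ioc 0 n, a k‖ ≤ (c + C) * n := by
              calc _ = ‖(∑ k ∈ Ioc 0 n, a k - c * n) + c * n‖ := by congr 1; ring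
                _ ≤ C * n + c * n := (norm_add_le _ _).trans (add_le_add ((ha n).trans
                    (mul_le_mul_of_nonneg_left (hsqrt n) hC)) (by simp [abs_of_pos hc]))
                _ = (c + C) * n := by ring
            rw [norm_mul]
            calc _ ≤ (c + C) * n * (n : ℝ)⁻¹ :=
                  mul_le_mul h4 (norm_log_sub_log_succ_le hn1) (norm_nonneg _) (by positivity)
              _ = _ := by field_simp
        _ = _ := by simp; ring
    calc _ = ‖(∑ n ∈ Ioc 0 N, a n - c * N) * ((Real.log (N + 1 : ℕ) : ℝ) : ℂ) +
          (c : ℂ) * N * (((Real.log (N + 1 : ℕ) : ℝ) : ℂ) - ((Real.log N : ℝ) : ℂ)) +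
          ∑ n ∈ Ioc 0 N, (∑ k ∈ Ioc 0 n, a k) *
            (((Real.log n : ℝ) : ℂ) - ((Real.log (n + 1 : ℕ) : ℝ) : ℂ))‖ := by
          congr 1; ring
      _ ≤ _ := (norm_add₃_le).trans (by linarith)
  refine ⟨((4 * C + c + (c + C)) + (c + C) * (4 * Cl)) / c, fun N hN => ?_⟩
  have hN0 : (0 : ℝ) < N := by exact_mod_cast hN
  rw [le_div_iff₀ hc]
  have e1 : ∑ n ∈ Ioc 0 N, a n * (Real.log n : ℝ) =
      ∑ d ∈ Ioc 0 N, l d * ∑ e ∈ Ioc 0 (N / d), a e := by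
    rw [← sum_Ioc_mul_eq_sum_sum, mul_comm l, ← hal]
    exact sum_congr rfl fun n _ => rfl
  have e2 : (∑ n ∈ Ioc 0 N, l n / n - (Real.log N : ℝ)) * ((c : ℂ) * N) =
      (∑ n ∈ Ioc 0 N, a n * (Real.log n : ℝ) - c * N * (Real.log N : ℝ)) -
        ∑ d ∈ Ioc 0 N, l d * (∑ e ∈ Ioc 0 (N / d), a e - c * (N / d)) := by
    rw [e1, sub_mul, sum_mul]
    simp only [mul_sub, sum_sub_distrib]
    have : ∑ d ∈ Ioc 0 N, l d / d * ((c : ℂ) * N) = ∑ d ∈ Ioc 0 N, l d * (c * (N / d)) :=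
      sum_congr rfl fun d _ => by ring
    rw [this]
    ring
  have h1 : ‖∑ d ∈ Ioc 0 N, l d * (∑ e ∈ Ioc 0 (N / d), a e - c * (N / d))‖ ≤
      (c + C) * (4 * Cl) * N := by
    refine (norm_sum_le _ _).trans ?_
    calc _ ≤ ∑ d ∈ Ioc 0 N, (c + C) * N * (‖l d‖ / d * ((d : ℝ) / N) ^ (1 / 4 : ℝ)) := by
          refine sum_le_sum fun d hd => ?_
          have hd0 : (0 : ℝ) < d := by exact_mod_cast (mem_Ioc.1 hd).1
          have hdN : (d : ℝ) ≤ N := by exact_mod_cast (mem_Ioc.1 hd).2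
          set x := (N : ℝ) / d with hx
          have hx1 : 1 ≤ x := (one_le_div hd0).2 hdN
          have hfl : ((N / d : ℕ) : ℝ) ≤ x := Nat.cast_div_le
          have hfl' : x < ((N / d : ℕ) : ℝ) + 1 := by
            rw [hx, div_lt_iff₀ hd0]
            have := Nat.lt_div_mul_add (a := N) (mem_Ioc.1 hd).1
            have h3 : (N : ℝ) < (N / d : ℕ) * d + d := by exact_mod_cast this
            linarith
          have hp : 1 ≤ x ^ (3 / 4 : ℝ) := Real.one_le_rpow hx1 (by norm_num)
          have hs : √((N / d : ℕ) : ℝ) ≤ x ^ (3 / 4 : ℝ) := by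
            refine (Real.sqrt_le_sqrt hfl).trans ?_
            rw [Real.sqrt_eq_rpow]
            exact Real.rpow_le_rpow_of_exponent_le hx1 (by norm_num)
          have h2 : ‖∑ e ∈ Ioc 0 (N / d), a e - c * (N / d)‖ ≤ (c + C) * x ^ (3 / 4 : ℝ) := by
            calc _ = ‖(∑ e ∈ Ioc 0 (N / d), a e - c * (N / d : ℕ)) +
                  ((c * (((N / d : ℕ) : ℝ) - x) : ℝ) : ℂ)‖ := by
                  congr 1; rw [hx]; push_cast; ring
              _ ≤ C * x ^ (3 / 4 : ℝ) + c * x ^ (3 / 4 : ℝ) := by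
                  refine (norm_add_le _ _).trans (add_le_add ((ha _).trans
                    (mul_le_mul_of_nonneg_left hs hC)) ?_)
                  rw [Complex.norm_real, norm_mul, Real.norm_of_nonneg hc.le]
                  refine mul_le_mul_of_nonneg_left (le_trans ?_ hp) hc.le
                  rw [Real.norm_eq_abs, abs_le]
                  constructor <;> linarith
              _ = _ := by ring
          have h3 : x ^ (3 / 4 : ℝ) = N * ((1 / (d : ℝ)) * ((d : ℝ) / N) ^ (1 / 4 : ℝ)) := by
            have h4 : (d : ℝ) / N = x⁻¹ := by rw [hx, inv_div]
            rw [h4, ← mul_assoc, mul_one_div, ← hx, Real.inv_rpow (by linarith),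
              ← Real.rpow_neg (by linarith)]
            nth_rewrite 2 [← Real.rpow_one x]
            rw [← Real.rpow_add (by linarith)]
            norm_num
          rw [norm_mul]
          calc _ ≤ ‖l d‖ * ((c + C) * x ^ (3 / 4 : ℝ)) := by gcongr
            _ = _ := by rw [h3]; ring
      _ = (c + C) * N * ∑ d ∈ Ioc 0 N, (‖l d‖ / d * ((d : ℝ) / N) ^ (1 / 4 : ℝ)) := by rw [mul_sum]
      _ ≤ (c + C) * N * (4 * Cl) := by
        gcongr
        exact sum_div_mul_rpow_le (fun n => norm_nonneg _) hl hN
      _ = _ := by ring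
  have h2 : ‖∑ n ∈ Ioc 0 N, l n / n - (Real.log N : ℝ)‖ * (c * N) ≤
      ((4 * C + c + (c + C)) + (c + C) * (4 * Cl)) * N := by
    have h3 := congrArg norm e2
    rw [norm_mul, norm_mul, Complex.norm_real, Complex.norm_natCast, Real.norm_of_nonneg hc.le] at h3
    rw [h3]
    refine (norm_sub_le _ _).trans ((add_le_add (hA N hN) h1).trans (le_of_eq (by ring)))
  rw [← mul_assoc] at h2
  exact le_of_mul_le_mul_right h2 hN0

end MertensAnalysis

section MertensAnalysis

lemma bounded_of_dichotomy {l₀ : ℕ → ℝ} {l l' : ℕ → ℂ} {K₀ K K' : ℝ}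
    (h₀ : ∀ N : ℕ, 1 ≤ N → |∑ n ∈ Ioc 0 N, l₀ n / n - Real.log N| ≤ K₀)
    (hp : ∀ n, l₀ n - (l' n).re ≤ 4 * (l₀ n + (l n).re))
    (h : (∀ N : ℕ, 1 ≤ N → ‖∑ n ∈ Ioc 0 N, l n / n‖ ≤ K) ∨
      (∀ N : ℕ, 1 ≤ N → ‖∑ n ∈ Ioc 0 N, l n / n + (Real.log N : ℝ)‖ ≤ K))
    (h' : (∀ N : ℕ, 1 ≤ N → ‖∑ n ∈ Ioc 0 N, l' n / n‖ ≤ K') ∨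
      (∀ N : ℕ, 1 ≤ N → ‖∑ n ∈ Ioc 0 N, l' n / n + (Real.log N : ℝ)‖ ≤ K')) :
    ∀ N : ℕ, 1 ≤ N → ‖∑ n ∈ Ioc 0 N, l n / n‖ ≤ K := by
  refine h.resolve_right fun h => ?_
  have key : ∀ N : ℕ, 1 ≤ N → Real.log N ≤ K' + K₀ + 4 * (K₀ + K) := fun N hN => by
    have hlog := Real.log_natCast_nonneg N
    have h1 : (∑ n ∈ Ioc 0 N, l' n / n).re ≤ K' := by
      rcases h' with h' | h'
      · exact (Complex.re_le_norm _).trans (h' N hN)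
      · have := (Complex.re_le_norm _).trans (h' N hN)
        rw [Complex.add_re, Complex.ofReal_re] at this
        linarith
    have h2 := (Complex.re_le_norm _).trans (h N hN)
    rw [Complex.add_re, Complex.ofReal_re] at h2
    have h3 := abs_le.1 (h₀ N hN)
    have h4 : ∑ n ∈ Ioc 0 N, (l₀ n / n - (l' n / n).re) ≤
        ∑ n ∈ Ioc 0 N, 4 * (l₀ n / n + (l n / n).re) := sum_le_sum fun n _ => by
      rw [Complex.div_natCast_re, Complex.div_natCast_re, ← sub_div, ← add_div, ← mul_div_assoc]
      exact div_le_div_of_nonneg_right (hp n) (Nat.cast_nonneg n)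
    rw [sum_sub_distrib, ← mul_sum, sum_add_distrib, ← Complex.re_sum, ← Complex.re_sum] at h4
    linarith [h3.1, h3.2]
  obtain ⟨n, hn1, hn⟩ := ((Filter.eventually_ge_atTop 1).and ((Real.tendsto_log_atTop.comp
    tendsto_natCast_atTop_atTop).eventually_gt_atTop (K' + K₀ + 4 * (K₀ + K)))).exists
  exact absurd (key n hn1) (not_le.2 hn)

/-- A lower bound for the mass of the weights `w` in short multiplicative intervals. -/
theorem mertens_positive_part {l₀ w : ℕ → ℝ} {l₁ l₂ l₄ : ℕ → ℂ} {K₀ K₁ K₂ K₄ : ℝ}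
    (h₀ : ∀ N : ℕ, 1 ≤ N → |∑ n ∈ Ioc 0 N, l₀ n / n - Real.log N| ≤ K₀)
    (h₁ : (∀ N : ℕ, 1 ≤ N → ‖∑ n ∈ Ioc 0 N, l₁ n / n‖ ≤ K₁) ∨
      (∀ N : ℕ, 1 ≤ N → ‖∑ n ∈ Ioc 0 N, l₁ n / n + (Real.log N : ℝ)‖ ≤ K₁))
    (h₂ : (∀ N : ℕ, 1 ≤ N → ‖∑ n ∈ Ioc 0 N, l₂ n / n‖ ≤ K₂) ∨
      (∀ N : ℕ, 1 ≤ N → ‖∑ n ∈ Ioc 0 N, l₂ n / n + (Real.log N : ℝ)‖ ≤ K₂))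
    (h₄ : (∀ N : ℕ, 1 ≤ N → ‖∑ n ∈ Ioc 0 N, l₄ n / n‖ ≤ K₄) ∨
      (∀ N : ℕ, 1 ≤ N → ‖∑ n ∈ Ioc 0 N, l₄ n / n + (Real.log N : ℝ)‖ ≤ K₄))
    (hp₁ : ∀ n, l₀ n - (l₂ n).re ≤ 4 * (l₀ n + (l₁ n).re))
    (hp₂ : ∀ n, l₀ n - (l₄ n).re ≤ 4 * (l₀ n + (l₂ n).re))
    (hw : ∀ n, (l₁ n).re + l₀ n / 2 + (l₂ n).re / 2 ≤ 2 * w n) :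
    ∃ K : ℝ, ∀ M N : ℕ, 1 ≤ M → M ≤ N →
      (Real.log N - Real.log M) / 4 - K ≤ ∑ n ∈ Ioc M N, w n / n := by
  have b₁ := bounded_of_dichotomy h₀ hp₁ h₁ h₂
  have b₂ := bounded_of_dichotomy h₀ hp₂ h₂ h₄
  refine ⟨(2 * K₁ + K₀ + K₂) / 2, fun M N hM hMN => ?_⟩
  have split : ∀ f : ℕ → ℝ, ∑ n ∈ Ioc M N, f n = ∑ n ∈ Ioc 0 N, f n - ∑ n ∈ Ioc 0 M, f n :=
    fun f => by rw [← sum_Ioc_consecutive f (Nat.zero_le M) hMN]; ring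
  have e : ∑ n ∈ Ioc M N, ((l₁ n / n).re + l₀ n / n / 2 + (l₂ n / n).re / 2) ≤
      ∑ n ∈ Ioc M N, 2 * (w n / n) := sum_le_sum fun n _ => by
    rw [Complex.div_natCast_re, Complex.div_natCast_re]
    have := div_le_div_of_nonneg_right (hw n) (Nat.cast_nonneg (α := ℝ) n)
    rw [← mul_div_assoc]
    refine le_trans (le_of_eq ?_) this
    ring
  rw [← mul_sum, sum_add_distrib, sum_add_distrib, ← sum_div, ← sum_div, split, split fun n => l₀ n / n,
    split fun n => (l₂ n / n).re, ← Complex.re_sum, ← Complex.re_sum, ← Complex.re_sum,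
    ← Complex.re_sum] at e
  have hN := hM.trans hMN
  have a1 := abs_le.1 ((Complex.abs_re_le_norm _).trans (b₁ N hN))
  have a2 := abs_le.1 ((Complex.abs_re_le_norm _).trans (b₁ M hM))
  have a3 := abs_le.1 ((Complex.abs_re_le_norm _).trans (b₂ N hN))
  have a4 := abs_le.1 ((Complex.abs_re_le_norm _).trans (b₂ M hM))
  have a5 := abs_le.1 (h₀ N hN)
  have a6 := abs_le.1 (h₀ M hM)
  linarith [a1.1, a2.2, a3.1, a4.2, a5.1, a6.2]

end MertensAnalysis

section FiberSum

variable {A : Type*} [AddCommMonoid A] [HasAntidiagonal A]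

/-- The arithmetic function `n ↦ ∑_{nm s = n} f s`. -/
noncomputable def fiberSum (nm : A → ℕ) (h0 : ∀ s, nm s ≠ 0) (hfin : ∀ n, {s | nm s = n}.Finite)
    (f : A → ℂ) : ArithmeticFunction ℂ :=
  ⟨fun n => ∑ s ∈ (hfin n).toFinset, f s, sum_eq_zero fun s hs => absurd (by simpa using hs) (h0 s)⟩

variable {nm : A → ℕ} (h0 : ∀ s, nm s ≠ 0) (hfin : ∀ n, {s | nm s = n}.Finite)

lemma fiberSum_apply (f : A → ℂ) (n : ℕ) :
    fiberSum nm h0 hfin f n = ∑ s ∈ (hfin n).toFinset, f s := rfl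

lemma fiberSum_mul (hadd : ∀ s t, nm (s + t) = nm s * nm t) (f g : A → ℂ) :
    fiberSum nm h0 hfin f * fiberSum nm h0 hfin g =
      fiberSum nm h0 hfin fun s => ∑ x ∈ antidiagonal s, f x.1 * g x.2 := by
  ext n
  simp only [ArithmeticFunction.mul_apply, fiberSum_apply, sum_mul_sum]
  simp only [← sum_product']
  rw [sum_sigma', sum_sigma']
  refine sum_nbij' (fun x => ⟨x.2.1 + x.2.2, x.2⟩) (fun x => ⟨(nm x.2.1, nm x.2.2), x.2⟩)
    ?_ ?_ ?_ ?_ ?_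
  · rintro ⟨⟨a, b⟩, ⟨s, t⟩⟩ h
    simp only [mem_sigma, Nat.mem_divisorsAntidiagonal, mem_product, Set.Finite.mem_toFinset,
      Set.mem_ofPred_eq, HasAntidiagonal.mem_antidiagonal, and_true] at h ⊢
    rw [hadd, h.2.1, h.2.2, h.1.1]
  · rintro ⟨u, ⟨s, t⟩⟩ h
    simp only [mem_sigma, Nat.mem_divisorsAntidiagonal, mem_product, Set.Finite.mem_toFinset,
      Set.mem_ofPred_eq, HasAntidiagonal.mem_antidiagonal, and_true] at h ⊢
    rw [← hadd, h.2, h.1]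
    exact ⟨rfl, h.1 ▸ h0 u⟩
  · rintro ⟨⟨a, b⟩, ⟨s, t⟩⟩ h
    simp only [mem_sigma, mem_product, Set.Finite.mem_toFinset, Set.mem_ofPred_eq] at h
    simp [h.2.1, h.2.2]
  · rintro ⟨u, ⟨s, t⟩⟩ h
    simp only [mem_sigma, HasAntidiagonal.mem_antidiagonal] at h
    simp [h.2]
  · rintro ⟨⟨a, b⟩, ⟨s, t⟩⟩ h
    rfl

lemma fiberSum_congr {f g : A → ℂ} (h : ∀ s, f s = g s) :
    fiberSum nm h0 hfin f = fiberSum nm h0 hfin g := by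
  rw [funext h]

lemma logTwist_fiberSum (f : A → ℂ) :
    logTwist (fiberSum nm h0 hfin f) =
      fiberSum nm h0 hfin fun s => f s * (Real.log (nm s) : ℝ) := by
  ext n
  rw [logTwist_apply, fiberSum_apply, fiberSum_apply, sum_mul]
  refine sum_congr rfl fun s hs => ?_
  rw [show nm s = n by simpa using hs]

lemma fiberSum_single_zero (h1 : ∀ s, nm s = 1 ↔ s = 0) [DecidableEq A] :
    fiberSum nm h0 hfin (fun s => if s = 0 then 1 else 0) = 1 := by
  ext n
  rw [fiberSum_apply, sum_ite_eq', ArithmeticFunction.one_apply]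
  have := (h1 0).2 rfl
  simp [this, eq_comm]

end FiberSum

section FreeMonoid

variable {P : Type*} [DecidableEq P]

/-- The Möbius function of the free commutative monoid `P →₀ ℕ`. -/
noncomputable def freeMoebius (s : P →₀ ℕ) : ℂ :=
  if ∀ p ∈ s.support, s p = 1 then (-1) ^ #s.support else 0

/-- The von Mangoldt function of the free commutative monoid `P →₀ ℕ` with norm `N`. -/
noncomputable def freeVonMangoldt (N : P → ℕ) (s : P →₀ ℕ) : ℝ :=
  if #s.support = 1 then ∑ p ∈ s.support, Real.log (N p) else 0

lemma norm_freeMoebius_le (s : P →₀ ℕ) : ‖freeMoebius s‖ ≤ 1 := by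
  rw [freeMoebius]; split_ifs <;> simp

lemma freeVonMangoldt_nonneg (N : P → ℕ) (s : P →₀ ℕ) : 0 ≤ freeVonMangoldt N s := by
  rw [freeVonMangoldt]
  split_ifs
  · exact sum_nonneg fun p _ => Real.log_natCast_nonneg _
  · rfl

lemma freeVonMangoldt_single (N : P → ℕ) (p : P) {j : ℕ} (hj : j ≠ 0) :
    freeVonMangoldt N (Finsupp.single p j) = Real.log (N p) := by
  rw [freeVonMangoldt, Finsupp.support_single _ hj]; simp

lemma exists_single_of_freeVonMangoldt_ne_zero {N : P → ℕ} {s : P →₀ ℕ}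
    (h : freeVonMangoldt N s ≠ 0) : ∃ p j, j ≠ 0 ∧ s = Finsupp.single p j := by
  rw [freeVonMangoldt] at h
  have hc : #s.support = 1 := by by_contra hc; simp [hc] at h
  obtain ⟨p, hp, hs⟩ := Finsupp.card_support_eq_one.1 hc
  exact ⟨p, s p, hp, hs⟩

lemma sum_antidiagonal_freeMoebius (s : P →₀ ℕ) :
    ∑ x ∈ antidiagonal s, freeMoebius x.2 = if s = 0 then 1 else 0 := by
  have h1 : ∑ t ∈ s.support.powerset, (-1 : ℂ) ^ #t = if s = 0 then 1 else 0 := by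
    have := sum_powerset_neg_one_pow_card (x := s.support)
    have h2 := congrArg (Int.cast : ℤ → ℂ) this
    push_cast at h2
    rw [h2]
    simp
  rw [← h1]
  let ind : Finset P → (P →₀ ℕ) := fun t => Finsupp.indicator t fun _ _ => 1
  have hsupp : ∀ t, (ind t).support = t := fun t => by
    ext p; simp [ind, Finsupp.indicator_apply]
  have hind : ∀ t p, ind t p = if p ∈ t then 1 else 0 := fun t p => by
    simp [ind, Finsupp.indicator_apply]
  symm
  refine sum_of_injOn (fun t => (s - ind t, ind t)) ?_ ?_ ?_ ?_
  · intro t _ t' _ h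
    have h2 : ind t = ind t' := (Prod.ext_iff.1 h).2
    rw [← hsupp t, ← hsupp t', h2]
  · intro t ht
    simp only [mem_coe, HasAntidiagonal.mem_antidiagonal]
    refine tsub_add_cancel_of_le fun p => ?_
    rw [hind]
    split_ifs with hp
    · exact Nat.one_le_iff_ne_zero.2 (Finsupp.mem_support_iff.1 (mem_powerset.1 ht hp))
    · exact Nat.zero_le _
  · rintro ⟨a, b⟩ hx hn
    rw [freeMoebius, if_neg]
    intro h
    refine hn ⟨b.support, ?_, ?_⟩
    · simp only [mem_coe, mem_powerset]
      rw [HasAntidiagonal.mem_antidiagonal] at hx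
      simp only at hx
      intro p hp
      rw [Finsupp.mem_support_iff] at hp ⊢
      rw [← hx, Finsupp.add_apply]
      omega
    · have hb : ind b.support = b := by
        ext p
        rw [hind]
        split_ifs with hp
        · exact (h p hp).symm
        · exact (Finsupp.notMem_support_iff.1 hp).symm
      rw [HasAntidiagonal.mem_antidiagonal] at hx
      simp only at hx
      simp only [hb, ← hx, add_tsub_cancel_right]
  · intro t _
    rw [freeMoebius, if_pos, hsupp]
    intro p hp
    rw [hsupp] at hp
    rw [hind, if_pos hp]

lemma sum_antidiagonal_freeVonMangoldt (N : P → ℕ) (s : P →₀ ℕ) :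
    ∑ x ∈ antidiagonal s, freeVonMangoldt N x.2 = ∑ p ∈ s.support, s p * Real.log (N p) := by
  have h1 : ∑ p ∈ s.support, s p * Real.log (N p) =
      ∑ x ∈ s.support.sigma fun p => Ioc 0 (s p), Real.log (N x.1) := by
    rw [sum_sigma]; simp
  rw [h1]
  symm
  refine sum_of_injOn (fun x => (s - Finsupp.single x.1 x.2, Finsupp.single x.1 x.2)) ?_ ?_ ?_ ?_
  · rintro ⟨p, j⟩ hx ⟨q, i⟩ _ h
    simp only [coe_sigma, Set.mem_sigma_iff, mem_coe, mem_Ioc] at hx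
    have := (Finsupp.single_eq_single_iff _ _ _ _).1 (Prod.ext_iff.1 h).2
    rcases this with ⟨rfl, rfl⟩ | ⟨h, _⟩
    · rfl
    · exact absurd h hx.2.1.ne'
  · rintro ⟨p, j⟩ hx
    simp only [coe_sigma, Set.mem_sigma_iff, mem_coe, mem_Ioc] at hx
    simp only [mem_coe, HasAntidiagonal.mem_antidiagonal]
    exact tsub_add_cancel_of_le (Finsupp.single_le_iff.2 hx.2.2)
  · rintro ⟨a, b⟩ hx hn
    by_contra h
    obtain ⟨p, j, hj, hb⟩ := exists_single_of_freeVonMangoldt_ne_zero h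
    simp only at hb
    subst hb
    rw [HasAntidiagonal.mem_antidiagonal] at hx
    simp only at hx
    refine hn ⟨⟨p, j⟩, ?_, ?_⟩
    · simp only [coe_sigma, Set.mem_sigma_iff, mem_coe, mem_Ioc, Finsupp.mem_support_iff, ← hx,
        Finsupp.add_apply, Finsupp.single_eq_same]
      omega
    · simp only [← hx, add_tsub_cancel_right]
  · rintro ⟨p, j⟩ hx
    simp only [mem_sigma, mem_Ioc] at hx
    exact (freeVonMangoldt_single N p hx.2.1.ne').symm

end FreeMonoid

section FreeMonoidCharacters

variable {P : Type*} [DecidableEq P]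

/-- The completely multiplicative norm on `P →₀ ℕ` extending `N`. -/
noncomputable def freeNorm (N : P → ℕ) (s : P →₀ ℕ) : ℕ := s.prod fun p e => N p ^ e

lemma freeNorm_add (N : P → ℕ) (s t : P →₀ ℕ) :
    freeNorm N (s + t) = freeNorm N s * freeNorm N t :=
  Finsupp.prod_add_index' (fun _ => pow_zero _) fun _ _ _ => pow_add _ _ _

lemma freeNorm_single (N : P → ℕ) (p : P) (j : ℕ) : freeNorm N (Finsupp.single p j) = N p ^ j :=
  Finsupp.prod_single_index (pow_zero _)

lemma freeNorm_ne_zero {N : P → ℕ} (hN : ∀ p, 2 ≤ N p) (s : P →₀ ℕ) : freeNorm N s ≠ 0 :=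
  prod_ne_zero_iff.2 fun p _ => pow_ne_zero _ (by have := hN p; omega)

lemma freeNorm_eq_one_iff {N : P → ℕ} (hN : ∀ p, 2 ≤ N p) (s : P →₀ ℕ) :
    freeNorm N s = 1 ↔ s = 0 := by
  refine ⟨fun h => ?_, fun h => by subst h; exact Finsupp.prod_zero_index⟩
  by_contra hs
  obtain ⟨p, hp⟩ := Finsupp.support_nonempty_iff.2 hs
  have h1 : N p ^ s p ∣ 1 := h ▸ dvd_prod_of_mem (fun p => N p ^ s p) hp
  have h2 := Nat.dvd_one.1 h1
  rw [Nat.pow_eq_one] at h2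
  have := hN p
  have := Finsupp.mem_support_iff.1 hp
  omega

lemma log_freeNorm {N : P → ℕ} (hN : ∀ p, 2 ≤ N p) (s : P →₀ ℕ) :
    Real.log (freeNorm N s) = ∑ p ∈ s.support, s p * Real.log (N p) := by
  rw [freeNorm, Finsupp.prod, Nat.cast_prod, Real.log_prod]
  · exact sum_congr rfl fun p _ => by rw [Nat.cast_pow, Real.log_pow]
  · intro p _
    have := hN p
    positivity

variable {N : P → ℕ} (hN : ∀ p, 2 ≤ N p) (hfin : ∀ n, {s | freeNorm N s = n}.Finite)
include hN hfin

/-- The arithmetic function with coefficients the sums of `f` over elements of given norm. -/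
noncomputable abbrev normSum (f : (P →₀ ℕ) → ℂ) : ArithmeticFunction ℂ :=
  fiberSum (freeNorm N) (freeNorm_ne_zero hN) hfin f

variable {χ : (P →₀ ℕ) → ℂ} (hχ : ∀ s t, χ (s + t) = χ s * χ t) (hχ0 : χ 0 = 1)
include hχ

lemma normSum_mul_freeMoebius (hχ0 : χ 0 = 1) :
    normSum hN hfin χ * normSum hN hfin (fun s => freeMoebius s * χ s) = 1 := by
  rw [fiberSum_mul _ _ (freeNorm_add N), ← fiberSum_single_zero (freeNorm_ne_zero hN) hfin
    (freeNorm_eq_one_iff hN)]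
  refine fiberSum_congr _ _ fun s => ?_
  have : ∀ x ∈ antidiagonal s, χ x.1 * (freeMoebius x.2 * χ x.2) = freeMoebius x.2 * χ s :=
    fun x hx => by rw [← HasAntidiagonal.mem_antidiagonal.1 hx, hχ]; ring
  rw [sum_congr rfl this, ← sum_mul, sum_antidiagonal_freeMoebius]
  split_ifs with h
  · rw [h, hχ0, one_mul]
  · rw [zero_mul]

lemma logTwist_normSum :
    logTwist (normSum hN hfin χ) =
      normSum hN hfin χ * normSum hN hfin (fun s => (freeVonMangoldt N s : ℂ) * χ s) := by
  rw [fiberSum_mul _ _ (freeNorm_add N), logTwist_fiberSum]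
  refine fiberSum_congr _ _ fun s => ?_
  have : ∀ x ∈ antidiagonal s, χ x.1 * ((freeVonMangoldt N x.2 : ℂ) * χ x.2) =
      (freeVonMangoldt N x.2 : ℂ) * χ s :=
    fun x hx => by rw [← HasAntidiagonal.mem_antidiagonal.1 hx, hχ]; ring
  rw [sum_congr rfl this, ← sum_mul, ← Complex.ofReal_sum, sum_antidiagonal_freeVonMangoldt,
    log_freeNorm hN, mul_comm]

omit hχ in
/-- Sum of the von Mangoldt function over elements of norm `n`, with weights `g`. -/
noncomputable def mangoldtSum (g : (P →₀ ℕ) → ℝ) (n : ℕ) : ℝ :=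
  ∑ s ∈ (hfin n).toFinset, freeVonMangoldt N s * g s

omit hN hχ in
lemma norm_normSum_freeVonMangoldt_le (hN : ∀ p, 2 ≤ N p) (hn : ∀ s, ‖χ s‖ = 1) (n : ℕ) :
    ‖normSum hN hfin (fun s => (freeVonMangoldt N s : ℂ) * χ s) n‖ ≤
      mangoldtSum hfin (fun _ => 1) n := by
  refine (norm_sum_le _ _).trans (sum_le_sum fun s _ => ?_)
  rw [norm_mul, hn, Complex.norm_real, Real.norm_of_nonneg (freeVonMangoldt_nonneg N s)]

omit hN hχ in
/-- Mertens-type lower bound for the mass of prime elements with `Re Ψ > 0`, for a character `Ψ` on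
the free monoid whose relevant powers have small summatory functions. -/
theorem mangoldtSum_positive_part {Ψ : (P →₀ ℕ) → ℂ} (hN : ∀ p, 2 ≤ N p)
    (hΨ : ∀ s t, Ψ (s + t) = Ψ s * Ψ t) (hΨ0 : Ψ 0 = 1) (hn : ∀ s, ‖Ψ s‖ = 1)
    {c C Cl : ℝ} (hc : 0 < c)
    (h0 : ∀ x : ℕ, ‖∑ n ∈ Ioc 0 x, normSum hN hfin (fun _ => 1) n - c * x‖ ≤ C * √(x : ℝ))
    (hk : ∀ k ∈ ({1, 2, 4} : Finset ℕ), ∀ x : ℕ,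
      ‖∑ n ∈ Ioc 0 x, normSum hN hfin (fun s => Ψ s ^ k) n‖ ≤ C * √(x : ℝ))
    (hl : ∀ x : ℕ, ∑ n ∈ Ioc 0 x, mangoldtSum hfin (fun _ => 1) n ≤ Cl * x) :
    ∃ K : ℝ, ∀ M x : ℕ, 1 ≤ M → M ≤ x → (Real.log x - Real.log M) / 4 - K ≤
      ∑ n ∈ Ioc M x, mangoldtSum hfin (fun s => max (Ψ s).re 0) n / n := by
  have hC : 0 ≤ C := by simpa using (norm_nonneg _).trans (h0 1)
  let l : ℕ → ArithmeticFunction ℂ :=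
    fun k => normSum hN hfin (fun s => (freeVonMangoldt N s : ℂ) * Ψ s ^ k)
  have hadd : ∀ k s t, Ψ (s + t) ^ k = Ψ s ^ k * Ψ t ^ k := fun k s t => by rw [hΨ, mul_pow]
  have hone : ∀ k, Ψ 0 ^ k = 1 := fun k => by rw [hΨ0, one_pow]
  have hnk : ∀ k s, ‖Ψ s ^ k‖ = 1 := fun k s => by rw [norm_pow, hn, one_pow]
  have hlk : ∀ k x : ℕ, ∑ n ∈ Ioc 0 x, ‖l k n‖ ≤ Cl * x := fun k x =>
    (sum_le_sum fun n _ => norm_normSum_freeVonMangoldt_le hfin hN (hnk k) n).trans (hl x)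
  have hm : ∀ k x : ℕ, ∑ n ∈ Ioc 0 x, ‖normSum hN hfin (fun s => freeMoebius s * Ψ s ^ k) n‖ ≤
      (c + C) * x := fun k x => by
    have h1 : ∀ n, ‖normSum hN hfin (fun s => freeMoebius s * Ψ s ^ k) n‖ ≤
        (normSum hN hfin (fun _ => 1) n).re := fun n => by
      refine (norm_sum_le _ _).trans ?_
      rw [fiberSum_apply, Complex.re_sum]
      refine sum_le_sum fun s _ => ?_
      rw [norm_mul, hnk, mul_one]
      exact norm_freeMoebius_le s
    refine (sum_le_sum fun n _ => h1 n).trans ?_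
    rw [← Complex.re_sum]
    have h2 := (Complex.re_le_norm _).trans (h0 x)
    rw [Complex.sub_re, ← Complex.ofReal_natCast, ← Complex.ofReal_mul, Complex.ofReal_re] at h2
    have h3 : √(x : ℝ) ≤ x := by
      rcases Nat.eq_zero_or_pos x with rfl | hx
      · simp
      · have : (1 : ℝ) ≤ x := by exact_mod_cast hx
        rw [Real.sqrt_le_left (by linarith)]
        nlinarith
    nlinarith
  have hdich : ∀ k ∈ ({1, 2, 4} : Finset ℕ), ∃ K : ℝ,
      (∀ x : ℕ, 1 ≤ x → ‖∑ n ∈ Ioc 0 x, l k n / n‖ ≤ K) ∨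
      (∀ x : ℕ, 1 ≤ x → ‖∑ n ∈ Ioc 0 x, l k n / n + (Real.log x : ℝ)‖ ≤ K) := fun k hk' =>
    mertens_dichotomy (hk k hk') (hlk k) (hm k)
      (normSum_mul_freeMoebius hN hfin (hadd k) (hone k)) (logTwist_normSum hN hfin (hadd k))
  obtain ⟨K₁, h₁⟩ := hdich 1 (by simp)
  obtain ⟨K₂, h₂⟩ := hdich 2 (by simp)
  obtain ⟨K₄, h₄⟩ := hdich 4 (by simp)
  obtain ⟨K₀, h₀⟩ := mertens_principal (l := l 0) hc h0 (hlk 0) (by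
    have := logTwist_normSum hN hfin (χ := fun s => Ψ s ^ 0) (hadd 0)
    simpa [l] using this)
  have hl0 : ∀ n, l 0 n = (mangoldtSum hfin (fun _ => 1) n : ℝ) := fun n => by
    simp only [l, mangoldtSum, fiberSum_apply, pow_zero, mul_one, Complex.ofReal_sum]
  have hlre : ∀ k n, (l k n).re = mangoldtSum hfin (fun s => (Ψ s ^ k).re) n := fun k n => by
    simp only [l, mangoldtSum, fiberSum_apply, Complex.re_sum, Complex.re_ofReal_mul]
  have hsq : ∀ s, (Ψ s).re ^ 2 + (Ψ s).im ^ 2 = 1 := fun s => by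
    have := Complex.sq_norm (Ψ s)
    rw [hn, Complex.normSq_apply] at this
    linarith
  have hmono : ∀ {g g' : (P →₀ ℕ) → ℝ} (n), (∀ s, g s ≤ g' s) →
      mangoldtSum hfin g n ≤ mangoldtSum hfin g' n := fun n h =>
    sum_le_sum fun s _ => mul_le_mul_of_nonneg_left (h s) (freeVonMangoldt_nonneg N s)
  have hlin : ∀ (g g' : (P →₀ ℕ) → ℝ) (a b : ℝ) (n), a * mangoldtSum hfin g n +
      b * mangoldtSum hfin g' n = mangoldtSum hfin (fun s => a * g s + b * g' s) n :=
    fun g g' a b n => by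
      simp only [mangoldtSum, mul_sum, ← sum_add_distrib]
      exact sum_congr rfl fun s _ => by ring
  have hre2 : ∀ z : ℂ, (z ^ 2).re = z.re ^ 2 - z.im ^ 2 := fun z => by
    rw [sq, Complex.mul_re]; ring
  have hp : ∀ k n, mangoldtSum hfin (fun _ => 1) n - (l (2 * k) n).re ≤
      4 * (mangoldtSum hfin (fun _ => 1) n + (l k n).re) := fun k n => by
    rw [hlre, hlre]
    have e1 := hlin (fun _ => 1) (fun s => (Ψ s ^ (2 * k)).re) 1 (-1) n
    have e2 := hlin (fun _ => 1) (fun s => (Ψ s ^ k).re) 4 4 n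
    have := hmono (g := fun s => 1 * 1 + -1 * (Ψ s ^ (2 * k)).re)
      (g' := fun s => 4 * 1 + 4 * (Ψ s ^ k).re) n fun s => by
        have h1 : (Ψ s ^ k).re ^ 2 + (Ψ s ^ k).im ^ 2 = 1 := by
          have := Complex.sq_norm (Ψ s ^ k)
          rw [hnk, Complex.normSq_apply] at this
          linarith
        rw [mul_comm 2 k, pow_mul, hre2]
        nlinarith [sq_nonneg ((Ψ s ^ k).re + 1)]
    linarith
  refine mertens_positive_part (l₀ := mangoldtSum hfin fun _ => 1) (l₁ := l 1) (l₂ := l 2)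
    (l₄ := l 4) (K₀ := K₀) (fun x hx => ?_) h₁ h₂ h₄ (hp 1) (hp 2) fun n => ?_
  · have := h₀ x hx
    simp only [hl0] at this
    rw [← Real.norm_eq_abs, ← Complex.norm_real]
    push_cast at this ⊢
    exact this
  · rw [hlre, hlre]
    simp only [mangoldtSum, sum_div, ← sum_add_distrib, mul_sum]
    refine sum_le_sum fun s _ => ?_
    have h1 : (Ψ s ^ 1).re + 1 / 2 + (Ψ s ^ 2).re / 2 ≤ 2 * max (Ψ s).re 0 := by
      rw [pow_one, hre2]
      have := hsq s
      rcases le_total 0 (Ψ s).re with h | h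
      · rw [max_eq_left h]; nlinarith [sq_nonneg (Ψ s).im]
      · rw [max_eq_right h]; nlinarith [sq_nonneg (Ψ s).im]
    have := mul_le_mul_of_nonneg_left h1 (freeVonMangoldt_nonneg N s)
    linarith

end FreeMonoidCharacters

section Eisenstein

/-- The ring of Eisenstein integers `ℤ[ω]`, `ω² + ω + 1 = 0`. -/
abbrev Eisenstein := QuadraticAlgebra ℤ (-1) (-1)

namespace Eisenstein

lemma norm_eq (x : Eisenstein) : x.norm = x.re ^ 2 - x.re * x.im + x.im ^ 2 := by
  rw [QuadraticAlgebra.norm_def]; ring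

lemma four_mul_norm (x : Eisenstein) : 4 * x.norm = (2 * x.re - x.im) ^ 2 + 3 * x.im ^ 2 := by
  rw [norm_eq]; ring

lemma norm_nonneg (x : Eisenstein) : 0 ≤ x.norm := by
  have := four_mul_norm x
  nlinarith [sq_nonneg (2 * x.re - x.im), sq_nonneg x.im]

lemma norm_eq_zero {x : Eisenstein} : x.norm = 0 ↔ x = 0 := by
  refine ⟨fun h => ?_, fun h => by rw [h, QuadraticAlgebra.norm_zero]⟩
  have h1 := four_mul_norm x
  rw [h] at h1
  have h2 : x.im = 0 := by
    have : x.im ^ 2 = 0 := by nlinarith [sq_nonneg (2 * x.re - x.im), sq_nonneg x.im]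
    exact pow_eq_zero_iff (two_ne_zero) |>.1 this
  have h3 : x.re = 0 := by
    rw [h2] at h1
    have : x.re ^ 2 = 0 := by linarith
    exact pow_eq_zero_iff (two_ne_zero) |>.1 this
  ext <;> simp [h2, h3]

lemma norm_pos {x : Eisenstein} (hx : x ≠ 0) : 0 < x.norm :=
  (norm_nonneg x).lt_of_ne fun h => hx (norm_eq_zero.1 h.symm)

instance : NoZeroDivisors Eisenstein where
  eq_zero_or_eq_zero_of_mul_eq_zero {x y} h := by
    have := congrArg QuadraticAlgebra.norm h
    rw [map_mul, QuadraticAlgebra.norm_zero, mul_eq_zero, norm_eq_zero, norm_eq_zero] at this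
    exact this

instance : IsDomain Eisenstein := NoZeroDivisors.to_isDomain _

lemma mul_star_self (x : Eisenstein) : x * star x = ((x.norm : ℤ) : Eisenstein) := by
  ext
  · simp only [QuadraticAlgebra.re_mul, QuadraticAlgebra.re_star, QuadraticAlgebra.im_star,
      QuadraticAlgebra.re_intCast, Int.cast_id]
    rw [norm_eq]; ring
  · simp; ring

lemma exists_norm_sub_mul_lt (x : Eisenstein) {y : Eisenstein} (hy : y ≠ 0) :
    ∃ q : Eisenstein, (x - y * q).norm < y.norm := by
  have hn := norm_pos hy
  set n := y.norm with hn'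
  set z := x * star y with hz
  have hr : ∀ u : ℤ, ∃ q : ℤ, |2 * (u - n * q)| ≤ n := fun u => by
    refine ⟨(2 * u + n) / (2 * n), abs_le.2 ?_⟩
    have h1 := Int.emod_add_mul_ediv (2 * u + n) (2 * n)
    have h2 := Int.emod_nonneg (2 * u + n) (by omega : 2 * n ≠ 0)
    have h3 := Int.emod_lt_of_pos (2 * u + n) (by omega : 0 < 2 * n)
    constructor <;> nlinarith
  obtain ⟨q₁, h₁⟩ := hr z.re
  obtain ⟨q₂, h₂⟩ := hr z.im
  refine ⟨⟨q₁, q₂⟩, ?_⟩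
  have e : (x - y * ⟨q₁, q₂⟩) * star y = ⟨z.re - n * q₁, z.im - n * q₂⟩ := by
    have : (x - y * ⟨q₁, q₂⟩) * star y = z - (y * star y) * ⟨q₁, q₂⟩ := by rw [hz]; ring
    rw [this, mul_star_self]
    ext <;> simp [hn']
  have e2 := congrArg QuadraticAlgebra.norm e
  rw [map_mul, QuadraticAlgebra.norm_star, norm_eq ⟨z.re - n * q₁, z.im - n * q₂⟩] at e2
  simp only at e2
  set e₁ := z.re - n * q₁
  set e₂ := z.im - n * q₂
  have h3 := abs_le.1 h₁
  have h4 := abs_le.1 h₂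
  have h5 : e₁ ^ 2 - e₁ * e₂ + e₂ ^ 2 < n * n := by
    have a1 : (2 * e₁) ^ 2 ≤ n ^ 2 := sq_le_sq' h3.1 h3.2
    have a2 : (2 * e₂) ^ 2 ≤ n ^ 2 := sq_le_sq' h4.1 h4.2
    nlinarith [sq_nonneg (e₁ + e₂)]
  rw [← e2] at h5
  exact lt_of_mul_lt_mul_right h5 hn.le

noncomputable instance : EuclideanDomain Eisenstein where
  quotient x y := by
    classical exact if hy : y = 0 then 0 else (exists_norm_sub_mul_lt x hy).choose
  quotient_zero x := by simp
  remainder x y := by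
    classical exact x - y * (if hy : y = 0 then 0 else (exists_norm_sub_mul_lt x hy).choose)
  quotient_mul_add_remainder_eq x y := by simp
  r x y := x.norm.natAbs < y.norm.natAbs
  r_wellFounded := (measure fun x : Eisenstein => x.norm.natAbs).wf
  remainder_lt x y hy := by
    have h := (exists_norm_sub_mul_lt x hy).choose_spec
    rw [dif_neg hy]
    have := norm_nonneg (x - y * (exists_norm_sub_mul_lt x hy).choose)
    omega
  mul_left_not_lt x y hy := by
    rw [map_mul, Int.natAbs_mul, not_lt]
    exact Nat.le_mul_of_pos_right _ (Int.natAbs_pos.2 (norm_pos hy).ne')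

lemma norm_eq_one_of_isUnit {x : Eisenstein} (hx : IsUnit x) : x.norm = 1 := by
  have := QuadraticAlgebra.isUnit_iff_norm_isUnit.1 hx
  have h2 := norm_nonneg x
  rcases Int.isUnit_iff.1 this with h | h <;> omega

lemma isUnit_of_norm_eq_one {x : Eisenstein} (hx : x.norm = 1) : IsUnit x :=
  QuadraticAlgebra.isUnit_iff_norm_isUnit.2 (by rw [hx]; exact isUnit_one)

/-- An Eisenstein integer is primary if it is congruent to `1` modulo `3`. -/
def Primary (x : Eisenstein) : Prop := 3 ∣ x.re - 1 ∧ 3 ∣ x.im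

lemma Primary.mul {x y : Eisenstein} (hx : x.Primary) (hy : y.Primary) : (x * y).Primary := by
  obtain ⟨⟨a, ha⟩, b, hb⟩ := hx
  obtain ⟨⟨c, hc⟩, d, hd⟩ := hy
  have ha' : x.re = 3 * a + 1 := by omega
  have hc' : y.re = 3 * c + 1 := by omega
  constructor
  · refine ⟨3 * a * c + a + c - 3 * b * d, ?_⟩
    simp [ha', hb, hc', hd]; ring
  · refine ⟨d * (3 * a + 1) + b * (3 * c + 1) - 3 * b * d, ?_⟩
    simp [ha', hb, hc', hd]; ring

lemma primary_one : (1 : Eisenstein).Primary := ⟨by simp, by simp⟩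

lemma Primary.pow {x : Eisenstein} (hx : x.Primary) (n : ℕ) : (x ^ n).Primary := by
  induction n with
  | zero => simpa using primary_one
  | succ n ih => rw [pow_succ]; exact ih.mul hx

lemma Primary.star {x : Eisenstein} (hx : x.Primary) : (star x).Primary := by
  obtain ⟨⟨a, ha⟩, b, hb⟩ := hx
  refine ⟨⟨a - b, ?_⟩, -b, ?_⟩ <;> simp <;> omega

lemma Primary.of_mul_left {u x : Eisenstein} (hx : x.Primary) (hux : (u * x).Primary) :
    u.Primary := by
  obtain ⟨⟨a, ha⟩, b, hb⟩ := hx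
  obtain ⟨⟨c, hc⟩, d, hd⟩ := hux
  have ha' : x.re = 3 * a + 1 := by omega
  simp [ha', hb] at hc hd
  constructor
  · exact ⟨c - u.re * a + u.im * b, by linarith⟩
  · exact ⟨d - u.re * b - u.im * a + u.im * b, by linarith⟩

lemma Primary.eq_one_of_isUnit {x : Eisenstein} (hx : x.Primary) (hu : IsUnit x) : x = 1 := by
  obtain ⟨⟨a, ha⟩, b, hb⟩ := hx
  have h1 := four_mul_norm x
  rw [norm_eq_one_of_isUnit hu, hb] at h1
  have hb0 : b = 0 := by
    by_contra h
    have : 1 ≤ b ^ 2 := Int.one_le_abs h |>.trans (by nlinarith [sq_abs b, abs_nonneg b, Int.one_le_abs h])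
    nlinarith [sq_nonneg (2 * x.re - 3 * b)]
  subst hb0
  have h2 : x.re = 1 := by
    have : (x.re - 1) * (x.re + 1) = 0 := by linarith
    rcases mul_eq_zero.1 this with h | h <;> omega
  ext <;> simp [h2, hb]

lemma Primary.eq_of_associated {x y : Eisenstein} (hx : x.Primary) (hy : y.Primary)
    (h : Associated x y) : x = y := by
  obtain ⟨u, rfl⟩ := h
  rw [mul_comm] at hy
  rw [(hx.of_mul_left hy).eq_one_of_isUnit u.isUnit, mul_one]

lemma Primary.three_not_dvd_norm {x : Eisenstein} (hx : x.Primary) : ¬ 3 ∣ x.norm := by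
  obtain ⟨⟨a, ha⟩, b, hb⟩ := hx
  have ha' : x.re = 3 * a + 1 := by omega
  rw [norm_eq, ha', hb]
  have : (3 * a + 1) ^ 2 - (3 * a + 1) * (3 * b) + (3 * b) ^ 2 =
    3 * (3 * a ^ 2 + 2 * a - (3 * a + 1) * b + 3 * b ^ 2) + 1 := by ring
  omega

lemma exists_unit_mul_primary {x : Eisenstein} (hx : ¬ 3 ∣ x.norm) :
    ∃ u : Eisenstein, IsUnit u ∧ (u * x).Primary := by
  have h : ¬ 3 ∣ x.re + x.im := fun ⟨c, hc⟩ => hx ⟨3 * c ^ 2 - x.re * x.im, by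
    rw [norm_eq]; linear_combination (x.re + x.im + 3 * c) * hc⟩
  have cases : (x.re % 3 = 1 ∧ x.im % 3 = 0) ∨ (x.re % 3 = 2 ∧ x.im % 3 = 0) ∨
      (x.re % 3 = 0 ∧ x.im % 3 = 1) ∨ (x.re % 3 = 0 ∧ x.im % 3 = 2) ∨
      (x.re % 3 = 1 ∧ x.im % 3 = 1) ∨ (x.re % 3 = 2 ∧ x.im % 3 = 2) := by omega
  rcases cases with h | h | h | h | h | h
  · refine ⟨⟨1, 0⟩, isUnit_of_norm_eq_one (by rw [norm_eq]; norm_num), ?_, ?_⟩ <;> simp <;> omega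
  · refine ⟨⟨-1, 0⟩, isUnit_of_norm_eq_one (by rw [norm_eq]; norm_num), ?_, ?_⟩ <;> simp <;> omega
  · refine ⟨⟨-1, -1⟩, isUnit_of_norm_eq_one (by rw [norm_eq]; norm_num), ?_, ?_⟩ <;> simp <;> omega
  · refine ⟨⟨1, 1⟩, isUnit_of_norm_eq_one (by rw [norm_eq]; norm_num), ?_, ?_⟩ <;> simp <;> omega
  · refine ⟨⟨0, -1⟩, isUnit_of_norm_eq_one (by rw [norm_eq]; norm_num), ?_, ?_⟩ <;> simp <;> omega
  · refine ⟨⟨0, 1⟩, isUnit_of_norm_eq_one (by rw [norm_eq]; norm_num), ?_, ?_⟩ <;> simp <;> omega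

end Eisenstein

end Eisenstein

section Eisenstein

namespace Eisenstein

lemma finite_norm_le (x : ℤ) : {y : Eisenstein | y.norm ≤ x}.Finite := by
  refine ((Set.finite_Icc (-(2 * x)) (2 * x)).prod (Set.finite_Icc (-(2 * x)) (2 * x))).preimage
    (f := fun y : Eisenstein => (y.re, y.im)) (fun a _ b _ h => ?_) |>.subset fun y hy => ?_
  · ext
    · exact (Prod.ext_iff.1 h).1
    · exact (Prod.ext_iff.1 h).2
  · have h1 : y.norm ≤ x := hy
    rw [norm_eq] at h1
    have key : ∀ a b : ℤ, a ^ 2 - a * b + b ^ 2 ≤ x → -(2 * x) ≤ a ∧ a ≤ 2 * x := fun a b h => by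
      have h2 : a ^ 2 ≤ 2 * x := by nlinarith [sq_nonneg (2 * b - a), sq_nonneg a]
      constructor <;> nlinarith [sq_nonneg (a - 1), sq_nonneg (a + 1)]
    simp only [Set.mem_preimage, Set.mem_prod, Set.mem_Icc]
    exact ⟨key _ _ h1, key y.im y.re (by linarith)⟩

/-- Primary prime elements: every prime ideal not dividing `3` has a unique such generator. -/
abbrev PrimaryPrime := {π : Eisenstein // Prime π ∧ π.Primary}

noncomputable instance : DecidableEq PrimaryPrime := Classical.decEq _

namespace PrimaryPrime

/-- The norm of a primary prime as a natural number. -/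
def norm (π : PrimaryPrime) : ℕ := π.1.norm.natAbs

lemma natCast_norm (π : PrimaryPrime) : (π.norm : ℤ) = π.1.norm :=
  Int.natAbs_of_nonneg (norm_nonneg _)

lemma two_le_norm (π : PrimaryPrime) : 2 ≤ π.norm := by
  have h0 := norm_pos π.2.1.ne_zero
  have h1 : π.1.norm ≠ 1 := fun h => π.2.1.not_isUnit (isUnit_of_norm_eq_one h)
  have := π.natCast_norm
  omega

lemma prime_star {x : Eisenstein} (hx : Prime x) : Prime (star x) :=
  (MulEquiv.prime_iff (starRingAut : RingAut Eisenstein)).2 hx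

/-- The complex conjugate of a primary prime. -/
def conj (π : PrimaryPrime) : PrimaryPrime := ⟨star π.1, prime_star π.2.1, π.2.2.star⟩

lemma natCast_norm_eq_mul (π : PrimaryPrime) : ((π.norm : ℕ) : Eisenstein) = π.1 * π.conj.1 := by
  rw [conj, mul_star_self, ← natCast_norm, Int.cast_natCast]

lemma eq_or_eq_conj {π π' : PrimaryPrime} {j j' : ℕ} (hj' : j' ≠ 0)
    (h : π.norm ^ j = π'.norm ^ j') : π' = π ∨ π' = π.conj := by
  have h1 : π'.1 ∣ (π.1 * π.conj.1) ^ j := by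
    have h2 := congrArg (Nat.cast : ℕ → Eisenstein) h
    push_cast at h2
    rw [← natCast_norm_eq_mul, h2, natCast_norm_eq_mul]
    exact (dvd_mul_right _ _).trans (dvd_pow_self _ hj')
  rcases π'.2.1.dvd_or_dvd (π'.2.1.dvd_of_dvd_pow h1) with h2 | h2
  · exact Or.inl (Subtype.ext (π'.2.2.eq_of_associated π.2.2 (π'.2.1.associated_of_dvd π.2.1 h2)))
  · exact Or.inr (Subtype.ext (π'.2.2.eq_of_associated π.conj.2.2
      (π'.2.1.associated_of_dvd π.conj.2.1 h2)))

lemma norm_conj (π : PrimaryPrime) : π.conj.norm = π.norm := by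
  rw [norm, conj, QuadraticAlgebra.norm_star, norm]

lemma norm_eq_prime_or_sq (π : PrimaryPrime) : ∃ q : ℕ, q.Prime ∧ (π.norm = q ∨ π.norm = q ^ 2) := by
  have h0 : π.norm ≠ 0 := by have := π.two_le_norm; omega
  have h1 : π.1 ∣ ((π.norm.primeFactorsList.map (Nat.cast : ℕ → Eisenstein)).prod) := by
    rw [← Nat.cast_list_prod, Nat.prod_primeFactorsList h0, natCast_norm_eq_mul]
    exact dvd_mul_right _ _
  obtain ⟨a, ha, hd⟩ := π.2.1.dvd_prod_iff.1 h1
  obtain ⟨q, hq, rfl⟩ := List.mem_map.1 ha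
  have hqp := Nat.prime_of_mem_primeFactorsList hq
  refine ⟨q, hqp, ?_⟩
  have h2 : π.norm ∣ q ^ 2 := by
    have := map_dvd (QuadraticAlgebra.norm (R := ℤ)) hd
    rw [QuadraticAlgebra.norm_natCast, ← natCast_norm] at this
    exact_mod_cast this
  obtain ⟨k, hk, hk'⟩ := (Nat.dvd_prime_pow hqp).1 h2
  have := π.two_le_norm
  interval_cases k
  · rw [pow_zero] at hk'
    omega
  · left; rw [hk', pow_one]
  · right; exact hk'

lemma log_norm_le (π : PrimaryPrime) {j : ℕ} (hj : j ≠ 0) :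
    Real.log π.norm ≤ 2 * ArithmeticFunction.vonMangoldt (π.norm ^ j) := by
  obtain ⟨q, hq, h | h⟩ := π.norm_eq_prime_or_sq
  · rw [h, ArithmeticFunction.vonMangoldt_apply_pow hj, ArithmeticFunction.vonMangoldt_apply_prime hq]
    have := Real.log_natCast_nonneg q
    linarith
  · rw [h, ← pow_mul, ArithmeticFunction.vonMangoldt_apply_pow (by omega),
      ArithmeticFunction.vonMangoldt_apply_prime hq, Nat.cast_pow, Real.log_pow]
    simp

end PrimaryPrime

/-- The primary Eisenstein integer with a given factorization into primary primes. -/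
noncomputable def primeProd (s : PrimaryPrime →₀ ℕ) : Eisenstein := s.prod fun π e => π.1 ^ e

lemma primeProd_add (s t : PrimaryPrime →₀ ℕ) :
    primeProd (s + t) = primeProd s * primeProd t :=
  Finsupp.prod_add_index' (fun _ => pow_zero _) fun _ _ _ => pow_add _ _ _

lemma primeProd_zero : primeProd 0 = 1 := Finsupp.prod_zero_index

lemma primeProd_single (π : PrimaryPrime) (j : ℕ) :
    primeProd (Finsupp.single π j) = π.1 ^ j := Finsupp.prod_single_index (pow_zero _)

lemma primary_primeProd (s : PrimaryPrime →₀ ℕ) : (primeProd s).Primary := by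
  induction s using Finsupp.induction_linear with
  | zero => rw [primeProd_zero]; exact primary_one
  | add s t hs ht => rw [primeProd_add]; exact hs.mul ht
  | single π j => rw [primeProd_single]; exact π.2.2.pow j

lemma norm_primeProd (s : PrimaryPrime →₀ ℕ) :
    (primeProd s).norm = freeNorm PrimaryPrime.norm s := by
  induction s using Finsupp.induction_linear with
  | zero => simp [primeProd_zero, freeNorm]
  | add s t hs ht => rw [primeProd_add, freeNorm_add, map_mul, hs, ht, Nat.cast_mul]
  | single π j => rw [primeProd_single, freeNorm_single, map_pow, Nat.cast_pow,
      PrimaryPrime.natCast_norm]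

lemma primeProd_eq_prod_toMultiset (s : PrimaryPrime →₀ ℕ) :
    primeProd s = (s.toMultiset.map Subtype.val).prod := by
  induction s using Finsupp.induction_linear with
  | zero => simp [primeProd_zero]
  | add s t hs ht => rw [primeProd_add, hs, ht, map_add, Multiset.map_add, Multiset.prod_add]
  | single π j => rw [primeProd_single, Finsupp.toMultiset_single, Multiset.map_nsmul,
      Multiset.prod_nsmul, Multiset.map_singleton, Multiset.prod_singleton]

lemma primeProd_injective : Function.Injective primeProd := fun s t h => by
  rw [primeProd_eq_prod_toMultiset, primeProd_eq_prod_toMultiset] at h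
  have hirr : ∀ s : PrimaryPrime →₀ ℕ, ∀ x ∈ s.toMultiset.map Subtype.val, Irreducible x :=
    fun s x hx => by
      obtain ⟨π, _, rfl⟩ := Multiset.mem_map.1 hx
      exact π.2.1.irreducible
  have hprim : ∀ s : PrimaryPrime →₀ ℕ, ∀ x ∈ s.toMultiset.map Subtype.val, x.Primary :=
    fun s x hx => by
      obtain ⟨π, _, rfl⟩ := Multiset.mem_map.1 hx
      exact π.2.2
  have h1 := UniqueFactorizationMonoid.factors_unique (hirr s) (hirr t) (Associated.of_eq h)
  have h2 := Multiset.rel_eq.1 (h1.mono fun x hx y hy hxy =>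
    (hprim s x hx).eq_of_associated (hprim t y hy) hxy)
  exact Multiset.toFinsupp.symm.injective (Multiset.map_injective Subtype.val_injective h2)

lemma exists_unit_mul_primeProd (x : Eisenstein) :
    ¬ 3 ∣ x.norm → ∃ u s, IsUnit u ∧ x = u * primeProd s := by
  induction x using UniqueFactorizationMonoid.induction_on_prime with
  | h₁ => intro h; simp at h
  | h₂ x hx => exact fun _ => ⟨x, 0, hx, by rw [primeProd_zero, mul_one]⟩
  | h₃ a p ha hp ih =>
    intro h
    rw [map_mul] at h
    obtain ⟨u, s, hu, hs⟩ := ih fun h' => h (h'.mul_left _)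
    obtain ⟨v, hv, hvp⟩ := exists_unit_mul_primary (x := p) fun h' => h (h'.mul_right _)
    obtain ⟨w, hw⟩ := hv.exists_left_inv
    refine ⟨w * u, s + Finsupp.single ⟨v * p, (associated_unit_mul_left p v hv).prime_iff.2 hp, hvp⟩ 1,
      (IsUnit.of_mul_eq_one v hw).mul hu, ?_⟩
    rw [primeProd_add, primeProd_single, pow_one, hs]
    linear_combination (-p * u * primeProd s) * hw

lemma Primary.exists_primeProd_eq {x : Eisenstein} (hx : x.Primary) : ∃ s, primeProd s = x := by
  obtain ⟨u, s, hu, rfl⟩ := exists_unit_mul_primeProd x hx.three_not_dvd_norm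
  have := ((primary_primeProd s).of_mul_left hx).eq_one_of_isUnit hu
  exact ⟨s, by rw [this, one_mul]⟩

lemma finite_freeNorm_eq (n : ℕ) : {s | freeNorm PrimaryPrime.norm s = n}.Finite :=
  ((finite_norm_le n).preimage primeProd_injective.injOn).subset fun s hs => by
    have : freeNorm PrimaryPrime.norm s = n := hs
    simp [norm_primeProd, this]

end Eisenstein

end Eisenstein

section EisensteinComplex

namespace Eisenstein

/-- The standard embedding of the Eisenstein integers into `ℂ`. -/
noncomputable def toC : Eisenstein →+* ℂ :=
  (QuadraticAlgebra.lift (R := ℤ) (a := -1) (b := -1) (A := ℂ) ⟨⟨-1 / 2, √3 / 2⟩, by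
    have h : √(3 : ℝ) * √3 = 3 := Real.mul_self_sqrt (by norm_num)
    apply Complex.ext
    · simp only [Complex.mul_re, Complex.add_re, Complex.smul_re, Complex.one_re]
      simp
      linear_combination (-1 / 4) * h
    · simp only [Complex.mul_im, Complex.add_im, Complex.smul_im, Complex.one_im]
      simp
      ring⟩).toRingHom

lemma toC_re (x : Eisenstein) : (toC x).re = x.re - x.im / 2 := by
  change ((x.re • (1 : ℂ) + x.im • (⟨-1 / 2, √3 / 2⟩ : ℂ))).re = _
  simp; ring

lemma toC_im (x : Eisenstein) : (toC x).im = x.im * (√3 / 2) := by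
  change ((x.re • (1 : ℂ) + x.im • (⟨-1 / 2, √3 / 2⟩ : ℂ))).im = _
  simp

lemma normSq_toC (x : Eisenstein) : Complex.normSq (toC x) = x.norm := by
  have h : √(3 : ℝ) * √3 = 3 := Real.mul_self_sqrt (by norm_num)
  rw [Complex.normSq_apply, toC_re, toC_im, norm_eq]
  push_cast
  linear_combination (x.im ^ 2 / 4 : ℝ) * h

lemma sq_norm_toC (x : Eisenstein) : ‖toC x‖ ^ 2 = x.norm := by
  rw [Complex.sq_norm, normSq_toC]

lemma norm_toC (x : Eisenstein) : ‖toC x‖ = √(x.norm : ℝ) := by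
  rw [← sq_norm_toC, Real.sqrt_sq (_root_.norm_nonneg _)]

lemma toC_eq_zero {x : Eisenstein} : toC x = 0 ↔ x = 0 := by
  rw [← Complex.normSq_eq_zero, normSq_toC, Int.cast_eq_zero, norm_eq_zero]

/-- The direction of an Eisenstein integer as a unit complex number. -/
noncomputable def dir (x : Eisenstein) : ℂ := toC x / ‖toC x‖

lemma dir_mul (x y : Eisenstein) : dir (x * y) = dir x * dir y := by
  simp only [dir, map_mul, norm_mul, Complex.ofReal_mul]
  rw [mul_div_mul_comm]

lemma dir_one : dir 1 = 1 := by simp [dir]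

lemma norm_dir {x : Eisenstein} (hx : x ≠ 0) : ‖dir x‖ = 1 := by
  have : ‖toC x‖ ≠ 0 := norm_ne_zero_iff.2 (toC_eq_zero.not.2 hx)
  rw [dir, norm_div, Complex.norm_real, norm_norm, div_self this]

lemma norm_dir_le (x : Eisenstein) : ‖dir x‖ ≤ 1 := by
  rw [dir, norm_div, Complex.norm_real, norm_norm]
  exact div_self_le_one _

lemma dir_re (x : Eisenstein) : (dir x).re = (2 * x.re - x.im : ℤ) / (2 * √(x.norm : ℝ)) := by
  rw [dir, Complex.div_ofReal_re, toC_re, norm_toC]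
  push_cast
  rw [← div_div]
  ring

lemma Primary.ne_zero {x : Eisenstein} (hx : x.Primary) : x ≠ 0 := by
  rintro rfl
  obtain ⟨⟨a, ha⟩, -⟩ := hx
  simp at ha
  omega

/-- The primary Eisenstein integers of norm at most `x`. -/
noncomputable def primaryNormLE (x : ℤ) : Finset Eisenstein :=
  ((finite_norm_le x).subset (t := {y | y.norm ≤ x ∧ y.Primary}) fun _ h => h.1).toFinset

lemma mem_primaryNormLE {x : ℤ} {y : Eisenstein} :
    y ∈ primaryNormLE x ↔ y.norm ≤ x ∧ y.Primary := by
  simp [primaryNormLE]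

lemma sum_normSum (f : Eisenstein → ℂ) (x : ℕ) :
    ∑ n ∈ Ioc 0 x, normSum PrimaryPrime.two_le_norm finite_freeNorm_eq (fun s => f (primeProd s)) n
      = ∑ y ∈ primaryNormLE x, f y := by
  simp only [fiberSum_apply]
  rw [sum_sigma']
  refine sum_bij (fun a _ => primeProd a.2) ?_ ?_ ?_ fun _ _ => rfl
  · rintro ⟨n, s⟩ h
    simp only [mem_sigma, mem_Ioc, Set.Finite.mem_toFinset, Set.mem_ofPred_eq] at h
    rw [mem_primaryNormLE, norm_primeProd, h.2]
    exact ⟨by exact_mod_cast h.1.2, primary_primeProd _⟩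
  · rintro ⟨n, s⟩ h ⟨n', s'⟩ h' he
    simp only [mem_sigma, mem_Ioc, Set.Finite.mem_toFinset, Set.mem_ofPred_eq] at h h'
    obtain rfl := primeProd_injective he
    obtain rfl : n = n' := h.2.symm.trans h'.2
    rfl
  · intro y hy
    rw [mem_primaryNormLE] at hy
    obtain ⟨s, rfl⟩ := hy.2.exists_primeProd_eq
    refine ⟨⟨freeNorm PrimaryPrime.norm s, s⟩, ?_, rfl⟩
    simp only [mem_sigma, mem_Ioc, Set.Finite.mem_toFinset, Set.mem_ofPred_eq, and_true]
    refine ⟨Nat.pos_of_ne_zero (freeNorm_ne_zero PrimaryPrime.two_le_norm s), ?_⟩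
    have := hy.1
    rw [norm_primeProd] at this
    exact_mod_cast this

/-- Weighted prime-element sum over the monoid of primary Eisenstein integers. -/
noncomputable abbrev vonMangoldtSum (g : (PrimaryPrime →₀ ℕ) → ℝ) (n : ℕ) : ℝ :=
  mangoldtSum finite_freeNorm_eq g n

lemma exists_of_freeVonMangoldt_ne_zero {n : ℕ} {s : PrimaryPrime →₀ ℕ}
    (hs : s ∈ (finite_freeNorm_eq n).toFinset)
    (h : freeVonMangoldt PrimaryPrime.norm s ≠ 0) :
    ∃ π : PrimaryPrime, ∃ j : ℕ, j ≠ 0 ∧ s = Finsupp.single π j ∧ π.norm ^ j = n := by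
  obtain ⟨π, j, hj, rfl⟩ := exists_single_of_freeVonMangoldt_ne_zero h
  refine ⟨π, j, hj, rfl, ?_⟩
  simpa [freeNorm_single] using hs

lemma vonMangoldtSum_one_le (n : ℕ) :
    vonMangoldtSum (fun _ => 1) n ≤ 4 * ArithmeticFunction.vonMangoldt n := by
  classical
  by_cases hex : ∃ s ∈ (finite_freeNorm_eq n).toFinset, freeVonMangoldt PrimaryPrime.norm s ≠ 0
  · obtain ⟨s, hs, h⟩ := hex
    obtain ⟨π, j, hj, rfl, hn⟩ := exists_of_freeVonMangoldt_ne_zero hs h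
    have hlog := π.log_norm_le hj
    rw [hn] at hlog
    have hsub : ∀ t ∈ (finite_freeNorm_eq n).toFinset,
        t ∉ ({Finsupp.single π j, Finsupp.single π.conj j} : Finset (PrimaryPrime →₀ ℕ)) →
          freeVonMangoldt PrimaryPrime.norm t * 1 = 0 := by
      intro t ht hnt
      by_contra h0
      rw [mul_one] at h0
      obtain ⟨π', j', hj', rfl, hn'⟩ := exists_of_freeVonMangoldt_ne_zero ht h0
      have h1 : π'.norm = π.norm := by
        rcases PrimaryPrime.eq_or_eq_conj hj' (hn.trans hn'.symm) with rfl | rfl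
        · rfl
        · exact π.norm_conj
      have h2 : j' = j := by
        rw [h1, ← hn] at hn'
        exact Nat.pow_right_injective π.two_le_norm hn'
      subst h2
      apply hnt
      rcases PrimaryPrime.eq_or_eq_conj hj' (hn.trans hn'.symm) with rfl | rfl <;> simp
    have h2 : vonMangoldtSum (fun _ => 1) n ≤
        ∑ t ∈ ({Finsupp.single π j, Finsupp.single π.conj j} : Finset (PrimaryPrime →₀ ℕ)),
          freeVonMangoldt PrimaryPrime.norm t * 1 := by
      rw [vonMangoldtSum, mangoldtSum, ← sum_filter_of_ne (p := fun t => t ∈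
        ({Finsupp.single π j, Finsupp.single π.conj j} : Finset (PrimaryPrime →₀ ℕ)))
        fun t ht h0 => by_contra fun h1 => h0 (hsub t ht h1)]
      refine sum_le_sum_of_subset_of_nonneg (fun t ht => (mem_filter.1 ht).2) fun t _ _ => ?_
      rw [mul_one]
      exact freeVonMangoldt_nonneg _ _
    refine h2.trans ?_
    have h3 : ∀ t ∈ ({Finsupp.single π j, Finsupp.single π.conj j} : Finset (PrimaryPrime →₀ ℕ)),
        freeVonMangoldt PrimaryPrime.norm t * 1 ≤ 2 * ArithmeticFunction.vonMangoldt n := by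
      intro t ht
      rw [mem_insert, mem_singleton] at ht
      rcases ht with rfl | rfl
      · rwa [freeVonMangoldt_single _ _ hj, mul_one]
      · rwa [freeVonMangoldt_single _ _ hj, mul_one, π.norm_conj]
    refine (sum_le_card_nsmul _ _ _ h3).trans ?_
    rw [nsmul_eq_mul]
    have h4 : (#({Finsupp.single π j, Finsupp.single π.conj j} :
        Finset (PrimaryPrime →₀ ℕ)) : ℝ) ≤ 2 := by exact_mod_cast card_le_two
    have h5 := ArithmeticFunction.vonMangoldt_nonneg (n := n)
    nlinarith
  · push Not at hex
    rw [vonMangoldtSum, mangoldtSum, sum_eq_zero fun s hs => by rw [hex s hs, zero_mul]]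
    have h5 := ArithmeticFunction.vonMangoldt_nonneg (n := n)
    linarith

/-- The trace `x + x̄` of an Eisenstein integer. -/
def trace (x : Eisenstein) : ℤ := 2 * x.re - x.im

lemma trace_star (x : Eisenstein) : trace (star x) = trace x := by
  simp [trace]; ring

lemma trace_eq_of_norm_eq {π π' : PrimaryPrime} (h : π.norm = π'.norm) :
    trace π'.1 = trace π.1 := by
  rcases PrimaryPrime.eq_or_eq_conj (π := π) (π' := π') (j := 1) one_ne_zero (by rw [h])
    with rfl | rfl
  · rfl
  · exact trace_star _

lemma exists_primaryPrime_of_vonMangoldtSum_pos {p : ℕ} (hp : p.Prime)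
    (h : 0 < vonMangoldtSum (fun s => max (dir (primeProd s)).re 0) p) :
    ∃ π : PrimaryPrime, π.norm = p ∧ 0 < trace π.1 ∧
      vonMangoldtSum (fun s => max (dir (primeProd s)).re 0) p ≤
        2 * Real.log p * (trace π.1 / √(p : ℝ)) := by
  have key : ∀ s ∈ (finite_freeNorm_eq p).toFinset, freeVonMangoldt PrimaryPrime.norm s ≠ 0 →
      ∃ π : PrimaryPrime, s = Finsupp.single π 1 ∧ π.norm = p := fun s hs h0 => by
    obtain ⟨π, j, -, rfl, hn⟩ := exists_of_freeVonMangoldt_ne_zero hs h0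
    obtain rfl : j = 1 := Nat.Prime.eq_one_of_pow (hn ▸ hp)
    exact ⟨π, rfl, by simpa using hn⟩
  have hdir : ∀ π : PrimaryPrime, π.norm = p →
      (dir (primeProd (Finsupp.single π 1))).re = trace π.1 / (2 * √(p : ℝ)) := fun π hπ => by
    rw [primeProd_single, pow_one, dir_re, ← PrimaryPrime.natCast_norm, hπ, trace, Int.cast_natCast]
  obtain ⟨s, hs, hpos⟩ := exists_lt_of_sum_lt (f := fun _ => (0 : ℝ)) (by simpa [mangoldtSum] using h)
  obtain ⟨π, rfl, hπ⟩ := key s hs fun h0 => by simp [h0] at hpos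
  have h1 : 0 < (dir (primeProd (Finsupp.single π 1))).re := by
    by_contra h1
    rw [max_eq_right (not_lt.1 h1), mul_zero] at hpos
    exact hpos.false
  have hp0 : (0 : ℝ) < √(p : ℝ) := Real.sqrt_pos.2 (by exact_mod_cast hp.pos)
  rw [hdir π hπ] at h1
  have h2 : (0 : ℝ) < trace π.1 := by
    by_contra h2
    exact h1.not_ge (div_nonpos_of_nonpos_of_nonneg (not_lt.1 h2) (by positivity))
  refine ⟨π, hπ, by exact_mod_cast h2, ?_⟩
  have h3 : vonMangoldtSum (fun s => max (dir (primeProd s)).re 0) p =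
      vonMangoldtSum (fun _ => 1) p * (trace π.1 / (2 * √(p : ℝ))) := by
    rw [vonMangoldtSum, mangoldtSum, vonMangoldtSum, mangoldtSum, sum_mul]
    refine sum_congr rfl fun t ht => ?_
    by_cases h0 : freeVonMangoldt PrimaryPrime.norm t = 0
    · simp [h0]
    · obtain ⟨π', rfl, hπ'⟩ := key t ht h0
      rw [hdir π' hπ', trace_eq_of_norm_eq (hπ.trans hπ'.symm), max_eq_left h1.le, mul_one]
  rw [h3]
  calc _ ≤ 4 * ArithmeticFunction.vonMangoldt p * (trace π.1 / (2 * √(p : ℝ))) := by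
        gcongr; exact vonMangoldtSum_one_le p
    _ = _ := by
        rw [ArithmeticFunction.vonMangoldt_apply_prime hp]
        field_simp
        ring

end Eisenstein

end EisensteinComplex

section EisensteinCounting

open MeasureTheory

namespace Eisenstein

/-- The Eisenstein integer obtained by rounding down coordinates with respect to `1, ω`. -/
noncomputable def floorC (z : ℂ) : Eisenstein := ⟨⌊z.re + z.im / √3⌋, ⌊2 * z.im / √3⌋⟩

lemma floorC_add_toC (z : ℂ) (x : Eisenstein) : floorC (z + toC x) = floorC z + x := by
  have h3 : √(3 : ℝ) ≠ 0 := by positivity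
  ext
  · simp only [floorC, QuadraticAlgebra.re_add, Complex.add_re, Complex.add_im, toC_re, toC_im]
    rw [← Int.floor_add_intCast]
    congr 1
    field_simp
    ring
  · simp only [floorC, QuadraticAlgebra.im_add, Complex.add_im, toC_im]
    rw [← Int.floor_add_intCast]
    congr 1
    field_simp

lemma norm_sub_toC_floorC_le (z : ℂ) : ‖z - toC (floorC z)‖ ≤ 2 := by
  have h3 : √(3 : ℝ) ≠ 0 := by positivity
  have h : √(3 : ℝ) * √3 = 3 := Real.mul_self_sqrt (by norm_num)
  set s := Int.fract (z.re + z.im / √3) with hs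
  set t := Int.fract (2 * z.im / √3) with ht
  have hre : (z - toC (floorC z)).re = s - t / 2 := by
    rw [Complex.sub_re, toC_re, hs, ht, Int.fract, Int.fract]
    simp only [floorC]
    field_simp
    ring
  have him : (z - toC (floorC z)).im = t * (√3 / 2) := by
    rw [Complex.sub_im, toC_im, ht, Int.fract]
    simp only [floorC]
    field_simp
  rw [← Real.sqrt_sq (by norm_num : (0 : ℝ) ≤ 2), Complex.norm_eq_sqrt_sq_add_sq, hre, him]
  apply Real.sqrt_le_sqrt
  have h0 := Int.fract_nonneg (z.re + z.im / √3)
  have h1 := (Int.fract_lt_one (z.re + z.im / √3)).le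
  have h0' := Int.fract_nonneg (2 * z.im / √3)
  have h1' := (Int.fract_lt_one (2 * z.im / √3)).le
  rw [← hs] at h0 h1
  rw [← ht] at h0' h1'
  have : (s - t / 2) ^ 2 + (t * (√3 / 2)) ^ 2 = s ^ 2 - s * t + t ^ 2 := by
    linear_combination (t ^ 2 / 4) * h
  rw [this]
  nlinarith

lemma measurableSet_floorC_eq (x : Eisenstein) : MeasurableSet {z | floorC z = x} := by
  have : {z | floorC z = x} =
      {z : ℂ | ⌊z.re + z.im / √3⌋ = x.re} ∩ {z : ℂ | ⌊2 * z.im / √3⌋ = x.im} := by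
    ext z
    simp [floorC, QuadraticAlgebra.ext_iff]
  rw [this]
  refine .inter ?_ ?_
  · exact measurableSet_eq_fun (Int.measurable_floor.comp (by fun_prop)) measurable_const
  · exact measurableSet_eq_fun (Int.measurable_floor.comp (by fun_prop)) measurable_const

lemma volume_floorC_eq (x : Eisenstein) :
    volume {z | floorC z = x} = volume {z | floorC z = 0} := by
  rw [← measure_preimage_add_right volume (toC x)]
  congr 1
  ext z
  simp [floorC_add_toC]

lemma volume_biUnion_floorC (S : Finset Eisenstein) :
    volume (⋃ x ∈ S, {z | floorC z = x}) = #S * volume {z | floorC z = 0} := by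
  rw [measure_biUnion_finset (fun x _ y _ hxy => ?_) fun x _ => measurableSet_floorC_eq x,
    sum_congr rfl fun x _ => volume_floorC_eq x, sum_const, nsmul_eq_mul]
  exact Set.disjoint_left.2 fun z hz hz' => hxy (hz.symm.trans hz')

lemma volume_floorC_ne_top : volume {z | floorC z = 0} ≠ ⊤ := by
  refine ne_top_of_le_ne_top (measure_closedBall_lt_top (x := (0 : ℂ)) (r := 2)).ne
    (measure_mono fun z hz => ?_)
  have h : floorC z = 0 := hz
  have := norm_sub_toC_floorC_le z
  rw [h, map_zero, sub_zero] at this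
  simpa using this

lemma card_mul_volume_le {S : Finset Eisenstein} {w : ℂ} {ρ : ℝ} (hρ : 0 ≤ ρ)
    (hS : ∀ x, x ∈ S ↔ ‖toC x + w‖ ≤ ρ) :
    #S * (volume {z | floorC z = 0}).toReal ≤ Real.pi * (ρ + 2) ^ 2 := by
  have h1 : (⋃ x ∈ S, {z | floorC z = x}) ⊆ Metric.closedBall (-w) (ρ + 2) := fun z hz => by
    simp only [Set.mem_iUnion, Set.mem_ofPred_eq, exists_prop] at hz
    obtain ⟨x, hx, rfl⟩ := hz
    rw [mem_closedBall_iff_norm]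
    calc ‖z - -w‖ = ‖(z - toC (floorC z)) + (toC (floorC z) + w)‖ := by congr 1; ring
      _ ≤ 2 + ρ := norm_add_le_of_le (norm_sub_toC_floorC_le z) ((hS _).1 hx)
      _ = _ := add_comm _ _
  have h2 := ENNReal.toReal_mono (measure_closedBall_lt_top).ne (measure_mono (μ := volume) h1)
  rw [volume_biUnion_floorC, Complex.volume_closedBall] at h2
  simp only [ENNReal.toReal_mul, ENNReal.toReal_natCast, ENNReal.toReal_pow,
    ENNReal.toReal_ofReal (by linarith : 0 ≤ ρ + 2)] at h2
  simpa [mul_comm] using h2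

lemma le_card_mul_volume {S : Finset Eisenstein} {w : ℂ} {ρ : ℝ} (hρ : 2 ≤ ρ)
    (hS : ∀ x, x ∈ S ↔ ‖toC x + w‖ ≤ ρ) :
    Real.pi * (ρ - 2) ^ 2 ≤ #S * (volume {z | floorC z = 0}).toReal := by
  have h1 : Metric.closedBall (-w) (ρ - 2) ⊆ (⋃ x ∈ S, {z | floorC z = x}) := fun z hz => by
    simp only [Set.mem_iUnion, Set.mem_ofPred_eq, exists_prop, exists_eq_right']
    rw [mem_closedBall_iff_norm] at hz
    rw [hS]
    have h2 := norm_sub_toC_floorC_le z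
    rw [norm_sub_rev] at h2
    calc ‖toC (floorC z) + w‖ = ‖(toC (floorC z) - z) + (z - -w)‖ := by congr 1; ring
      _ ≤ 2 + (ρ - 2) := norm_add_le_of_le h2 hz
      _ = _ := by ring
  have h3 : volume (⋃ x ∈ S, {z | floorC z = x}) ≠ ⊤ := by
    rw [volume_biUnion_floorC]
    exact ENNReal.mul_ne_top (ENNReal.natCast_ne_top _) volume_floorC_ne_top
  have h2 := ENNReal.toReal_mono h3 (measure_mono (μ := volume) h1)
  rw [volume_biUnion_floorC, Complex.volume_closedBall] at h2
  simp only [ENNReal.toReal_mul, ENNReal.toReal_natCast, ENNReal.toReal_pow,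
    ENNReal.toReal_ofReal (by linarith : 0 ≤ ρ - 2)] at h2
  simpa [mul_comm] using h2

/-- Counting Eisenstein integers in a disc, with an error bounded by the circumference. -/
lemma exists_card_disc : ∃ c : ℝ, 0 < c ∧ ∀ (S : Finset Eisenstein) (w : ℂ) (ρ : ℝ), 0 ≤ ρ →
    (∀ x, x ∈ S ↔ ‖toC x + w‖ ≤ ρ) → |#S - c * ρ ^ 2| ≤ c * (4 * ρ + 4) := by
  set κ := (volume {z | floorC z = 0}).toReal with hκ
  have hκ0 : 0 < κ := by
    have h := le_card_mul_volume (S := (finite_norm_le 9).toFinset) (w := 0) (ρ := 3) (by norm_num)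
      fun x => by
        rw [add_zero, norm_toC, Real.sqrt_le_left (by norm_num)]
        simp only [Set.Finite.mem_toFinset, Set.mem_ofPred_eq]
        norm_num
        exact_mod_cast Iff.rfl
    refine (ENNReal.toReal_nonneg).lt_of_ne fun h0 => ?_
    rw [← h0] at h
    have := Real.pi_pos
    linarith
  refine ⟨Real.pi / κ, div_pos Real.pi_pos hκ0, fun S w ρ hρ hS => ?_⟩
  have h1 := card_mul_volume_le hρ hS
  rw [← hκ, ← le_div_iff₀ hκ0, mul_div_right_comm] at h1
  have hc : 0 < Real.pi / κ := div_pos Real.pi_pos hκ0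
  rw [abs_le]
  constructor
  · rcases le_total 2 ρ with h | h
    · have h2 := le_card_mul_volume h hS
      rw [← hκ, ← div_le_iff₀ hκ0, mul_div_right_comm] at h2
      nlinarith
    · have h2 : (0 : ℝ) ≤ #S := by positivity
      have h3 : ρ ^ 2 ≤ 4 * ρ + 4 := by nlinarith
      nlinarith
  · nlinarith

end Eisenstein

end EisensteinCounting

section EisensteinCharacterSums

namespace Eisenstein

lemma exists_card_primaryNormLE : ∃ c C : ℝ, 0 < c ∧ 0 ≤ C ∧ ∀ x : ℕ,
    |#(primaryNormLE x) - c * x| ≤ C * √(x : ℝ) := by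
  obtain ⟨c, hc, h⟩ := exists_card_disc
  refine ⟨c / 9, 8 * c, by positivity, by positivity, fun x => ?_⟩
  rcases Nat.eq_zero_or_pos x with rfl | hx
  · have : primaryNormLE (0 : ℕ) = ∅ := by
      refine eq_empty_of_forall_notMem fun y hy => ?_
      rw [mem_primaryNormLE] at hy
      have := norm_pos hy.2.ne_zero
      have := hy.1
      simp only [Nat.cast_zero] at this
      omega
    rw [this]
    simp
  have h3C : toC 3 = 3 := by
    apply Complex.ext
    · rw [toC_re]; simp
    · rw [toC_im]; simp
  classical
  have hinj : Function.Injective fun β : Eisenstein => 1 + 3 * β := fun β β' h => by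
    have h1 : (3 : Eisenstein) * β = 3 * β' := add_left_cancel h
    refine mul_left_cancel₀ (fun h3 => ?_) h1
    simp [h3] at h3C
  set S := (primaryNormLE x).preimage (fun β => 1 + 3 * β) hinj.injOn with hS
  have hcard : #(primaryNormLE x) = #S := by
    rw [← card_image_of_injective S hinj, hS, image_preimage, filter_true_of_mem]
    intro γ hγ
    obtain ⟨-, ⟨a, ha⟩, b, hb⟩ := mem_primaryNormLE.1 hγ
    refine ⟨⟨a, b⟩, ?_⟩
    ext <;> simp <;> omega
  have hmem : ∀ β, β ∈ S ↔ ‖toC β + 1 / 3‖ ≤ √(x : ℝ) / 3 := fun β => by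
    have h1 : toC (1 + 3 * β) = 3 * (toC β + 1 / 3) := by
      rw [map_add, map_mul, map_one, h3C]; ring
    have h2 : (1 + 3 * β).Primary := ⟨⟨β.re, by simp⟩, ⟨β.im, by simp⟩⟩
    have h4 : ‖toC (1 + 3 * β)‖ = 3 * ‖toC β + 1 / 3‖ := by rw [h1, norm_mul]; simp
    rw [hS, mem_preimage, mem_primaryNormLE, and_iff_left h2, le_div_iff₀ (by norm_num),
      mul_comm ‖_‖, ← h4, norm_toC, Real.sqrt_le_sqrt_iff (by positivity)]
    exact_mod_cast Iff.rfl
  have h1 := h S (1 / 3) (√(x : ℝ) / 3) (by positivity) hmem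
  rw [div_pow, Real.sq_sqrt (by positivity), ← hcard] at h1
  have h2 : (1 : ℝ) ≤ √(x : ℝ) := Real.one_le_sqrt.2 (by exact_mod_cast hx)
  rw [show c / 9 * x = c * (x / 3 ^ 2 : ℝ) by ring]
  refine h1.trans ?_
  nlinarith

lemma sum_inv_sqrt_le (N : ℕ) : ∑ n ∈ Ioc 0 N, 1 / √(n : ℝ) ≤ 2 * √(N : ℝ) := by
  induction N with
  | zero => simp
  | succ N ih =>
    rw [sum_Ioc_succ_top (Nat.zero_le N)]
    have h1 : √((N + 1 : ℕ) : ℝ) ^ 2 = N + 1 := by rw [Real.sq_sqrt (by positivity)]; push_cast; ring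
    have h2 : √(N : ℝ) ^ 2 = N := Real.sq_sqrt (by positivity)
    have h3 : 0 < √((N + 1 : ℕ) : ℝ) := Real.sqrt_pos.2 (by positivity)
    have h4 : 0 ≤ √(N : ℝ) := Real.sqrt_nonneg _
    have h5 : 1 / √((N + 1 : ℕ) : ℝ) ≤ 2 * √((N + 1 : ℕ) : ℝ) - 2 * √(N : ℝ) := by
      rw [div_le_iff₀ h3]
      nlinarith [sq_nonneg (√((N + 1 : ℕ) : ℝ) - √(N : ℝ))]
    linarith

lemma exists_sum_inv_norm_le : ∃ C : ℝ, 0 ≤ C ∧ ∀ x : ℕ,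
    ∑ γ ∈ primaryNormLE x, 1 / ‖toC γ‖ ≤ C * √(x : ℝ) := by
  obtain ⟨c, C, hc, hC, h⟩ := exists_card_primaryNormLE
  refine ⟨(c + C) * 2, by positivity, fun x => ?_⟩
  have hmaps : ∀ N : ℕ, ∀ γ ∈ primaryNormLE N, γ.norm.natAbs ∈ Ioc 0 N := fun N γ hγ => by
    rw [mem_primaryNormLE] at hγ
    have := norm_pos hγ.2.ne_zero
    rw [mem_Ioc]
    omega
  have hfib : ∀ N n : ℕ, n ≤ N → {γ ∈ primaryNormLE N | γ.norm.natAbs = n} =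
      {γ ∈ primaryNormLE n | γ.norm.natAbs = n} := fun N n hn => by
    ext γ
    simp only [mem_filter, mem_primaryNormLE]
    have := norm_nonneg γ
    constructor <;> rintro ⟨⟨h1, h2⟩, h3⟩ <;> exact ⟨⟨by omega, h2⟩, h3⟩
  have hb : ∀ N : ℕ, ∑ n ∈ Ioc 0 N, (#{γ ∈ primaryNormLE n | γ.norm.natAbs = n} : ℝ) ≤
      (c + C) * N := fun N => by
    have h0 : ∑ n ∈ Ioc 0 N, (#{γ ∈ primaryNormLE n | γ.norm.natAbs = n} : ℝ) =
        ∑ n ∈ Ioc 0 N, (#{γ ∈ primaryNormLE N | γ.norm.natAbs = n} : ℝ) :=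
      sum_congr rfl fun n hn => by rw [hfib N n (mem_Ioc.1 hn).2]
    rw [h0, ← Nat.cast_sum, ← card_eq_sum_card_fiberwise (hmaps N)]
    have h1 := (abs_le.1 (h N)).2
    have h2 : √(N : ℝ) ≤ N := by
      rcases Nat.eq_zero_or_pos N with rfl | hN
      · simp
      · have : (1 : ℝ) ≤ N := by exact_mod_cast hN
        rw [Real.sqrt_le_left (by linarith)]
        nlinarith
    nlinarith
  calc ∑ γ ∈ primaryNormLE x, 1 / ‖toC γ‖
      = ∑ n ∈ Ioc 0 x, (#{γ ∈ primaryNormLE n | γ.norm.natAbs = n} : ℝ) * (1 / √(n : ℝ)) := by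
        rw [← sum_fiberwise_of_maps_to (hmaps x)]
        refine sum_congr rfl fun n hn => ?_
        rw [hfib x n (mem_Ioc.1 hn).2, ← nsmul_eq_mul]
        refine sum_eq_card_nsmul fun γ hγ => ?_
        have h1 : γ.norm = (n : ℤ) := by
          have := (mem_filter.1 hγ).2
          have := norm_nonneg γ
          omega
        rw [norm_toC, h1, Int.cast_natCast]
    _ ≤ (c + C) * ∑ n ∈ Ioc 0 x, 1 / √(n : ℝ) :=
        sum_mul_le_of_antitone (fun n => by positivity) (fun n hn => by
          apply one_div_le_one_div_of_le
          · exact Real.sqrt_pos.2 (by exact_mod_cast hn)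
          · exact Real.sqrt_le_sqrt (by push_cast; linarith)) hb x
    _ ≤ (c + C) * (2 * √(x : ℝ)) := by gcongr; exact sum_inv_sqrt_le x
    _ = _ := by ring

lemma norm_pow_sub_pow_le {a b : ℂ} (ha : ‖a‖ ≤ 1) (hb : ‖b‖ ≤ 1) (k : ℕ) :
    ‖a ^ k - b ^ k‖ ≤ k * ‖a - b‖ := by
  induction k with
  | zero => simp
  | succ k ih =>
    have h1 : a ^ (k + 1) - b ^ (k + 1) = (a ^ k - b ^ k) * a + b ^ k * (a - b) := by ring
    have h2 : ‖b ^ k‖ ≤ 1 := by rw [norm_pow]; exact pow_le_one₀ (_root_.norm_nonneg _) hb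
    calc _ ≤ ‖(a ^ k - b ^ k)‖ * ‖a‖ + ‖b ^ k‖ * ‖a - b‖ := by
          rw [h1, ← norm_mul, ← norm_mul]; exact norm_add_le _ _
      _ ≤ (k * ‖a - b‖) * 1 + 1 * ‖a - b‖ := by gcongr
      _ = _ := by push_cast; ring

lemma norm_dir_sub_dir_le (x : Eisenstein) {y : Eisenstein} (hy : y ≠ 0) :
    ‖dir x - dir y‖ ≤ 2 * ‖toC (x - y)‖ * (1 / ‖toC y‖) := by
  have h0 : 0 < ‖toC y‖ := norm_pos_iff.2 (toC_eq_zero.not.2 hy)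
  rw [mul_one_div, le_div_iff₀ h0]
  have h1 : (dir x - dir y) * (‖toC y‖ : ℂ) = dir x * ((‖toC y‖ - ‖toC x‖ : ℝ) : ℂ) + toC (x - y) := by
    have h2 : dir y * (‖toC y‖ : ℂ) = toC y := by
      rw [dir, div_mul_cancel₀]; exact_mod_cast h0.ne'
    have h3 : dir x * (‖toC x‖ : ℂ) = toC x := by
      by_cases hx : toC x = 0
      · rw [dir, hx]; simp
      · rw [dir, div_mul_cancel₀]; exact_mod_cast norm_ne_zero_iff.2 hx
    rw [sub_mul, h2, map_sub, Complex.ofReal_sub, mul_sub, h3]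
    ring
  calc ‖dir x - dir y‖ * ‖toC y‖ = ‖(dir x - dir y) * (‖toC y‖ : ℂ)‖ := by
        rw [norm_mul, Complex.norm_real, norm_norm]
    _ ≤ ‖dir x‖ * |‖toC y‖ - ‖toC x‖| + ‖toC (x - y)‖ := by
        rw [h1]
        refine (norm_add_le _ _).trans ?_
        rw [norm_mul, Complex.norm_real, Real.norm_eq_abs]
    _ ≤ 1 * ‖toC (x - y)‖ + ‖toC (x - y)‖ := by
        gcongr
        · exact norm_dir_le x
        · rw [map_sub, norm_sub_rev]; exact abs_norm_sub_norm_le _ _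
    _ = _ := by ring

/-- The primitive cube root of unity `ω`. -/
def omega : Eisenstein := ⟨0, 1⟩

lemma norm_omega : omega.norm = 1 := by rw [norm_eq]; simp [omega]

lemma dir_omega : dir omega = toC omega := by
  rw [dir, norm_toC, norm_omega]; simp

lemma dir_omega_pow_ne_one {k : ℕ} (hk : k ∈ ({1, 2, 4} : Finset ℕ)) : dir omega ^ k ≠ 1 := by
  rw [dir_omega, ← map_pow, ← map_one toC]
  intro h
  have h1 : omega ^ k = 1 := by
    rw [← sub_eq_zero, ← toC_eq_zero, map_sub, h, sub_self]
  have h2 := congrArg QuadraticAlgebra.re h1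
  simp only [mem_insert, mem_singleton] at hk
  rcases hk with rfl | rfl | rfl <;> simp [pow_succ, omega] at h2

lemma exists_norm_sum_dir_pow_le {k : ℕ} (hk : k ∈ ({1, 2, 4} : Finset ℕ)) : ∃ C : ℝ, 0 ≤ C ∧
    ∀ x : ℕ, ‖∑ γ ∈ primaryNormLE x, dir γ ^ k‖ ≤ C * √(x : ℝ) := by
  obtain ⟨c, C, hc, hC, hcard⟩ := exists_card_primaryNormLE
  obtain ⟨D, hD, hinv⟩ := exists_sum_inv_norm_le
  have hw : 0 < ‖dir omega ^ k - 1‖ := norm_pos_iff.2 (sub_ne_zero.2 (dir_omega_pow_ne_one hk))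
  refine ⟨(2 * (24 * c + 6 * C) + k * 4 * (D * 5)) / ‖dir omega ^ k - 1‖, by positivity,
    fun x => ?_⟩
  rw [div_mul_eq_mul_div, le_div_iff₀ hw]
  rcases Nat.eq_zero_or_pos x with rfl | hx
  · have h1 := hcard 0
    simp at h1
    simp [h1]
  set τ : Eisenstein := omega - 1 with hτ
  have hτn : ‖toC τ‖ ≤ 2 := by
    rw [norm_toC, Real.sqrt_le_left (by norm_num), norm_eq]; simp [hτ, omega]; norm_num
  set y : ℕ := (Nat.sqrt x + 4) ^ 2 with hy
  have hsy : √(y : ℝ) = Nat.sqrt x + 4 := by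
    rw [hy, Nat.cast_pow, Real.sqrt_sq (by positivity)]; push_cast; ring
  have hx1 : (1 : ℝ) ≤ √(x : ℝ) := Real.one_le_sqrt.2 (by exact_mod_cast hx)
  have hsq : √(x : ℝ) ^ 2 = x := Real.sq_sqrt (by positivity)
  have hy1 : √(x : ℝ) + 2 ≤ √(y : ℝ) := by
    have : √(x : ℝ) ≤ Nat.sqrt x + 1 := by
      rw [Real.sqrt_le_left (by positivity)]
      exact_mod_cast (Nat.le_succ x).trans (Nat.succ_le_succ_sqrt' x)
    linarith
  have hy2 : √(y : ℝ) ≤ √(x : ℝ) + 4 := by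
    have : (Nat.sqrt x : ℝ) ≤ √(x : ℝ) := Real.nat_sqrt_le_real_sqrt
    linarith
  have hxy : x ≤ y := by
    have : √(x : ℝ) ≤ √(y : ℝ) := by linarith
    rw [Real.sqrt_le_sqrt_iff (by positivity)] at this
    exact_mod_cast this
  set S := primaryNormLE x with hS
  set U := primaryNormLE y with hU
  have hinj : Function.Injective fun γ : Eisenstein => omega * γ - τ := fun γ γ' h => by
    have h1 : omega * γ = omega * γ' := sub_left_injective h
    exact mul_left_cancel₀ (fun h0 => by simpa [h0] using norm_omega) h1
  set S' := S.image fun γ => omega * γ - τ with hS'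
  have hcS' : #S' = #S := card_image_of_injective _ hinj
  have hSU : S ⊆ U := fun γ hγ => by
    rw [hS, mem_primaryNormLE] at hγ
    rw [hU, mem_primaryNormLE]
    exact ⟨hγ.1.trans (by exact_mod_cast hxy), hγ.2⟩
  have hmemU : ∀ γ : Eisenstein, γ ∈ U ↔ ‖toC γ‖ ≤ √(y : ℝ) ∧ γ.Primary := fun γ => by
    rw [hU, mem_primaryNormLE, norm_toC, Real.sqrt_le_sqrt_iff (by positivity)]
    exact_mod_cast Iff.rfl
  have hS'U : S' ⊆ U := fun γ hγ => by
    obtain ⟨δ, hδ, rfl⟩ := mem_image.1 hγ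
    rw [hS, mem_primaryNormLE] at hδ
    rw [hmemU]
    constructor
    · rw [map_sub]
      refine (norm_sub_le _ _).trans ?_
      have h1 : ‖toC (omega * δ)‖ ≤ √(x : ℝ) := by
        rw [norm_toC, map_mul, norm_omega, one_mul]
        exact Real.sqrt_le_sqrt (by exact_mod_cast hδ.1)
      linarith
    · obtain ⟨-, ⟨a, ha⟩, b, hb⟩ := hδ
      refine ⟨⟨-b, ?_⟩, ⟨a - b, ?_⟩⟩
      · simp [omega, hτ]; omega
      · simp [omega, hτ]; omega
  have hdiff : (#U : ℝ) - #S ≤ (24 * c + 6 * C) * √(x : ℝ) := by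
    have h1 := (abs_le.1 (hcard y)).2
    have h2 := (abs_le.1 (hcard x)).1
    have h3 : (y : ℝ) = √(y : ℝ) ^ 2 := (Real.sq_sqrt (by positivity)).symm
    rw [← hU] at h1
    rw [← hS] at h2
    have h4 : (y : ℝ) - x ≤ 24 * √(x : ℝ) := by
      rw [h3]; nlinarith
    have h5 : C * √(y : ℝ) ≤ C * (5 * √(x : ℝ)) := by gcongr; linarith
    have h6 : c * (y - x : ℝ) ≤ c * (24 * √(x : ℝ)) := by gcongr
    linarith
  have hpart : ∀ V : Finset Eisenstein, V ⊆ U → #V = #S → ∀ g : Eisenstein → ℂ, (∀ γ, ‖g γ‖ ≤ 1) →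
      ‖∑ γ ∈ U, g γ - ∑ γ ∈ V, g γ‖ ≤ (24 * c + 6 * C) * √(x : ℝ) := fun V hV hVc g hg => by
    rw [← sum_sdiff hV, add_sub_cancel_right]
    refine (norm_sum_le_of_le _ fun γ _ => hg γ).trans ?_
    rw [sum_const, card_sdiff_of_subset hV, nsmul_one, Nat.cast_sub (card_le_card hV), hVc]
    exact hdiff
  have hle : ∀ γ, ‖dir γ ^ k‖ ≤ 1 := fun γ => by
    rw [norm_pow]; exact pow_le_one₀ (_root_.norm_nonneg _) (norm_dir_le γ)
  have hrot : dir omega ^ k * ∑ γ ∈ S, dir γ ^ k = ∑ γ ∈ S', dir (γ + τ) ^ k := by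
    rw [hS', sum_image hinj.injOn, mul_sum]
    refine sum_congr rfl fun γ _ => ?_
    rw [sub_add_cancel, dir_mul, mul_pow]
  have hshift : ‖∑ γ ∈ U, dir (γ + τ) ^ k - ∑ γ ∈ U, dir γ ^ k‖ ≤ k * 4 * (D * 5) * √(x : ℝ) := by
    rw [← sum_sub_distrib]
    calc _ ≤ ∑ γ ∈ U, k * 4 * (1 / ‖toC γ‖) := norm_sum_le_of_le _ fun γ hγ => by
          refine (norm_pow_sub_pow_le (norm_dir_le _) (norm_dir_le _) k).trans ?_
          rw [mul_assoc]
          gcongr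
          refine (norm_dir_sub_dir_le _ ((hmemU γ).1 hγ).2.ne_zero).trans ?_
          rw [add_sub_cancel_left]
          gcongr
          linarith
      _ ≤ k * 4 * (D * √(y : ℝ)) := by rw [← mul_sum]; gcongr; exact hinv y
      _ ≤ k * 4 * (D * (5 * √(x : ℝ))) := by gcongr; linarith
      _ = _ := by ring
  have h1 := hpart S hSU rfl (fun γ => dir γ ^ k) hle
  have h2 := hpart S' hS'U hcS' (fun γ => dir (γ + τ) ^ k) fun γ => hle _
  rw [← norm_mul, mul_comm, sub_mul, one_mul, hrot]
  rw [norm_sub_rev] at h2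
  calc _ = ‖(∑ γ ∈ S', dir (γ + τ) ^ k - ∑ γ ∈ U, dir (γ + τ) ^ k) +
        (∑ γ ∈ U, dir (γ + τ) ^ k - ∑ γ ∈ U, dir γ ^ k) +
        (∑ γ ∈ U, dir γ ^ k - ∑ γ ∈ S, dir γ ^ k)‖ := by congr 1; ring
    _ ≤ _ := norm_add₃_le
    _ ≤ _ := by linarith

end Eisenstein

end EisensteinCharacterSums

section EisensteinPrimes

namespace Eisenstein

lemma exists_vonMangoldtSum_positive_part : ∃ K : ℝ, ∀ M x : ℕ, 1 ≤ M → M ≤ x →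
    (Real.log x - Real.log M) / 4 - K ≤
      ∑ n ∈ Ioc M x, vonMangoldtSum (fun s => max (dir (primeProd s)).re 0) n / n := by
  obtain ⟨c, C, hc, hC, hcard⟩ := exists_card_primaryNormLE
  obtain ⟨C₁, hC₁, h₁⟩ := exists_norm_sum_dir_pow_le (k := 1) (by simp)
  obtain ⟨C₂, hC₂, h₂⟩ := exists_norm_sum_dir_pow_le (k := 2) (by simp)
  obtain ⟨C₄, hC₄, h₄⟩ := exists_norm_sum_dir_pow_le (k := 4) (by simp)
  have hle : ∀ {D : ℝ} {x : ℕ} {z : ℂ}, D ≤ C + C₁ + C₂ + C₄ → ‖z‖ ≤ D * √(x : ℝ) →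
      ‖z‖ ≤ (C + C₁ + C₂ + C₄) * √(x : ℝ) := fun hD hz =>
    hz.trans (mul_le_mul_of_nonneg_right hD (Real.sqrt_nonneg _))
  refine mangoldtSum_positive_part (Ψ := fun s => dir (primeProd s)) (c := c)
    (C := C + C₁ + C₂ + C₄) (Cl := 4 * (Real.log 4 + 4)) finite_freeNorm_eq
    PrimaryPrime.two_le_norm (fun s t => ?_) ?_ (fun s => ?_) hc (fun x => ?_) (fun k hk x => ?_)
    fun x => ?_
  · rw [primeProd_add, dir_mul]
  · rw [primeProd_zero, dir_one]
  · exact norm_dir (primary_primeProd s).ne_zero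
  · refine hle (D := C) (by linarith) ?_
    have h := sum_normSum (fun _ => 1) x
    rw [h, sum_const, nsmul_one]
    have h2 := hcard x
    rw [← Real.norm_eq_abs, ← Complex.norm_real] at h2
    simpa using h2
  · have h := sum_normSum (fun y => dir y ^ k) x
    rw [h]
    simp only [mem_insert, mem_singleton] at hk
    rcases hk with rfl | rfl | rfl
    · exact hle (by linarith) (h₁ x)
    · exact hle (by linarith) (h₂ x)
    · exact hle (by linarith) (h₄ x)
  · refine (sum_le_sum fun n _ => vonMangoldtSum_one_le n).trans ?_
    rw [← mul_sum, mul_assoc]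
    have := Chebyshev.psi_le_const_mul_self (x := x) (by positivity)
    rw [Chebyshev.psi, Nat.floor_natCast] at this
    gcongr

lemma exists_sum_not_prime_le : ∃ D : ℝ, 0 ≤ D ∧ ∀ M x : ℕ, 1 ≤ M →
    ∑ n ∈ Ioc M x with ¬ n.Prime, ArithmeticFunction.vonMangoldt n / n ≤ D * √(x : ℝ) / M := by
  obtain ⟨D, hD⟩ := Chebyshev.psi_sub_theta_le_mul_sqrt
  refine ⟨|D|, abs_nonneg _, fun M x hM => ?_⟩
  have hM' : (0 : ℝ) < M := by exact_mod_cast hM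
  have h1 := hD x
  rw [Chebyshev.psi_sub_theta_eq_sum_not_prime, Nat.floor_natCast] at h1
  calc _ ≤ ∑ n ∈ Ioc M x with ¬ n.Prime, ArithmeticFunction.vonMangoldt n / M := by
        refine sum_le_sum fun n hn => ?_
        have : (M : ℝ) ≤ n := by exact_mod_cast (mem_Ioc.1 (mem_filter.1 hn).1).1.le
        exact div_le_div_of_nonneg_left ArithmeticFunction.vonMangoldt_nonneg hM' this
    _ = (∑ n ∈ Ioc M x with ¬ n.Prime, ArithmeticFunction.vonMangoldt n) / M := by rw [sum_div]
    _ ≤ (∑ n ∈ Ioc 0 x with ¬ n.Prime, ArithmeticFunction.vonMangoldt n) / M := by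
        gcongr
        exact Nat.zero_le _
    _ ≤ |D| * √(x : ℝ) / M := by
        gcongr
        exact h1.trans (mul_le_mul_of_nonneg_right (le_abs_self D) (Real.sqrt_nonneg _))

lemma exists_sum_prime_ge : ∃ C X₀ : ℕ, 2 ≤ C ∧ 1 ≤ X₀ ∧ ∀ X : ℕ, X₀ ≤ X →
    1 ≤ ∑ p ∈ Ioc X (C * X) with p.Prime,
      vonMangoldtSum (fun s => max (dir (primeProd s)).re 0) p / p := by
  obtain ⟨K, hK⟩ := exists_vonMangoldtSum_positive_part
  obtain ⟨D, hD, hD'⟩ := exists_sum_not_prime_le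
  set w : ℕ → ℝ := fun n => vonMangoldtSum (fun s => max (dir (primeProd s)).re 0) n with hw
  have hw4 : ∀ n, w n ≤ 4 * ArithmeticFunction.vonMangoldt n := fun n => by
    refine le_trans (sum_le_sum fun s _ => ?_) (vonMangoldtSum_one_le n)
    gcongr
    · exact freeVonMangoldt_nonneg _ _
    · exact max_le ((Complex.re_le_norm _).trans (norm_dir_le _)) zero_le_one
  obtain ⟨C, hC⟩ := exists_nat_ge (max 2 (Real.exp (4 * (K + 2))))
  obtain ⟨X₀, hX₀⟩ := exists_nat_ge (max 1 ((4 * D) ^ 2 * C))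
  have hC2 : (2 : ℝ) ≤ C := (le_max_left _ _).trans hC
  have hClog : 4 * (K + 2) ≤ Real.log C :=
    (Real.le_log_iff_exp_le (by linarith)).2 ((le_max_right _ _).trans hC)
  have hX1 : (1 : ℝ) ≤ X₀ := (le_max_left _ _).trans hX₀
  refine ⟨C, X₀, by exact_mod_cast hC2, by exact_mod_cast hX1, fun X hX => ?_⟩
  have hXX : (X₀ : ℝ) ≤ X := by exact_mod_cast hX
  have hX0 : (0 : ℝ) < X := by linarith
  have hXn : 1 ≤ X := by exact_mod_cast hX1.trans hXX
  have hsplit := sum_filter_add_sum_filter_not (Ioc X (C * X)) (fun p => p.Prime) fun n => w n / n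
  have h1 := hK X (C * X) hXn (Nat.le_mul_of_pos_left X (by
    have : 2 ≤ C := by exact_mod_cast hC2
    omega))
  rw [Nat.cast_mul, Real.log_mul (by linarith) hX0.ne'] at h1
  have h2 : ∑ n ∈ Ioc X (C * X) with ¬ n.Prime, w n / n ≤ 1 := by
    calc _ ≤ ∑ n ∈ Ioc X (C * X) with ¬ n.Prime, 4 * (ArithmeticFunction.vonMangoldt n / n) := by
          refine sum_le_sum fun n _ => ?_
          rw [← mul_div_assoc]
          gcongr
          exact hw4 n
      _ ≤ 4 * (D * √((C * X : ℕ) : ℝ) / X) := by rw [← mul_sum]; gcongr; exact hD' X (C * X) hXn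
      _ ≤ 1 := by
          rw [← mul_div_assoc, div_le_one hX0, ← mul_assoc]
          have h3 : (4 * D) ^ 2 * C ≤ X := ((le_max_right _ _).trans hX₀).trans hXX
          refine le_of_sq_le_sq ?_ hX0.le
          rw [mul_pow, Real.sq_sqrt (by positivity), Nat.cast_mul]
          nlinarith
  have h3 : ∑ n ∈ Ioc X (C * X), w n / n ≥ (Real.log C + Real.log X - Real.log X) / 4 - K := h1
  linarith

/-- Primary primes of positive trace are abundant in every long enough multiplicative window. -/
theorem exists_primes_positive_trace : ∃ C X₀ : ℕ, 2 ≤ C ∧ 1 ≤ X₀ ∧ ∀ X : ℕ, X₀ ≤ X →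
    ∃ (S : Finset ℕ) (a : ℕ → ℤ), (∀ p ∈ S, p.Prime ∧ X < p ∧ p ≤ C * X ∧ 0 < a p ∧
      ∃ x : Eisenstein, x.Primary ∧ x.norm = p ∧ trace x = a p) ∧
      1 ≤ ∑ p ∈ S, 2 * Real.log p * (a p / √(p : ℝ)) / p := by
  classical
  obtain ⟨C, X₀, hC, hX₀, h⟩ := exists_sum_prime_ge
  refine ⟨C, X₀, hC, hX₀, fun X hX => ?_⟩
  set w : ℕ → ℝ := fun n => vonMangoldtSum (fun s => max (dir (primeProd s)).re 0) n with hw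
  set S := {p ∈ Ioc X (C * X) | p.Prime ∧ 0 < w p} with hS
  have hex : ∀ p ∈ S, ∃ a : ℤ, 0 < a ∧ w p ≤ 2 * Real.log p * (a / √(p : ℝ)) ∧
      ∃ x : Eisenstein, x.Primary ∧ x.norm = p ∧ trace x = a := fun p hp => by
    obtain ⟨π, hπ, hpos, hle⟩ :=
      exists_primaryPrime_of_vonMangoldtSum_pos (mem_filter.1 hp).2.1 (mem_filter.1 hp).2.2
    exact ⟨trace π.1, hpos, hle, π.1, π.2.2, by rw [← PrimaryPrime.natCast_norm, hπ], rfl⟩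
  choose! a hpos hle hx using hex
  refine ⟨S, a, fun p hp => ?_, ?_⟩
  · have h1 := mem_filter.1 hp
    have h2 := mem_Ioc.1 h1.1
    refine ⟨h1.2.1, h2.1, h2.2, hpos p hp, hx p hp⟩
  · calc _ ≤ ∑ p ∈ Ioc X (C * X) with p.Prime, w p / p := h X hX
      _ ≤ ∑ p ∈ S, w p / p := by
          rw [hS, ← filter_filter, ← sum_filter_add_sum_filter_not
            {p ∈ Ioc X (C * X) | p.Prime} (fun p => 0 < w p)]
          refine add_le_of_nonpos_right (sum_nonpos fun p hp => ?_)
          exact div_nonpos_of_nonpos_of_nonneg (not_lt.1 (mem_filter.1 hp).2) (by positivity)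
      _ ≤ _ := sum_le_sum fun p hp => by
          gcongr
          exact hle p hp

end Eisenstein

end EisensteinPrimes

section CubicCharacters

variable {F : Type*} [Field F] [Fintype F] [DecidableEq F]

lemma card_cube_roots_of_cube (h3 : 3 ∣ Fintype.card F - 1) {b : F} (hb : b ≠ 0) :
    #{x : F | x ^ 3 = b ^ 3} = 3 := by
  have h1 : Nat.card (powMonoidHom 3 : Fˣ →* Fˣ).ker = 3 := by
    rw [IsCyclic.card_powMonoidHom_ker, Nat.card_eq_fintype_card, Fintype.card_units]
    exact Nat.gcd_eq_right h3
  refine Eq.trans ?_ h1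
  rw [← Fintype.card_subtype, ← Nat.card_eq_fintype_card]
  symm
  have hmem : ∀ u : (powMonoidHom 3 : Fˣ →* Fˣ).ker, (u.1 : F) ^ 3 = 1 := fun u => by
    have := u.2
    rw [MonoidHom.mem_ker, powMonoidHom_apply] at this
    rw [← Units.val_pow_eq_pow_val, this, Units.val_one]
  refine Nat.card_eq_of_bijective (fun u => ⟨b * u.1, by rw [mul_pow, hmem, mul_one]⟩)
    ⟨fun u v h => ?_, fun x => ?_⟩
  · have h2 : b * u.1 = b * v.1 := congrArg Subtype.val h
    exact Subtype.ext (Units.ext (mul_left_cancel₀ hb h2))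
  · have hx : x.1 ≠ 0 := fun h => by
      have := x.2
      rw [h, zero_pow three_ne_zero] at this
      exact hb (pow_eq_zero_iff three_ne_zero |>.1 this.symm)
    refine ⟨⟨Units.mk0 (x.1 / b) (div_ne_zero hx hb), ?_⟩, ?_⟩
    · rw [MonoidHom.mem_ker, powMonoidHom_apply]
      ext
      simp [div_pow, x.2, div_self (pow_ne_zero 3 hb)]
    · ext
      simp [mul_div_cancel₀ _ hb]

lemma apply_eq_one_iff_exists_cube {χ : MulChar F ℂ} (hχ : orderOf χ = 3) {a : F}
    (h : χ a = 1) : ∃ b, b ^ 3 = a := by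
  have ha : IsUnit a := by
    by_contra ha
    rw [χ.map_nonunit ha] at h
    exact zero_ne_one h
  obtain ⟨u, rfl⟩ := ha
  obtain ⟨g, hg⟩ := IsCyclic.exists_generator (α := Fˣ)
  obtain ⟨k, rfl⟩ := (mem_powers_iff_mem_zpowers.2 (hg u))
  have hg3 : χ g ^ 3 = 1 := by
    rw [← MulChar.pow_apply_coe, ← hχ, pow_orderOf_eq_one, MulChar.one_apply_coe]
  have hg1 : χ g ≠ 1 := fun h1 => by
    have : χ = 1 := by
      refine MulChar.ext fun v => ?_
      obtain ⟨j, rfl⟩ := (mem_powers_iff_mem_zpowers.2 (hg v))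
      simp [h1]
    rw [this, orderOf_one] at hχ
    omega
  have h4 : orderOf (χ g) = 3 := orderOf_eq_prime hg3 hg1
  have h5 : 3 ∣ k := by
    rw [← h4]
    apply orderOf_dvd_of_pow_eq_one
    simpa using h
  obtain ⟨j, rfl⟩ := h5
  exact ⟨((g ^ j : Fˣ) : F), by simp [← pow_mul, mul_comm]⟩

/-- The number of cube roots of `a` in terms of a cubic character. -/
lemma card_cube_roots {χ : MulChar F ℂ} (hχ : orderOf χ = 3) (h3 : 3 ∣ Fintype.card F - 1) (a : F) :
    (#{x : F | x ^ 3 = a} : ℂ) = 1 + χ a + χ⁻¹ a := by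
  by_cases ha : a = 0
  · subst ha
    have : ({x : F | x ^ 3 = 0} : Finset F) = {0} := by ext; simp
    rw [this]
    rw [χ.map_zero, χ⁻¹.map_zero]
    simp
  have hc : χ⁻¹ a = (χ a)⁻¹ := by rw [MulChar.inv_apply_eq_inv, Ring.inverse_eq_inv']
  by_cases hb : ∃ b, b ^ 3 = a
  · obtain ⟨b, rfl⟩ := hb
    have hb0 : b ≠ 0 := fun h => ha (by simp [h])
    rw [card_cube_roots_of_cube h3 hb0, hc]
    have : χ (b ^ 3) = 1 := by
      rw [map_pow, ← MulChar.pow_apply' χ three_ne_zero, ← hχ, pow_orderOf_eq_one,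
        MulChar.one_apply (isUnit_iff_ne_zero.2 hb0)]
    rw [this]
    norm_num
  · have h1 : χ a ≠ 1 := fun h => hb (apply_eq_one_iff_exists_cube hχ h)
    have h2 : χ a ^ 3 = 1 := by
      rw [← MulChar.pow_apply' χ three_ne_zero, ← hχ, pow_orderOf_eq_one,
        MulChar.one_apply (isUnit_iff_ne_zero.2 ha)]
    have h4 : ({x : F | x ^ 3 = a} : Finset F) = ∅ :=
      filter_eq_empty_iff.2 fun x _ hx => hb ⟨x, hx⟩
    have h5 : (χ a)⁻¹ = χ a ^ 2 := inv_eq_of_mul_eq_one_right (by rw [← h2]; ring)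
    rw [h4, hc, h5]
    have h6 : (χ a - 1) * (1 + χ a + χ a ^ 2) = 0 := by linear_combination h2
    rw [(mul_eq_zero.1 h6).resolve_left (sub_ne_zero.2 h1)]
    simp

end CubicCharacters

section CubicConvolutions

variable {F : Type*} [Field F] [Fintype F] [DecidableEq F]

lemma sum_mulChar_mul_sub (ψ φ : MulChar F ℂ) {m : F} (hm : m ≠ 0) :
    ∑ u, ψ u * φ (m - u) = (ψ * φ) m * jacobiSum ψ φ := by
  rw [jacobiSum, mul_sum, ← Equiv.sum_comp (Equiv.mulLeft₀ m hm)]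
  refine sum_congr rfl fun u _ => ?_
  rw [Equiv.mulLeft₀_apply, show m - m * u = m * (1 - u) by ring, map_mul, map_mul,
    MulChar.mul_apply]
  ring

lemma mulChar_neg_one_of_orderOf_eq_three {χ : MulChar F ℂ} (hχ : orderOf χ = 3) : χ (-1) = 1 := by
  have h1 : χ (-1) ^ 3 = 1 := by
    rw [← MulChar.pow_apply' χ three_ne_zero, ← hχ, pow_orderOf_eq_one,
      MulChar.one_apply (isUnit_one.neg)]
  have h2 : χ (-1) ^ 3 = χ (-1) := by rw [← map_pow]; congr 1; ring
  rw [← h2, h1]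

lemma sum_cubicChar_mul_self {χ : MulChar F ℂ} (hχ : orderOf χ = 3) (m : F) :
    ∑ u, χ u * χ (m - u) = jacobiSum χ χ * χ⁻¹ m := by
  have h1 : χ * χ = χ⁻¹ := eq_inv_of_mul_eq_one_left (by
    rw [← pow_orderOf_eq_one χ, hχ, pow_succ, pow_two])
  by_cases hm : m = 0
  · subst hm
    have h2 : χ⁻¹ ≠ 1 := by
      rw [Ne, inv_eq_one, ← orderOf_eq_one_iff, hχ]; norm_num
    have h3 : ∀ u, χ u * χ (0 - u) = χ⁻¹ u := fun u => by
      rw [zero_sub, neg_eq_neg_one_mul, map_mul, mulChar_neg_one_of_orderOf_eq_three hχ, one_mul,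
        ← MulChar.mul_apply, h1]
    rw [sum_congr rfl fun u _ => h3 u, MulChar.sum_eq_zero_of_ne_one h2, χ⁻¹.map_zero, mul_zero]
  · rw [sum_mulChar_mul_sub _ _ hm, h1, mul_comm]

lemma sum_cubicChar_mul_inv {χ : MulChar F ℂ} (hχ : orderOf χ = 3) (m : F) :
    ∑ u, χ u * χ⁻¹ (m - u) = (if m = 0 then (Fintype.card F : ℂ) else 0) - 1 := by
  have h0 : χ ≠ 1 := by rw [Ne, ← orderOf_eq_one_iff, hχ]; norm_num
  have h1 := mulChar_neg_one_of_orderOf_eq_three (χ := χ⁻¹) (by rwa [orderOf_inv])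
  by_cases hm : m = 0
  · subst hm
    have h3 : ∀ u, χ u * χ⁻¹ (0 - u) = 1 - if u = 0 then 1 else 0 := fun u => by
      rw [zero_sub, neg_eq_neg_one_mul, map_mul, h1, one_mul, ← MulChar.mul_apply, mul_inv_cancel]
      split_ifs with h
      · rw [h, MulChar.map_zero, sub_self]
      · rw [MulChar.one_apply (isUnit_iff_ne_zero.2 h), sub_zero]
    rw [sum_congr rfl fun u _ => h3 u, sum_sub_distrib, sum_ite_eq']
    simp
  · rw [sum_mulChar_mul_sub _ _ hm, jacobiSum_nontrivial_inv h0,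
      mulChar_neg_one_of_orderOf_eq_three hχ, mul_inv_cancel,
      MulChar.one_apply (isUnit_iff_ne_zero.2 hm), if_neg hm]
    ring

lemma sum_mulChar_sub {χ : MulChar F ℂ} (h : χ ≠ 1) (m : F) : ∑ u, χ (m - u) = 0 :=
  (Equiv.sum_comp (Equiv.subLeft m) χ).trans (MulChar.sum_eq_zero_of_ne_one h)

lemma sum_cubic_convolution {χ : MulChar F ℂ} (hχ : orderOf χ = 3) (m : F) :
    ∑ u, (1 + χ u + χ⁻¹ u) * (1 + χ (m - u) + χ⁻¹ (m - u)) =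
      Fintype.card F - 2 + jacobiSum χ χ * χ⁻¹ m + jacobiSum χ⁻¹ χ⁻¹ * χ m +
        2 * (if m = 0 then (Fintype.card F : ℂ) else 0) := by
  have hχ' : orderOf χ⁻¹ = 3 := by rwa [orderOf_inv]
  have h0 : χ ≠ 1 := by rw [Ne, ← orderOf_eq_one_iff, hχ]; norm_num
  have h0' : χ⁻¹ ≠ 1 := by rw [Ne, ← orderOf_eq_one_iff, hχ']; norm_num
  have h1 := sum_cubicChar_mul_self hχ m
  have h2 := sum_cubicChar_mul_self hχ' m
  have h3 := sum_cubicChar_mul_inv hχ m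
  have h4 := sum_cubicChar_mul_inv hχ' m
  rw [inv_inv] at h2 h4
  have h5 : ∀ u, (1 + χ u + χ⁻¹ u) * (1 + χ (m - u) + χ⁻¹ (m - u)) = 1 + χ u + χ⁻¹ u +
      χ (m - u) + χ⁻¹ (m - u) + χ u * χ (m - u) + χ⁻¹ u * χ⁻¹ (m - u) + χ u * χ⁻¹ (m - u) +
      χ⁻¹ u * χ (m - u) := fun u => by ring
  simp only [h5, sum_add_distrib, h1, h2, h3, h4, sum_mulChar_sub h0, sum_mulChar_sub h0',
    MulChar.sum_eq_zero_of_ne_one h0, MulChar.sum_eq_zero_of_ne_one h0', sum_const, card_univ,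
    nsmul_one]
  ring

lemma sum_cubic_convolution_convolution {χ : MulChar F ℂ} (hχ : orderOf χ = 3) (m : F) :
    ∑ u, (1 + χ u + χ⁻¹ u) *
      ∑ v, (1 + χ v + χ⁻¹ v) * (1 + χ (m - u - v) + χ⁻¹ (m - u - v)) =
      (Fintype.card F : ℂ) ^ 2 + (jacobiSum χ χ + jacobiSum χ⁻¹ χ⁻¹) *
        ((if m = 0 then (Fintype.card F : ℂ) else 0) - 1) +
        3 * Fintype.card F * (χ m + χ⁻¹ m) := by
  have hχ' : orderOf χ⁻¹ = 3 := by rwa [orderOf_inv]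
  have h0 : χ ≠ 1 := by rw [Ne, ← orderOf_eq_one_iff, hχ]; norm_num
  have h0' : χ⁻¹ ≠ 1 := by rw [Ne, ← orderOf_eq_one_iff, hχ']; norm_num
  have h1 := sum_cubicChar_mul_self hχ m
  have h2 := sum_cubicChar_mul_self hχ' m
  have h3 := sum_cubicChar_mul_inv hχ m
  have h4 := sum_cubicChar_mul_inv hχ' m
  rw [inv_inv] at h2 h4
  have hJ : jacobiSum χ χ * jacobiSum χ⁻¹ χ⁻¹ = Fintype.card F := by
    refine jacobiSum_mul_jacobiSum_inv ?_ h0 h0 ?_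
    · rw [ringChar.eq_zero]
      exact (CharP.ringChar_ne_zero_of_finite F).symm
    · rw [← pow_two, Ne, ← orderOf_dvd_iff_pow_eq_one, hχ]; norm_num
  simp only [sum_cubic_convolution hχ]
  set q : ℂ := (Fintype.card F : ℂ) with hq
  set J := jacobiSum χ χ
  set J' := jacobiSum χ⁻¹ χ⁻¹
  have h5 : ∀ u, (1 + χ u + χ⁻¹ u) * (q - 2 + J * χ⁻¹ (m - u) + J' * χ (m - u) +
      2 * (if m - u = 0 then q else 0)) = (q - 2) * 1 + (q - 2) * χ u + (q - 2) * χ⁻¹ u +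
      J * χ⁻¹ (m - u) + J * (χ u * χ⁻¹ (m - u)) + J * (χ⁻¹ u * χ⁻¹ (m - u)) +
      J' * χ (m - u) + J' * (χ u * χ (m - u)) + J' * (χ⁻¹ u * χ (m - u)) +
      (if m = u then 2 * q * (1 + χ u + χ⁻¹ u) else 0) := fun u => by
    simp only [sub_eq_zero]
    split_ifs <;> ring
  simp only [h5, sum_add_distrib, ← mul_sum, h1, h2, h3, h4, sum_mulChar_sub h0,
    sum_mulChar_sub h0', MulChar.sum_eq_zero_of_ne_one h0, MulChar.sum_eq_zero_of_ne_one h0',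
    sum_const, card_univ, nsmul_one, sum_ite_eq, mem_univ, if_true, ← hq]
  linear_combination (χ m + χ⁻¹ m) * hJ

end CubicConvolutions

section CubicCounts

lemma natCast_rmod3_eq_sum (p : ℕ) [Fact p.Prime] (m : ℤ) :
    (rmod3 m p : ℂ) = ∑ u : ZMod p, (#{x : ZMod p | x ^ 3 = u} : ℂ) *
      ∑ v : ZMod p, (#{x : ZMod p | x ^ 3 = v} : ℂ) * #{x : ZMod p | x ^ 3 = m - u - v} := by
  have hfib : ∀ f : ZMod p → ℂ, ∑ u, (#{x : ZMod p | x ^ 3 = u} : ℂ) * f u = ∑ x, f (x ^ 3) :=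
    fun f => by
      rw [← sum_fiberwise' univ (fun x : ZMod p => x ^ 3)]
      refine sum_congr rfl fun u _ => ?_
      rw [← nsmul_eq_mul, ← sum_const]
  simp only [hfib]
  have h1 : rmod3 m p = Nat.card {t : ZMod p × ZMod p × ZMod p //
      t.2.2 ^ 3 = m - t.1 ^ 3 - t.2.1 ^ 3} := by
    refine Nat.card_congr ⟨fun x => ⟨(x.1 0, x.1 1, x.1 2), ?_⟩,
      fun t => ⟨![t.1.1, t.1.2.1, t.1.2.2], ?_⟩, fun x => ?_, fun t => rfl⟩
    · have := x.2
      rw [Fin.sum_univ_three] at this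
      linear_combination this
    · have := t.2
      rw [Fin.sum_univ_three]
      simp only [Matrix.cons_val]
      linear_combination this
    · ext i
      fin_cases i <;> rfl
  rw [h1, Nat.card_eq_fintype_card, Fintype.card_subtype, card_filter, Nat.cast_sum,
    Fintype.sum_prod_type]
  refine sum_congr rfl fun a _ => ?_
  rw [Fintype.sum_prod_type]
  refine sum_congr rfl fun b _ => ?_
  rw [card_filter, Nat.cast_sum]

lemma rmod3_eq_of_cubicChar {p : ℕ} [Fact p.Prime] (h3 : 3 ∣ p - 1) {χ : MulChar (ZMod p) ℂ}
    (hχ : orderOf χ = 3) (m : ℤ) :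
    (rmod3 m p : ℂ) = (p : ℂ) ^ 2 + (jacobiSum χ χ + jacobiSum χ⁻¹ χ⁻¹) *
        ((if (m : ZMod p) = 0 then (p : ℂ) else 0) - 1) + 3 * p * (χ m + χ⁻¹ m) := by
  have h := sum_cubic_convolution_convolution hχ (m : ZMod p)
  rw [ZMod.card] at h
  rw [← h, natCast_rmod3_eq_sum]
  simp only [card_cube_roots hχ (by rwa [ZMod.card] : 3 ∣ Fintype.card (ZMod p) - 1)]

end CubicCounts

namespace Eisenstein

lemma isPrimitiveRoot_toC_omega : IsPrimitiveRoot (toC omega) 3 := by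
  have h1 : omega ^ 3 = 1 := by
    ext <;> simp [pow_succ, omega]
  have h2 : omega ≠ 1 := fun h => by
    have := congrArg QuadraticAlgebra.im h
    simp [omega] at this
  have h3 : IsPrimitiveRoot omega 3 := by
    rw [← orderOf_eq_prime h1 h2]
    exact IsPrimitiveRoot.orderOf omega
  exact h3.map_of_injective ((injective_iff_map_eq_zero toC).2 fun x => toC_eq_zero.1)

lemma prime_of_norm_prime {x : Eisenstein} {p : ℕ} (hp : p.Prime) (hx : x.norm = p) : Prime x := by
  refine Irreducible.prime ⟨fun h => ?_, fun a b hab => ?_⟩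
  · have := norm_eq_one_of_isUnit h
    rw [hx] at this
    exact hp.one_lt.ne' (by exact_mod_cast this)
  · have h1 : (a.norm * b.norm) = (p : ℤ) := by rw [← hx, hab, map_mul]
    have h2 : a.norm.natAbs * b.norm.natAbs = p := by rw [← Int.natAbs_mul, h1, Int.natAbs_natCast]
    rcases (Nat.prime_iff.1 hp).irreducible.isUnit_or_isUnit h2.symm with h | h
    · exact Or.inl (isUnit_of_norm_eq_one (by
        have := Nat.isUnit_iff.1 h; have := norm_nonneg a; omega))
    · exact Or.inr (isUnit_of_norm_eq_one (by
        have := Nat.isUnit_iff.1 h; have := norm_nonneg b; omega))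

lemma jacobiSum_inv_inv_eq_conj {F : Type*} [Field F] [Fintype F] (χ : MulChar F ℂ) :
    jacobiSum χ⁻¹ χ⁻¹ = starRingEnd ℂ (jacobiSum χ χ) := by
  rw [jacobiSum, jacobiSum, map_sum]
  refine sum_congr rfl fun u _ => ?_
  rw [map_mul, ← MulChar.star_eq_inv]
  rfl

/-- The cubic Jacobi sum is, up to sign, the image of a primary Eisenstein integer. -/
lemma exists_primary_toC_eq_neg_jacobiSum {F : Type*} [Field F] [Fintype F] {χ : MulChar F ℂ}
    (hχ : χ ^ 3 = 1) (h3 : 3 ∣ Fintype.card F - 1) :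
    ∃ x : Eisenstein, x.Primary ∧ toC x = -jacobiSum χ χ := by
  obtain ⟨z, hz, hJ⟩ := exists_jacobiSum_eq_neg_one_add (by norm_num) hχ hχ h3
    isPrimitiveRoot_toC_omega
  have hle : Algebra.adjoin ℤ {toC omega} ≤ (toC.toIntAlgHom).range :=
    Algebra.adjoin_le (by rintro _ rfl; exact ⟨omega, rfl⟩)
  obtain ⟨y, rfl⟩ := hle hz
  refine ⟨1 + 3 * (omega * y), ⟨?_, ?_⟩, ?_⟩
  · refine ⟨(omega * y).re, ?_⟩
    have : (3 : Eisenstein) = ((3 : ℤ) : Eisenstein) := rfl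
    rw [this]
    simp
  · refine ⟨(omega * y).im, ?_⟩
    have : (3 : Eisenstein) = ((3 : ℤ) : Eisenstein) := rfl
    rw [this]
    simp
  · rw [hJ]
    have hC : toC 3 = 3 := map_ofNat toC 3
    have h1 : (omega - 1) ^ 2 = -3 * omega := by
      have : (3 : Eisenstein) = ((3 : ℤ) : Eisenstein) := rfl
      rw [this]
      ext <;> simp [pow_succ, omega]
    have h2 : (toC omega - 1) ^ 2 = -3 * toC omega := by
      have := congrArg toC h1
      simpa [hC] using this
    rw [h2]
    simp [hC]
    ring

lemma two_re_toC (x : Eisenstein) : 2 * (toC x).re = trace x := by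
  rw [toC_re, trace]; push_cast; ring

lemma Primary.three_dvd_sub_one {x : Eisenstein} (hx : x.Primary) {p : ℕ} (hp : x.norm = p) :
    3 ∣ p - 1 := by
  obtain ⟨⟨a, ha⟩, b, hb⟩ := hx
  rw [norm_eq, show x.re = 3 * a + 1 by linarith, hb] at hp
  have : (p : ℤ) = 3 * (3 * a ^ 2 + 2 * a - 3 * a * b - b + 3 * b ^ 2) + 1 := by
    rw [← hp]; ring
  omega

lemma Primary.exists_cubicChar {x : Eisenstein} (hx : x.Primary) {p : ℕ} [hp : Fact p.Prime]
    (h : x.norm = p) : ∃ χ : MulChar (ZMod p) ℂ, orderOf χ = 3 ∧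
      2 * (jacobiSum χ χ).re = -trace x ∧ ‖jacobiSum χ χ‖ = √(p : ℝ) := by
  have h3 : 3 ∣ Fintype.card (ZMod p) - 1 := by
    rw [ZMod.card]; exact hx.three_dvd_sub_one h
  obtain ⟨χ, hχ⟩ := MulChar.exists_mulChar_orderOf (ZMod p) h3
    (Complex.isPrimitiveRoot_exp 3 three_ne_zero)
  have h0 : χ ≠ 1 := by rw [Ne, ← orderOf_eq_one_iff, hχ]; norm_num
  have hJ : jacobiSum χ χ * jacobiSum χ⁻¹ χ⁻¹ = Fintype.card (ZMod p) := by
    refine jacobiSum_mul_jacobiSum_inv ?_ h0 h0 ?_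
    · rw [ringChar.eq_zero]
      exact (CharP.ringChar_ne_zero_of_finite (ZMod p)).symm
    · rw [← pow_two, Ne, ← orderOf_dvd_iff_pow_eq_one, hχ]; norm_num
  rw [jacobiSum_inv_inv_eq_conj, Complex.mul_conj, ZMod.card] at hJ
  have hJ' : Complex.normSq (jacobiSum χ χ) = p := by exact_mod_cast hJ
  obtain ⟨y, hy, hyJ⟩ := exists_primary_toC_eq_neg_jacobiSum
    (by rw [← hχ, pow_orderOf_eq_one] : χ ^ 3 = 1) h3
  have hyn : y.norm = p := by
    have := normSq_toC y
    rw [hyJ, Complex.normSq_neg, hJ'] at this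
    exact_mod_cast this.symm
  refine ⟨χ, hχ, ?_, ?_⟩
  · have htr : trace x = trace y :=
      trace_eq_of_norm_eq (π := ⟨y, prime_of_norm_prime hp.out hyn, hy⟩)
        (π' := ⟨x, prime_of_norm_prime hp.out h, hx⟩) (by
          rw [PrimaryPrime.norm, PrimaryPrime.norm, h, hyn])
    rw [htr, ← two_re_toC, hyJ, Complex.neg_re]
    ring
  · rw [← norm_neg, ← hyJ, norm_toC, hyn, Int.cast_natCast]

lemma Primary.rmod3_of_dvd {x : Eisenstein} (hx : x.Primary) {p : ℕ} (hp : p.Prime)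
    (h : x.norm = p) {m : ℤ} (hm : (p : ℤ) ∣ m) :
    (rmod3 m p : ℝ) = (p : ℝ) ^ 2 - (p - 1) * trace x := by
  have : Fact p.Prime := ⟨hp⟩
  obtain ⟨χ, hχ, hre, -⟩ := hx.exists_cubicChar h
  have hm0 : (m : ZMod p) = 0 := (ZMod.intCast_zmod_eq_zero_iff_dvd m p).2 hm
  have key := rmod3_eq_of_cubicChar (hx.three_dvd_sub_one h) hχ m
  rw [jacobiSum_inv_inv_eq_conj, Complex.add_conj, hre, if_pos hm0, hm0, MulChar.map_zero,
    MulChar.map_zero] at key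
  have : ((rmod3 m p : ℝ) : ℂ) = (((p : ℝ) ^ 2 - (p - 1) * trace x : ℝ) : ℂ) := by
    push_cast
    rw [key]
    push_cast
    ring
  exact_mod_cast this

lemma Primary.rmod3_le {x : Eisenstein} (hx : x.Primary) {p : ℕ} (hp : p.Prime)
    (h : x.norm = p) {m : ℤ} (hm : ¬ (p : ℤ) ∣ m) :
    (rmod3 m p : ℝ) ≤ (p : ℝ) ^ 2 + 8 * p := by
  have : Fact p.Prime := ⟨hp⟩
  obtain ⟨χ, hχ, -, hn⟩ := hx.exists_cubicChar h
  have hm0 : (m : ZMod p) ≠ 0 := (ZMod.intCast_zmod_eq_zero_iff_dvd m p).not.2 hm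
  have key := rmod3_eq_of_cubicChar (hx.three_dvd_sub_one h) hχ m
  rw [jacobiSum_inv_inv_eq_conj, if_neg hm0] at key
  have hp1 : (1 : ℝ) ≤ p := by exact_mod_cast hp.one_lt.le
  have hs : √(p : ℝ) ≤ p := Real.sqrt_le_self_iff.2 (Or.inr hp1)
  have h1 : ‖χ m‖ ≤ 1 := DirichletCharacter.norm_le_one χ _
  have h2 : ‖χ⁻¹ m‖ ≤ 1 := DirichletCharacter.norm_le_one χ⁻¹ _
  have h3 : (rmod3 m p : ℝ) = ‖(rmod3 m p : ℂ)‖ := by simp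
  rw [h3, key]
  refine (norm_add₃_le).trans ?_
  simp only [norm_mul, norm_pow, Complex.norm_natCast, Complex.norm_ofNat]
  have h4 := norm_add_le (jacobiSum χ χ) (starRingEnd ℂ (jacobiSum χ χ))
  rw [Complex.norm_conj, hn] at h4
  have h5 := norm_add_le (χ m) (χ⁻¹ m)
  have h6 : ‖(0 - 1 : ℂ)‖ = 1 := by simp
  rw [h6]
  nlinarith

end Eisenstein

lemma rmod3_mul {M N : ℕ} (h : M.Coprime N) (m : ℤ) :
    rmod3 m (M * N) = rmod3 m M * rmod3 m N := by
  rw [rmod3, rmod3, rmod3, ← Nat.card_prod]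
  let e := ZMod.chineseRemainder h
  have he : ∀ x : Fin 3 → ZMod (M * N), ∑ i, x i ^ 3 = (m : ZMod (M * N)) ↔
      ∑ i, (e (x i)).1 ^ 3 = (m : ZMod M) ∧ ∑ i, (e (x i)).2 ^ 3 = (m : ZMod N) := fun x => by
    rw [← e.injective.eq_iff, Prod.ext_iff]
    simp [Prod.fst_sum, Prod.snd_sum]
  refine Nat.card_congr ⟨fun x => ⟨⟨fun i => (e (x.1 i)).1, ((he _).1 x.2).1⟩,
    ⟨fun i => (e (x.1 i)).2, ((he _).1 x.2).2⟩⟩,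
    fun y => ⟨fun i => e.symm (y.1.1 i, y.2.1 i), (he _).2 ?_⟩, fun x => ?_, fun y => ?_⟩
  · simpa using ⟨y.1.2, y.2.2⟩
  · ext i
    simp
  · ext i <;> simp

lemma rmod3_two (m : ℤ) : rmod3 m 2 = 4 := by
  rw [rmod3, Nat.card_eq_fintype_card]
  generalize (m : ZMod 2) = a
  revert a
  decide

lemma rmod3_one (m : ℤ) : rmod3 m 1 = 1 := by
  rw [rmod3, Nat.card_eq_fintype_card]
  generalize (m : ZMod 1) = a
  revert a
  decide

lemma rmod3_prod_primes {S : Finset ℕ} (hS : ∀ p ∈ S, p.Prime) (m : ℤ) :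
    rmod3 m (∏ p ∈ S, p) = ∏ p ∈ S, rmod3 m p := by
  induction S using Finset.induction_on with
  | empty => simpa using rmod3_one m
  | insert p S hp ih =>
    rw [prod_insert hp, prod_insert hp, rmod3_mul, ih fun q hq => hS q (mem_insert_of_mem hq)]
    refine Nat.Coprime.prod_right fun q hq => ?_
    refine (Nat.coprime_primes (hS p (mem_insert_self _ _)) (hS q (mem_insert_of_mem hq))).2 ?_
    rintro rfl
    exact hp hq

lemma rmod3_two_mul_prod_primes {S : Finset ℕ} (hS : ∀ p ∈ S, p.Prime) (h2 : 2 ∉ S) (m : ℤ) :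
    rmod3 m (2 * ∏ p ∈ S, p) = 4 * ∏ p ∈ S, rmod3 m p := by
  rw [← prod_insert h2 (f := fun p => p), rmod3_prod_primes, prod_insert h2, rmod3_two]
  exact forall_mem_insert _ _ _ |>.2 ⟨Nat.prime_two, hS⟩

namespace Eisenstein

/-- A prime represented by the norm of a primary Eisenstein integer of trace `a > 0`. -/
def IsNormOfTrace (p : ℕ) (a : ℤ) : Prop :=
  p.Prime ∧ 0 < a ∧ ∃ x : Eisenstein, x.Primary ∧ x.norm = p ∧ trace x = a

namespace IsNormOfTrace

variable {p : ℕ} {a : ℤ}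

lemma trace_le (h : IsNormOfTrace p a) : (a : ℝ) ≤ 2 * √(p : ℝ) := by
  obtain ⟨-, ha, x, -, hp, rfl⟩ := h
  have h1 : (trace x) ^ 2 ≤ 4 * (p : ℤ) := by
    rw [← hp, four_mul_norm, trace]; nlinarith [sq_nonneg x.im]
  have h2 : ((trace x : ℤ) : ℝ) ^ 2 ≤ 4 * p := by exact_mod_cast h1
  refine Real.le_sqrt_of_sq_le h2 |>.trans_eq ?_
  rw [Real.sqrt_mul (by norm_num)]
  congr 1
  rw [show (4 : ℝ) = 2 ^ 2 by norm_num]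
  exact Real.sqrt_sq (by norm_num)

lemma rmod3_le (h : IsNormOfTrace p a) (m : ℤ) :
    (rmod3 m p : ℝ) ≤ (p : ℝ) ^ 2 * (1 + 8 / p) := by
  obtain ⟨hp, ha, x, hx, hxp, rfl⟩ := h
  have hp0 : (1 : ℝ) ≤ p := by exact_mod_cast hp.one_lt.le
  have h1 : (p : ℝ) ^ 2 * (1 + 8 / p) = (p : ℝ) ^ 2 + 8 * p := by field_simp
  have ha' : (0 : ℝ) < trace x := by exact_mod_cast ha
  rw [h1]
  by_cases hm : (p : ℤ) ∣ m
  · rw [hx.rmod3_of_dvd hp hxp hm]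
    nlinarith [mul_nonneg (sub_nonneg.2 hp0) ha'.le]
  · exact hx.rmod3_le hp hxp hm

lemma rmod3_le_mul_exp (h : IsNormOfTrace p a) {m : ℤ} (hm : (p : ℤ) ∣ m) :
    (rmod3 m p : ℝ) ≤ (p : ℝ) ^ 2 * (1 + 8 / p) * Real.exp (-(a / p) / 2) := by
  obtain ⟨hp, ha, x, hx, hxp, rfl⟩ := h
  have hp0 : (2 : ℝ) ≤ p := by exact_mod_cast hp.two_le
  have ha' : (0 : ℝ) < trace x := by exact_mod_cast ha
  rw [hx.rmod3_of_dvd hp hxp hm]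
  have h1 := Real.add_one_le_exp (-((trace x : ℝ) / p) / 2)
  have h2 : (p : ℝ) ^ 2 - (p - 1) * trace x ≤
      (p : ℝ) ^ 2 * (-((trace x : ℝ) / p) / 2 + 1) := by
    have : (p : ℝ) ^ 2 * (-((trace x : ℝ) / p) / 2 + 1) = (p : ℝ) ^ 2 - p * trace x / 2 := by
      field_simp; ring
    rw [this]; nlinarith
  refine h2.trans ((mul_le_mul_of_nonneg_left h1 (by positivity)).trans ?_)
  gcongr
  exact le_mul_of_one_le_right (by positivity) (le_add_of_nonneg_right (by positivity))

end IsNormOfTrace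

end Eisenstein

/-- Nonnegative weights bounded by `δ` can be distributed into `K` classes of weight at least `L`
as soon as the total weight is at least `K * (L + δ)`. -/
lemma exists_forall_le_sum_filter {ι : Type*} [DecidableEq ι] {w : ι → ℝ} {L δ : ℝ} (hL : 0 ≤ L)
    (hδ : 0 ≤ δ) (K : ℕ) (S : Finset ι) (hw : ∀ i ∈ S, 0 ≤ w i ∧ w i ≤ δ)
    (h : K * (L + δ) ≤ ∑ i ∈ S, w i) :
    ∃ f : ι → ℕ, ∀ k < K, L ≤ ∑ i ∈ S with f i = k, w i := by
  induction K generalizing S with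
  | zero => exact ⟨fun _ => 0, fun k hk => absurd hk (Nat.not_lt_zero k)⟩
  | succ K ih =>
    push_cast at h
    have hS : S ∈ {A ∈ S.powerset | L ≤ ∑ i ∈ A, w i} := by
      rw [mem_filter, mem_powerset]
      exact ⟨Subset.rfl, by nlinarith [mul_nonneg K.cast_nonneg (add_nonneg hL hδ)]⟩
    obtain ⟨A, hA⟩ := exists_minimal ⟨S, hS⟩
    obtain ⟨hAS, hLA⟩ := mem_filter.1 hA.1
    rw [mem_powerset] at hAS
    have hA' : ∑ i ∈ A, w i ≤ L + δ := by
      rcases A.eq_empty_or_nonempty with rfl | ⟨j, hj⟩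
      · rw [sum_empty]; positivity
      · by_contra! hlt
        have h1 : L ≤ ∑ i ∈ A.erase j, w i := by
          rw [← add_sum_erase A w hj] at hlt
          linarith [(hw j (hAS hj)).2]
        have h2 := hA.2 (mem_filter.2 ⟨mem_powerset.2 ((erase_subset j A).trans hAS), h1⟩)
          (erase_subset j A) hj
        exact notMem_erase j A h2
    obtain ⟨f, hf⟩ := ih (S \ A) (fun i hi => hw i (sdiff_subset hi)) (by
      rw [← sum_sdiff hAS] at h; linarith)
    refine ⟨fun i => if i ∈ A then K else f i, fun k hk => ?_⟩
    rcases Nat.lt_succ_iff_lt_or_eq.1 hk with hk | rfl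
    · refine (hf k hk).trans (sum_le_sum_of_subset_of_nonneg (fun i hi => ?_) fun i hi _ =>
        (hw i (mem_filter.1 hi).1).1)
      simp only [mem_filter, mem_sdiff] at hi ⊢
      exact ⟨hi.1.1, by rw [if_neg hi.1.2, hi.2]⟩
    · refine hLA.trans (sum_le_sum_of_subset_of_nonneg (fun i hi => ?_) fun i hi _ =>
        (hw i (mem_filter.1 hi).1).1)
      rw [mem_filter]
      exact ⟨hAS hi, if_pos hi⟩

lemma exists_forall_dvd_add {S : Finset ℕ} (hS : ∀ p ∈ S, p.Prime) (f : ℕ → ℕ) :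
    ∃ m < ∏ p ∈ S, p, ∀ p ∈ S, p ∣ m + f p := by
  have h0 : ∀ p ∈ S, id p ≠ 0 := fun p hp => (hS p hp).ne_zero
  have hco : Set.Pairwise (S : Set ℕ) (Function.onFun Nat.Coprime id) := fun p hp q hq hpq =>
    (Nat.coprime_primes (hS p hp) (hS q hq)).2 hpq
  refine ⟨Nat.chineseRemainderOfFinset (fun p => (p - 1) * f p) id S h0 hco,
    Nat.chineseRemainderOfFinset_lt_prod _ _ h0 hco, fun p hp => ?_⟩
  have h1 := (Nat.chineseRemainderOfFinset (fun p => (p - 1) * f p) id S h0 hco).2 p hp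
  have h2 : (p - 1) * f p + f p = p * f p := by
    rw [Nat.sub_mul, one_mul, Nat.sub_add_cancel (Nat.le_mul_of_pos_left _ (hS p hp).pos)]
  refine (Nat.modEq_zero_iff_dvd).1 ((h1.add_right (f p)).trans ?_)
  rw [h2]
  exact Nat.modEq_zero_iff_dvd.2 (dvd_mul_right p _)

lemma prod_one_add_div_le {C X : ℕ} (hX : 1 ≤ X) {S : Finset ℕ}
    (hS : ∀ p ∈ S, X < p ∧ p ≤ C * X) : ∏ p ∈ S, (1 + 8 / (p : ℝ)) ≤ Real.exp (8 * C) := by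
  have hX0 : (0 : ℝ) < X := by exact_mod_cast hX
  have hcard : (#S : ℝ) ≤ C * X := by
    have : S ⊆ Ioc 0 (C * X) := fun p hp => mem_Ioc.2 ⟨(Nat.zero_le _).trans_lt (hS p hp).1, (hS p hp).2⟩
    have := card_le_card this
    rw [Nat.card_Ioc] at this
    exact_mod_cast this
  calc ∏ p ∈ S, (1 + 8 / (p : ℝ)) ≤ ∏ _p ∈ S, Real.exp (8 / X) := by
        refine prod_le_prod (fun p _ => by positivity) fun p hp => ?_
        rw [add_comm]
        refine (Real.add_one_le_exp _).trans (Real.exp_le_exp.2 ?_)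
        gcongr
        exact (hS p hp).1.le
    _ = Real.exp (#S * (8 / X)) := by rw [prod_const, Real.exp_nat_mul]
    _ ≤ Real.exp (8 * C) := by
        rw [Real.exp_le_exp, mul_div_assoc', div_le_iff₀ hX0]
        linarith

namespace Eisenstein

section Modulus

variable {C X : ℕ} {S : Finset ℕ} {a : ℕ → ℤ}

lemma rmod3_le_of_isNormOfTrace (hX : 2 ≤ X) (hS : ∀ p ∈ S, X < p ∧ p ≤ C * X)
    (ha : ∀ p ∈ S, IsNormOfTrace p (a p)) {A : Finset ℕ} (hA : A ⊆ S) {m : ℤ}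
    (hm : ∀ p ∈ A, (p : ℤ) ∣ m) :
    (rmod3 m (2 * ∏ p ∈ S, p) : ℝ) ≤ ((2 * ∏ p ∈ S, p : ℕ) : ℝ) ^ 2 *
      (Real.exp (8 * C) * Real.exp (-(∑ p ∈ A, (a p / p : ℝ)) / 2)) := by
  rw [rmod3_two_mul_prod_primes (fun p hp => (ha p hp).1)
    (fun h => absurd (hS 2 h).1 (by omega))]
  have h1 : Real.exp (-(∑ p ∈ A, (a p / p : ℝ)) / 2) =
      ∏ p ∈ S, if p ∈ A then Real.exp (-(a p / p) / 2) else 1 := by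
    rw [← prod_filter, filter_mem_eq_inter, inter_eq_right.2 hA, ← Real.exp_sum, ← sum_div,
      sum_neg_distrib]
  push_cast
  rw [mul_pow, mul_assoc, ← prod_pow, h1, show ((2 : ℝ) ^ 2) = 4 by norm_num]
  refine mul_le_mul_of_nonneg_left ?_ (by norm_num)
  calc ∏ p ∈ S, (rmod3 m p : ℝ)
      ≤ ∏ p ∈ S, ((p : ℝ) ^ 2 * ((1 + 8 / p) *
          if p ∈ A then Real.exp (-(a p / p) / 2) else 1)) := by
        refine prod_le_prod (fun p _ => Nat.cast_nonneg _) fun p hp => ?_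
        rw [← mul_assoc]
        split_ifs with h
        · exact (ha p hp).rmod3_le_mul_exp (hm p h)
        · rw [mul_one]
          exact (ha p hp).rmod3_le m
    _ = (∏ p ∈ S, (p : ℝ) ^ 2) * ((∏ p ∈ S, (1 + 8 / (p : ℝ))) *
          ∏ p ∈ S, if p ∈ A then Real.exp (-(a p / p) / 2) else 1) := by
        rw [prod_mul_distrib, prod_mul_distrib]
    _ ≤ _ := by
        refine mul_le_mul_of_nonneg_left (mul_le_mul_of_nonneg_right
          (prod_one_add_div_le (by omega) hS) ?_) (prod_nonneg fun p _ => by positivity)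
        exact prod_nonneg fun p _ => by split_ifs <;> positivity

lemma div_four_le_sum_log (hX : 1 ≤ X) (hS : ∀ p ∈ S, X < p ∧ p ≤ C * X)
    (ha : ∀ p ∈ S, IsNormOfTrace p (a p))
    (h : 1 ≤ ∑ p ∈ S, 2 * Real.log p * (a p / √(p : ℝ)) / p) :
    (X : ℝ) / 4 ≤ ∑ p ∈ S, Real.log p := by
  have hX0 : (0 : ℝ) < X := by exact_mod_cast hX
  have h1 : ∑ p ∈ S, 2 * Real.log p * (a p / √(p : ℝ)) / p ≤ ∑ p ∈ S, Real.log p * (4 / X) := by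
    refine sum_le_sum fun p hp => ?_
    have hp0 : (0 : ℝ) < p := by exact_mod_cast (ha p hp).1.pos
    have hlog : 0 ≤ Real.log p := Real.log_natCast_nonneg p
    have h2 : a p / √(p : ℝ) ≤ 2 := by
      rw [div_le_iff₀ (Real.sqrt_pos.2 hp0)]
      exact (ha p hp).trace_le
    calc 2 * Real.log p * (a p / √(p : ℝ)) / p ≤ 2 * Real.log p * 2 / X := by
          have : (X : ℝ) ≤ p := by exact_mod_cast (hS p hp).1.le
          gcongr
      _ = Real.log p * (4 / X) := by ring
  rw [← sum_mul] at h1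
  have h3 := h.trans h1
  rw [mul_div_assoc', le_div_iff₀ hX0] at h3
  linarith

lemma sqrt_div_log_le_sum (hX : 2 ≤ X) (hS : ∀ p ∈ S, X < p ∧ p ≤ C * X)
    (ha : ∀ p ∈ S, IsNormOfTrace p (a p))
    (h : 1 ≤ ∑ p ∈ S, 2 * Real.log p * (a p / √(p : ℝ)) / p) :
    √(X : ℝ) ≤ 2 * Real.log (C * X) * ∑ p ∈ S, (a p / p : ℝ) := by
  have hX0 : (0 : ℝ) < X := by exact_mod_cast (by omega : 0 < X)
  have h1 : ∑ p ∈ S, 2 * Real.log p * (a p / √(p : ℝ)) / p ≤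
      ∑ p ∈ S, 2 * Real.log (C * X) / √(X : ℝ) * (a p / p : ℝ) := by
    refine sum_le_sum fun p hp => ?_
    have hp0 : (0 : ℝ) < p := by exact_mod_cast (ha p hp).1.pos
    have ha0 : (0 : ℝ) < a p := by exact_mod_cast (ha p hp).2.1
    have hlog : 0 ≤ Real.log p := Real.log_natCast_nonneg p
    have hpC : (p : ℝ) ≤ C * X := by exact_mod_cast (hS p hp).2
    calc 2 * Real.log p * (a p / √(p : ℝ)) / p = 2 * Real.log p / √(p : ℝ) * (a p / p) := by ring
      _ ≤ 2 * Real.log (C * X) / √(X : ℝ) * (a p / p : ℝ) := by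
          have : (X : ℝ) ≤ p := by exact_mod_cast (hS p hp).1.le
          have hlogC : 0 ≤ Real.log (C * X) := hlog.trans (Real.log_le_log hp0 hpC)
          gcongr
  rw [← mul_sum] at h1
  have h3 := h.trans h1
  rw [div_mul_eq_mul_div, le_div_iff₀ (Real.sqrt_pos.2 hX0)] at h3
  linarith

lemma sum_log_le (hS : ∀ p ∈ S, p.Prime ∧ p ≤ C * X) :
    ∑ p ∈ S, Real.log p ≤ Real.log 4 * (C * X) := by
  have h1 := Chebyshev.theta_le_log4_mul_x (x := (C * X : ℝ)) (by positivity)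
  refine le_trans ?_ h1
  rw [Chebyshev.theta]
  refine sum_le_sum_of_subset_of_nonneg (fun p hp => ?_) fun p _ _ => Real.log_natCast_nonneg p
  rw [mem_filter, mem_Ioc, ← Nat.cast_mul, Nat.floor_natCast]
  exact ⟨⟨(hS p hp).1.pos, (hS p hp).2⟩, (hS p hp).1⟩

/-- A modulus with few representations along a run of `K` residues. -/
lemma exists_modulus (hX : 2 ≤ X) (hC : 1 ≤ C) (hS : ∀ p ∈ S, X < p ∧ p ≤ C * X)
    (ha : ∀ p ∈ S, IsNormOfTrace p (a p))
    (h : 1 ≤ ∑ p ∈ S, 2 * Real.log p * (a p / √(p : ℝ)) / p) {K : ℕ} (hK : 1 ≤ K)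
    (hKX : K * (2 * Real.log (2 * Real.exp (8 * C) * K) + 2) * (2 * Real.log (C * X)) ≤
      √(X : ℝ)) :
    ∃ M m : ℕ, Even M ∧ 2 * m < M ∧ (X : ℝ) / 4 ≤ Real.log M ∧
      Real.log M ≤ Real.log 4 * (C * X) + Real.log 2 ∧
      (∀ k < K, (rmod3 ((m : ℤ) + (k : ℤ)) M : ℝ) ≤ (M : ℝ) ^ 2 / (2 * K)) ∧
      ∀ m' : ℤ, (rmod3 m' M : ℝ) ≤ (M : ℝ) ^ 2 * Real.exp (8 * C) := by
  have hK0 : (1 : ℝ) ≤ K := by exact_mod_cast hK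
  have hB : 1 ≤ Real.exp (8 * C) := Real.one_le_exp (by positivity)
  have hL : 0 ≤ 2 * Real.log (2 * Real.exp (8 * C) * K) := by
    refine mul_nonneg (by norm_num) (Real.log_nonneg ?_)
    nlinarith
  have hlog : 0 < 2 * Real.log (C * X) := by
    refine mul_pos (by norm_num) (Real.log_pos ?_)
    exact_mod_cast (by nlinarith : 1 < C * X)
  have hw : ∀ p ∈ S, 0 ≤ (a p / p : ℝ) ∧ (a p / p : ℝ) ≤ 2 := fun p hp => by
    have hp0 : (1 : ℝ) ≤ p := by exact_mod_cast (ha p hp).1.one_lt.le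
    have ha0 : (0 : ℝ) < a p := by exact_mod_cast (ha p hp).2.1
    refine ⟨by positivity, ?_⟩
    rw [div_le_iff₀ (by positivity)]
    exact (ha p hp).trace_le.trans
      (mul_le_mul_of_nonneg_left (Real.sqrt_le_self_iff.2 (Or.inr hp0)) (by norm_num))
  obtain ⟨f, hf⟩ := exists_forall_le_sum_filter hL (by norm_num : (0 : ℝ) ≤ 2) K S hw (by
    have := hKX.trans (sqrt_div_log_le_sum hX hS ha h)
    rw [mul_comm (2 * Real.log (C * X))] at this
    exact le_of_mul_le_mul_right this hlog)
  obtain ⟨m, hmlt, hm⟩ := exists_forall_dvd_add (fun p hp => (ha p hp).1) f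
  have hlogM : Real.log ((2 * ∏ p ∈ S, p : ℕ) : ℝ) = Real.log 2 + ∑ p ∈ S, Real.log p := by
    push_cast
    have h0 : ∀ p ∈ S, (p : ℝ) ≠ 0 := fun p hp => Nat.cast_ne_zero.2 (ha p hp).1.ne_zero
    rw [Real.log_mul two_ne_zero (prod_ne_zero_iff.2 h0), Real.log_prod h0]
  have hlog2 := Real.log_nonneg (one_le_two : (1 : ℝ) ≤ 2)
  refine ⟨2 * ∏ p ∈ S, p, m, even_two_mul _, by omega, ?_, ?_, fun k hk => ?_, fun m' => ?_⟩
  · rw [hlogM]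
    linarith [div_four_le_sum_log (by omega) hS ha h]
  · rw [hlogM]
    linarith [sum_log_le fun p hp => ⟨(ha p hp).1, (hS p hp).2⟩]
  · refine (rmod3_le_of_isNormOfTrace hX hS ha (filter_subset (fun p => f p = k) S)
      fun p hp => ?_).trans ?_
    · obtain ⟨hpS, rfl⟩ := mem_filter.1 hp
      exact_mod_cast hm p hpS
    · rw [div_eq_mul_inv]
      refine mul_le_mul_of_nonneg_left ?_ (by positivity)
      have h1 : Real.exp (-(∑ p ∈ S with f p = k, (a p / p : ℝ)) / 2) ≤
          (2 * Real.exp (8 * C) * K)⁻¹ := by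
        rw [← Real.exp_log (by positivity : 0 < 2 * Real.exp (8 * C) * K), ← Real.exp_neg,
          Real.exp_le_exp]
        linarith [hf k hk]
      refine (mul_le_mul_of_nonneg_left h1 (Real.exp_pos _).le).trans_eq ?_
      field_simp
  · have := rmod3_le_of_isNormOfTrace hX hS ha (empty_subset S) (m := m') (by simp)
    simpa using this

end Modulus

end Eisenstein

lemma eventually_sqrt_div_log_sq :
    ∀ᶠ T : ℝ in Filter.atTop, 16 ≤ √T / Real.log T ^ 2 := by
  have h := (isLittleO_log_rpow_rpow_atTop (s := 1 / 2) 2 (by norm_num)).bound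
    (by norm_num : (0 : ℝ) < 1 / 16)
  filter_upwards [h, Filter.eventually_gt_atTop 1] with T h hT
  have hlog := Real.log_pos hT
  rw [Real.norm_of_nonneg (by positivity), Real.norm_of_nonneg (by positivity),
    ← Real.sqrt_eq_rpow, Real.rpow_two] at h
  rw [le_div_iff₀ (by positivity)]
  linarith

lemma eventually_four_sqrt_lt_exp :
    ∀ᶠ T : ℝ in Filter.atTop, 4 * √T < Real.exp (T / 4) := by
  filter_upwards [Filter.eventually_gt_atTop (1024 : ℝ)] with T hT
  have h1 : 1 ≤ √T := Real.one_le_sqrt.2 (by linarith)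
  have h3 := Real.quadratic_le_exp_of_nonneg (by linarith : 0 ≤ T / 4)
  have h4 : √T ≤ T := Real.sqrt_le_self_iff.2 (Or.inr (by linarith))
  nlinarith

/-- Key input from Waring's problem for cubes: existence of moduli `M` with
long runs of residues having few representations as sums of three cubes. -/
theorem waring_cubes_modular_gaps :
    ∃ C₀ C₁ C₂ C₃ T₀ : ℝ, 0 < C₀ ∧ 0 < C₁ ∧ 0 < C₂ ∧ 0 < C₃ ∧ 0 < T₀ ∧
      ∀ T : ℝ, T₀ ≤ T →
        ∃ M m K₁ : ℕ, Even M ∧ 2 * m < M ∧ 4 * K₁ < M ∧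
          (C₀ * T ≤ Real.log M ∧ Real.log M ≤ C₁ * T) ∧
          C₂ * (Real.sqrt T / (Real.log T) ^ 2) ≤ (K₁ : ℝ) ∧
          (∀ k < K₁, (rmod3 ((m : ℤ) + (k : ℤ)) M : ℝ) ≤
            (M : ℝ) ^ 2 / (2 * (K₁ : ℝ))) ∧
          (∀ m' : ℤ, (rmod3 m' M : ℝ) ≤ (Real.log T) ^ (C₃ : ℝ) * (M : ℝ) ^ 2) := by
  obtain ⟨C, X₀, hC, hX₀, hmain⟩ := Eisenstein.exists_primes_positive_trace
  have hCpos : (0 : ℝ) < C := by exact_mod_cast (by omega : 0 < C)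
  have hlog4 : 0 < Real.log 4 := Real.log_pos (by norm_num)
  set B := Real.exp (8 * C) with hB
  have hev : ∀ᶠ T : ℝ in Filter.atTop, 2 ≤ T ∧ (X₀ : ℝ) ≤ T ∧ (2 * C : ℝ) ≤ T ∧
      B ≤ Real.log T ∧ 2 * Real.log (2 * B) ≤ Real.log T ∧ 16 ≤ √T / Real.log T ^ 2 ∧
      4 * √T < Real.exp (T / 4) := by
    simp only [Filter.eventually_and]
    exact ⟨Filter.eventually_ge_atTop _, Filter.eventually_ge_atTop _,
      Filter.eventually_ge_atTop _, Real.tendsto_log_atTop.eventually_ge_atTop _,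
      Real.tendsto_log_atTop.eventually_ge_atTop _, eventually_sqrt_div_log_sq,
      eventually_four_sqrt_lt_exp⟩
  obtain ⟨T₀, hT₀⟩ := Filter.eventually_atTop.1 hev
  refine ⟨1 / 4, 2 * C * Real.log 4 + 1, 1 / 32, 1, max T₀ 1, by norm_num, by positivity,
    by norm_num, one_pos, by positivity, fun T hT => ?_⟩
  obtain ⟨hT2, hTX, hTC, hTB, hTB2, hT16, hTexp⟩ := hT₀ T ((le_max_left _ _).trans hT)
  have hB1 : 1 ≤ B := Real.one_le_exp (by positivity)
  have hlogT : 1 ≤ Real.log T := hB1.trans hTB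
  have hTX' : T ≤ (⌈T⌉₊ : ℝ) := Nat.le_ceil T
  have hXT : (⌈T⌉₊ : ℝ) ≤ 2 * T := by linarith [Nat.ceil_lt_add_one (by linarith : 0 ≤ T)]
  have hX2 : 2 ≤ ⌈T⌉₊ := by exact_mod_cast hT2.trans hTX'
  obtain ⟨S, a, hSa, hsum⟩ := hmain ⌈T⌉₊ (by exact_mod_cast hTX.trans hTX')
  set Y := √T / Real.log T ^ 2 with hY
  have hsqrt : 0 < √T := Real.sqrt_pos.2 (by linarith)
  have hK1 : 1 ≤ ⌊Y / 16⌋₊ := Nat.le_floor (by push_cast; linarith)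
  have hKle : (⌊Y / 16⌋₊ : ℝ) ≤ Y / 16 := Nat.floor_le (by positivity)
  have hK1' : (1 : ℝ) ≤ ⌊Y / 16⌋₊ := by exact_mod_cast hK1
  have hKge : Y / 32 ≤ (⌊Y / 16⌋₊ : ℝ) := by
    linarith [Nat.lt_floor_add_one (Y / 16)]
  have hYs : Y ≤ √T := div_le_self hsqrt.le (one_le_pow₀ hlogT)
  set K := ⌊Y / 16⌋₊ with hK
  have hlogK0 : 0 ≤ Real.log (2 * B * K) := Real.log_nonneg (by nlinarith)
  have hlogK : 2 * Real.log (2 * B * K) ≤ 2 * Real.log T := by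
    rw [Real.log_mul (by positivity) (by positivity)]
    have : Real.log K ≤ Real.log √T := Real.log_le_log (by positivity) (by linarith)
    rw [Real.log_sqrt (by linarith)] at this
    linarith
  have hlogCX : Real.log (C * ⌈T⌉₊) ≤ 2 * Real.log T := by
    rw [← Real.log_rpow (by linarith), Real.rpow_two]
    exact Real.log_le_log (by positivity) (by nlinarith)
  have hlogCX0 : 0 ≤ Real.log (C * ⌈T⌉₊) := by
    rw [← Nat.cast_mul]; exact Real.log_natCast_nonneg _
  obtain ⟨M, m, hMe, hmM, hlogM, hlogM', hgap, hall⟩ := Eisenstein.exists_modulus hX2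
    (by omega) (fun p hp => ⟨(hSa p hp).2.1, (hSa p hp).2.2.1⟩)
    (fun p hp => ⟨(hSa p hp).1, (hSa p hp).2.2.2⟩) hsum hK1 (by
      calc K * (2 * Real.log (2 * Real.exp (8 * C) * K) + 2) * (2 * Real.log (C * ⌈T⌉₊))
          ≤ Y / 16 * (2 * Real.log T + 2 * Real.log T) * (2 * (2 * Real.log T)) := by
            gcongr
            all_goals linarith
        _ = √T := by
            rw [hY]
            field_simp
            ring
        _ ≤ √(⌈T⌉₊ : ℝ) := Real.sqrt_le_sqrt hTX')
  have hM0 : (0 : ℝ) < M := by exact_mod_cast (by omega : 0 < M)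
  refine ⟨M, m, K, hMe, hmM, ?_, ⟨by linarith, ?_⟩, by linarith, hgap, fun m' => ?_⟩
  · have h1 : Real.exp (T / 4) ≤ M := by
      rw [← Real.le_log_iff_exp_le hM0]
      linarith
    have h2 : (4 * K : ℝ) < M := by linarith
    exact_mod_cast h2
  · have h1 : Real.log 2 ≤ 1 := by linarith [Real.log_two_lt_d9]
    have h2 : Real.log 4 * (C * ⌈T⌉₊) ≤ Real.log 4 * (C * (2 * T)) := by gcongr
    linarith
  · rw [Real.rpow_one, mul_comm]
    exact (hall m').trans (mul_le_mul_of_nonneg_left hTB (by positivity))
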